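/- Let k be a non-archimedean local field of characteristic ≠ 2, let M be a semi-simple module with M¹ ≠ 0, and let q be a quadratic space over k with dim(q) = dim_k(M). Then q has an isometry with module M if and only if det(q)·F_M(1)·F_M(−1) is a square in k (possibly 0). -/

import Mathlib

open Polynomial

noncomputable section

variable {k : Type} [Field k]

/-- `f*(X) = f(0)⁻¹ X^{deg f} f(1/X)`. -/
def starPoly (f : k[X]) : k[X] := Polynomial.C (f.coeff 0)⁻¹ * f.reverse

/-- Type 0 : a product of powers of `X - 1` and `X + 1`. -/
def IsType0Pol (f : k[X]) : Prop := ∃ a b : ℕ, f = (X - 1 : k[X]) ^ a * (X + 1) ^ b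

/-- Type 1 : a product of (powers of) monic symmetric irreducible polynomials of even degree. -/
def IsType1Pol (f : k[X]) : Prop :=
  ∃ s : Multiset k[X],
    (∀ g ∈ s, g.Monic ∧ Irreducible g ∧ g = g.reverse ∧ Even g.natDegree) ∧ f = s.prod

/-- Type 2 : a product of polynomials `g * g*` with `g` monic irreducible, `g ≠ ±g*`. -/
def IsType2Pol (f : k[X]) : Prop :=
  ∃ s : Multiset k[X],
    (∀ g ∈ s, g.Monic ∧ Irreducible g ∧ g ≠ starPoly g ∧ g ≠ -starPoly g) ∧
    f = (s.map fun g => g * starPoly g).prod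

/-- A monic polynomial is hyperbolic if it is of the form `G·G*`; equivalently, all its
components of type 0 and 1 occur with an even exponent. -/
def IsHyperbolicPoly (f : k[X]) : Prop := ∃ g : k[X], g.Monic ∧ f = g * starPoly g

/-- Data describing a self-dual torsion `k[X]`-module which is finite dimensional over `k`:
the direct sum, over `i`, of `[k[X]/(f i ^ e i)]^(n i)`, where each `f i` is monic
irreducible, and where the collection is self-dual (stable under `f ↦ f*`). -/
structure ModuleData (k : Type) [Field k] where
  ι : Type
  [fin : Fintype ι]
  f : ι → k[X]
  e : ι → ℕ
  n : ι → ℕ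
  monic : ∀ i, (f i).Monic
  irr : ∀ i, Irreducible (f i)
  epos : ∀ i, 0 < e i
  npos : ∀ i, 0 < n i
  selfdual : ∃ σ : Equiv.Perm ι,
    ∀ i, f (σ i) = starPoly (f i) ∧ e (σ i) = e i ∧ n (σ i) = n i

attribute [instance] ModuleData.fin

namespace ModuleData

variable (D : ModuleData k)

/-- The underlying `K[X]`-module of `M ⊗_k K`, realised concretely, for an extension
`ι : k →+* K`. -/
abbrev SpaceVia {K : Type} [Field K] (ι : k →+* K) : Type :=
  (i : D.ι) → Fin (D.n i) →
    (Polynomial K ⧸ Ideal.span {((D.f i).map ι) ^ D.e i})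

/-- The dimension of `M` as a `k`-vector space. -/
def dim : ℕ := ∑ i, D.n i * (D.e i * (D.f i).natDegree)

/-- The characteristic polynomial `F_M` of `M`. -/
def charPoly : k[X] := ∏ i, D.f i ^ (D.n i * D.e i)

/-- The summand `i` is of type 0 : `f i` is `X - 1` or `X + 1`. -/
def IsIdx0 (i : D.ι) : Prop := D.f i = X - 1 ∨ D.f i = X + 1

/-- The summand `i` is of type 1 : `f i` is symmetric of even degree. -/
def IsIdx1 (i : D.ι) : Prop := D.f i = (D.f i).reverse ∧ Even (D.f i).natDegree

/-- The summand `i` is of type 2 : `f i` is not self-dual. -/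
def IsIdx2 (i : D.ι) : Prop := D.f i ≠ starPoly (D.f i)

open Classical in
/-- `dim_k M⁰`. -/
def dim0 : ℕ := ∑ i, if D.IsIdx0 i then D.n i * (D.e i * (D.f i).natDegree) else 0

open Classical in
/-- `dim_k M¹`. -/
def dim1 : ℕ := ∑ i, if D.IsIdx1 i then D.n i * (D.e i * (D.f i).natDegree) else 0

open Classical in
/-- `dim_k M²`. -/
def dim2 : ℕ := ∑ i, if D.IsIdx2 i then D.n i * (D.e i * (D.f i).natDegree) else 0

/-- `M` is semi-simple : all exponents are 1. -/
def Semisimple : Prop := ∀ i, D.e i = 1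

/-- `M̄_odd` : the direct sum of the summands `[k[X]/(f)]^n`, over those summands
`[k[X]/(f^e)]^n` of `M` with `e` odd and `f` self-dual (`f = f*`). -/
def oddBar : ModuleData k where
  ι := {i : D.ι // Odd (D.e i) ∧ D.f i = starPoly (D.f i)}
  fin := by classical exact inferInstance
  f i := D.f i.1
  e _ := 1
  n i := D.n i.1
  monic i := D.monic i.1
  irr i := D.irr i.1
  epos _ := one_pos
  npos i := D.npos i.1
  selfdual := ⟨Equiv.refl _, fun i => ⟨i.2.2, rfl, rfl⟩⟩

end ModuleData

theorem starPoly_eq_self_of_symm {f : k[X]} (hm : f.Monic) (hs : f = f.reverse) :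
    starPoly f = f := by
  have h0 : f.coeff 0 = 1 := by
    conv_lhs => rw [hs]
    rw [Polynomial.coeff_zero_reverse]
    exact hm
  rw [starPoly, h0, inv_one, map_one, one_mul, ← hs]

/-- The module `[k[X]/(f)]^m` for a monic symmetric irreducible `f`. -/
def ModuleData.single (f : k[X]) (hmon : f.Monic) (hirr : Irreducible f)
    (hsym : f = f.reverse) (m : ℕ) (hm : 0 < m) : ModuleData k where
  ι := Unit
  fin := inferInstance
  f _ := f
  e _ := 1
  n _ := m
  monic _ := hmon
  irr _ := hirr
  epos _ := one_pos
  npos _ := hm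
  selfdual := ⟨Equiv.refl _, fun _ => ⟨(starPoly_eq_self_of_symm hmon hsym).symm, rfl, rfl⟩⟩

section Bilin

variable {V : Type} [AddCommGroup V] [Module k V]

/-- `t` is an isometry of the bilinear space `(V, B)`. -/
def IsIsometryOf (B : LinearMap.BilinForm k V) (t : V ≃ₗ[k] V) : Prop :=
  ∀ x y, B (t x) (t y) = B x y

/-- `(V, B)` is a quadratic space : `B` is a symmetric bilinear form of non-zero
determinant (equivalently, non-degenerate). -/
def IsQuadraticSpace (B : LinearMap.BilinForm k V) : Prop :=
  (∀ x y, B x y = B y x) ∧ (∀ x, (∀ y, B x y = 0) → x = 0)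

/-- The bilinear space `(W, B)` over an extension `ι : k →+* K` has an isometry whose
associated `K[X]`-module is `M ⊗_k K`. -/
def HasIsometryWithModuleVia {K : Type} [Field K] (ι : k →+* K)
    {W : Type} [AddCommGroup W] [Module K W]
    (B : LinearMap.BilinForm K W) (D : ModuleData k) : Prop :=
  ∃ t : W ≃ₗ[K] W, IsIsometryOf B t ∧
    ∃ φ : W ≃ₗ[K] D.SpaceVia ι, ∀ w, φ (t w) = (X : Polynomial K) • φ w

/-- `(V, B)` has an isometry with module `M`. -/
def HasIsometryWithModule (B : LinearMap.BilinForm k V) (D : ModuleData k) : Prop :=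
  HasIsometryWithModuleVia (RingHom.id k) B D

/-- The bilinear space `(W, B)` over an extension `ι : k →+* K` has an isometry with
minimal polynomial (the image of) `f`. -/
def HasIsometryWithMinpolyVia {K : Type} [Field K] (ι : k →+* K)
    {W : Type} [AddCommGroup W] [Module K W]
    (B : LinearMap.BilinForm K W) (f : k[X]) : Prop :=
  ∃ t : W ≃ₗ[K] W, IsIsometryOf B t ∧ minpoly K t.toLinearMap = f.map ι

/-- `(V, B)` has an isometry with minimal polynomial `f`. -/
def HasIsometryWithMinpoly (B : LinearMap.BilinForm k V) (f : k[X]) : Prop :=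
  ∃ t : V ≃ₗ[k] V, IsIsometryOf B t ∧ minpoly k t.toLinearMap = f

/-- A (2n)-dimensional quadratic space is hyperbolic if it has a self-orthogonal subspace
of dimension n. -/
def IsHyperbolicSpace (B : LinearMap.BilinForm k V) : Prop :=
  ∃ W : Submodule k V, (∀ x ∈ W, ∀ y ∈ W, B x y = 0) ∧
    2 * Module.finrank k W = Module.finrank k V

/-- The Witt index : the largest dimension of a totally isotropic subspace. -/
def wittIndex (B : LinearMap.BilinForm k V) : ℕ :=
  sSup {m | ∃ W : Submodule k V, (∀ x ∈ W, ∀ y ∈ W, B x y = 0) ∧ Module.finrank k W = m}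

variable [FiniteDimensional k V]

/-- The Gram matrix of `B` with respect to a fixed basis. -/
def gramOf (B : LinearMap.BilinForm k V) :
    Matrix (Fin (Module.finrank k V)) (Fin (Module.finrank k V)) k :=
  LinearMap.toMatrix₂ (Module.finBasis k V) (Module.finBasis k V) B

/-- The determinant of `B` (well defined modulo nonzero squares). -/
def detOf (B : LinearMap.BilinForm k V) : k := (gramOf B).det

end Bilin

namespace QuadraticSpace

open QuadraticMap

section Witt

variable {V W U : Type} [AddCommGroup V] [Module k V] [AddCommGroup W] [Module k W]
  [AddCommGroup U] [Module k U]

/-- The polar form of `Q` is nondegenerate. -/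
def Nondeg (Q : QuadraticForm k V) : Prop := ∀ x, (∀ y, polar Q x y = 0) → x = 0

/-- The one-dimensional form `a X²`. -/
def oneDim (a : k) : QuadraticForm k k := a • QuadraticMap.sq

@[simp] theorem oneDim_apply (a x : k) : oneDim a x = a * (x * x) := by
  simp [oneDim]

/-- The restriction of `Q` to the orthogonal complement of `u`. -/
def perp (Q : QuadraticForm k V) (u : V) : QuadraticForm k (LinearMap.ker (Q.polarBilin u)) :=
  Q.comp (LinearMap.ker (Q.polarBilin u)).subtype

@[simp] theorem perp_apply (Q : QuadraticForm k V) (u : V) (x) : perp Q u x = Q (x : V) := rfl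

theorem map_add_eq (Q : QuadraticForm k V) (x y : V) : Q (x + y) = Q x + Q y + polar Q x y := by
  simp [polar]

theorem map_smul_eq (Q : QuadraticForm k V) (a : k) (x : V) : Q (a • x) = a * a * Q x := by
  rw [QuadraticMap.map_smul, smul_eq_mul]

theorem map_lin_comb (Q : QuadraticForm k V) (a b : k) (x y : V) :
    Q (a • x + b • y) = a * a * Q x + b * b * Q y + a * b * polar Q x y := by
  rw [map_add_eq, map_smul_eq, map_smul_eq, polar_smul_left, polar_smul_right]
  simp only [smul_eq_mul]; ring

theorem polar_self' (Q : QuadraticForm k V) (x : V) : polar Q x x = 2 * Q x := by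
  rw [polar_self]; simp

theorem polar_prod (Q₁ : QuadraticForm k V) (Q₂ : QuadraticForm k W) (x y : V × W) :
    polar (Q₁.prod Q₂) x y = polar Q₁ x.1 y.1 + polar Q₂ x.2 y.2 := by
  simp only [polar, QuadraticMap.prod_apply, Prod.fst_add, Prod.snd_add]; ring

theorem polar_map {Q₁ : QuadraticForm k V} {Q₂ : QuadraticForm k W} (e : Q₁.IsometryEquiv Q₂)
    (x y : V) : polar Q₂ (e x) (e y) = polar Q₁ x y := by
  simp only [polar, ← map_add, e.map_app]

theorem nondeg_of_equivalent {Q₁ : QuadraticForm k V} {Q₂ : QuadraticForm k W}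
    (h : Q₁.Equivalent Q₂) (h₁ : Nondeg Q₁) : Nondeg Q₂ := by
  obtain ⟨e⟩ := h
  intro x hx
  have : e.symm x = 0 := h₁ _ fun y => by
    rw [← polar_map e, ← hx (e y)]
    congr 1
    exact e.toLinearEquiv.apply_symm_apply x
  have h2 := congrArg e this
  rw [show e (e.symm x) = x from e.toLinearEquiv.apply_symm_apply x] at h2
  simpa using h2

theorem nondeg_prod {Q₁ : QuadraticForm k V} {Q₂ : QuadraticForm k W} :
    Nondeg (Q₁.prod Q₂) ↔ Nondeg Q₁ ∧ Nondeg Q₂ := by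
  constructor
  · intro h
    refine ⟨fun x hx => ?_, fun x hx => ?_⟩
    · have := h (x, 0) fun y => by rw [polar_prod]; simp [hx]
      simpa using congrArg Prod.fst this
    · have := h (0, x) fun y => by rw [polar_prod]; simp [hx]
      simpa using congrArg Prod.snd this
  · rintro ⟨h₁, h₂⟩ x hx
    refine Prod.ext (h₁ _ fun y => ?_) (h₂ _ fun y => ?_)
    · simpa [polar_prod] using hx (y, 0)
    · simpa [polar_prod] using hx (0, y)

theorem nondeg_neg {Q : QuadraticForm k V} (h : Nondeg Q) : Nondeg (-Q) := fun x hx =>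
  h x fun y => by simpa [polar_neg] using hx y

theorem anisotropic_of_equivalent {Q₁ : QuadraticForm k V} {Q₂ : QuadraticForm k W}
    (h : Q₁.Equivalent Q₂) (h₁ : Q₁.Anisotropic) : Q₂.Anisotropic := by
  obtain ⟨e⟩ := h
  intro x hx
  have := h₁ (e.symm x) (by rw [e.symm.map_app, hx])
  have h2 := congrArg e this
  rw [show e (e.symm x) = x from e.toLinearEquiv.apply_symm_apply x] at h2
  simpa using h2

/-- Splitting off an anisotropic vector. -/
def splitEquiv (h2 : (2 : k) ≠ 0) (Q : QuadraticForm k V) (u : V) (hu : Q u ≠ 0) :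
    ((oneDim (Q u)).prod (perp Q u)).IsometryEquiv Q where
  toFun p := p.1 • u + (p.2 : V)
  invFun x := (polar Q u x / (2 * Q u), ⟨x - (polar Q u x / (2 * Q u)) • u, by
    have := polar_self' Q u
    simp only [LinearMap.mem_ker, polarBilin_apply_apply, polar_sub_right, polar_smul_right, this,
      smul_eq_mul]
    field_simp; ring⟩)
  left_inv := by
    rintro ⟨a, x, hx⟩
    have hx' : polar Q u x = 0 := by simpa using hx
    have : polar Q u (a • u + x) / (2 * Q u) = a := by
      rw [polar_add_right, polar_smul_right, polar_self', hx']
      simp only [smul_eq_mul]; field_simp; ring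
    simp only [this]
    ext <;> simp
  right_inv x := by simp
  map_add' p q := by simp [add_smul]; abel
  map_smul' a p := by simp [mul_smul]
  map_app' := by
    rintro ⟨a, x, hx⟩
    have hx' : polar Q u x = 0 := by simpa using hx
    have := map_lin_comb Q a 1 u x
    simp only [one_smul, hx'] at this
    simp only [this, QuadraticMap.prod_apply, oneDim_apply, perp_apply]
    ring

theorem split (h2 : (2 : k) ≠ 0) (Q : QuadraticForm k V) {u : V} {a : k} (hu : Q u = a)
    (ha : a ≠ 0) : ((oneDim a).prod (perp Q u)).Equivalent Q := by
  subst hu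
  exact ⟨splitEquiv h2 Q u ha⟩

theorem finrank_perp [FiniteDimensional k V] (h2 : (2 : k) ≠ 0) (Q : QuadraticForm k V) {u : V}
    (hu : Q u ≠ 0) :
    Module.finrank k (LinearMap.ker (Q.polarBilin u)) + 1 = Module.finrank k V := by
  have := (splitEquiv h2 Q u hu).toLinearEquiv.finrank_eq
  rw [Module.finrank_prod, Module.finrank_self] at this
  omega

theorem nondeg_perp (h2 : (2 : k) ≠ 0) {Q : QuadraticForm k V} (hQ : Nondeg Q) {u : V}
    (hu : Q u ≠ 0) : Nondeg (perp Q u) :=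
  (nondeg_prod.1 (nondeg_of_equivalent (split h2 Q rfl hu).symm hQ)).2

theorem exists_ne_zero {Q : QuadraticForm k V} (hQ : Nondeg Q)
    [Nontrivial V] : ∃ u, Q u ≠ 0 := by
  by_contra! h
  obtain ⟨x, hx⟩ := exists_ne (0 : V)
  exact hx (hQ x fun y => by simp [polar, h])

/-- The reflection of vector `w`. -/
def reflection (Q : QuadraticForm k V) (w : V) (hw : Q w ≠ 0) : Q.IsometryEquiv Q :=
  have key (x : V) : polar Q w (x - (polar Q w x / Q w) • w) = - polar Q w x := by
    rw [polar_sub_right, polar_smul_right, polar_self', smul_eq_mul]; field_simp; ring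
  { toFun := fun x => x - (polar Q w x / Q w) • w
    invFun := fun x => x - (polar Q w x / Q w) • w
    left_inv := fun x => by
      simp only [key]; rw [neg_div, neg_smul]; abel
    right_inv := fun x => by
      simp only [key]; rw [neg_div, neg_smul]; abel
    map_add' := fun x y => by
      simp only [polar_add_right, add_div, add_smul]; abel
    map_smul' := fun a x => by
      simp only [polar_smul_right, smul_eq_mul, RingHom.id_apply, smul_sub, smul_smul,
        mul_div_assoc]
    map_app' := fun x => by
      have := map_lin_comb Q 1 (-(polar Q w x / Q w)) x w
      simp only [one_smul, neg_smul, ← sub_eq_add_neg] at this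
      change Q (x - (polar Q w x / Q w) • w) = Q x
      rw [this, polar_comm Q x w]
      field_simp; ring }

theorem reflection_apply (Q : QuadraticForm k V) (w : V) (hw : Q w ≠ 0) (x : V) :
    reflection Q w hw x = x - (polar Q w x / Q w) • w := rfl

/-- Isometries act transitively on vectors of a given nonzero length. -/
theorem exists_isometry_map (h2 : (2 : k) ≠ 0) (Q : QuadraticForm k V) {u v : V} (huv : Q u = Q v)
    (hu : Q u ≠ 0) : ∃ e : Q.IsometryEquiv Q, e u = v := by
  have hs : Q (u - v) = 2 * Q u - polar Q u v := by
    have := map_lin_comb Q 1 (-1) u v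
    simp only [one_smul, neg_smul, ← sub_eq_add_neg] at this
    rw [this, ← huv]; ring
  have ha : Q (u + v) = 2 * Q u + polar Q u v := by
    rw [map_add_eq, ← huv]; ring
  by_cases h : Q (u - v) = 0
  · have h' : Q (u + v) ≠ 0 := by
      intro h'
      apply hu
      have : (2 * 2) * Q u = 0 := by linear_combination h + h' - hs - ha
      simpa [h2] using this
    refine ⟨(reflection Q (u + v) h').trans
      { LinearEquiv.neg k with map_app' := fun m => by simp }, ?_⟩
    have h3 : polar Q (u + v) u / Q (u + v) = 1 := by
      rw [div_eq_one_iff_eq h', ha, polar_add_left, polar_self', polar_comm Q v u]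
    show -(reflection Q (u + v) h' u) = v
    rw [reflection_apply, h3]; simp
  · refine ⟨reflection Q (u - v) h, ?_⟩
    have h3 : polar Q (u - v) u / Q (u - v) = 1 := by
      rw [div_eq_one_iff_eq h, hs, polar_sub_left, polar_self', polar_comm Q v u]
    rw [reflection_apply, h3]; simp

theorem cancel_oneDim (h2 : (2 : k) ≠ 0) {a : k} (ha : a ≠ 0) {Q₁ : QuadraticForm k V}
    {Q₂ : QuadraticForm k W}
    (h : ((oneDim a).prod Q₁).Equivalent ((oneDim a).prod Q₂)) : Q₁.Equivalent Q₂ := by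
  obtain ⟨e⟩ := h
  obtain ⟨r, hr⟩ := exists_isometry_map h2 ((oneDim a).prod Q₂) (u := e (1, 0)) (v := (1, 0))
    (by rw [e.map_app]; simp) (by rw [e.map_app]; simpa using ha)
  set g := e.trans r with hg
  have hg1 : g (1, 0) = (1, 0) := hr
  have hg2 : g.symm (1, 0) = (1, 0) := by
    rw [← hg1]; exact g.toLinearEquiv.symm_apply_apply _
  have pol {X : Type} [AddCommGroup X] [Module k X] (Q : QuadraticForm k X) (p : k × X) :
      polar ((oneDim a).prod Q) (1, 0) p = 2 * a * p.1 := by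
    rw [polar_prod]; simp only [polar, oneDim_apply]; simp; ring
  have h1 : ∀ x : V, (g (0, x)).1 = 0 := fun x => by
    have := polar_map g (1, 0) (0, x)
    rw [hg1, pol, pol] at this
    simpa [h2, ha] using this
  have h1' : ∀ x : W, (g.symm (0, x)).1 = 0 := fun x => by
    have := polar_map g.symm (1, 0) (0, x)
    rw [hg2, pol, pol] at this
    simpa [h2, ha] using this
  have hx : ∀ x : V, g (0, x) = (0, (g (0, x)).2) := fun x => Prod.ext (h1 x) rfl
  have hx' : ∀ x : W, g.symm (0, x) = (0, (g.symm (0, x)).2) := fun x => Prod.ext (h1' x) rfl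
  exact ⟨{ toFun := fun x => (g (0, x)).2
           invFun := fun x => (g.symm (0, x)).2
           map_add' := fun x y => by
             rw [← Prod.snd_add, ← map_add]; simp
           map_smul' := fun c x => by
             simp only [RingHom.id_apply]
             rw [← Prod.smul_snd, ← map_smul]; simp
           left_inv := fun x => by
             simp only
             rw [← hx x, show g.symm (g (0, x)) = (0, x) from g.toLinearEquiv.symm_apply_apply _]
           right_inv := fun x => by
             simp only
             rw [← hx' x, show g (g.symm (0, x)) = (0, x) from g.toLinearEquiv.apply_symm_apply _]
           map_app' := fun x => by
             have := g.map_app (0, x)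
             rw [hx x] at this
             simpa using this }⟩

theorem prod_assoc_equivalent (Q₁ : QuadraticForm k V) (Q₂ : QuadraticForm k W)
    (Q₃ : QuadraticForm k U) :
    ((Q₁.prod Q₂).prod Q₃).Equivalent (Q₁.prod (Q₂.prod Q₃)) :=
  ⟨{ LinearEquiv.prodAssoc k V W U with
     map_app' := fun x => by simp [add_assoc] }⟩

/-- Witt cancellation. -/
theorem cancel (h2 : (2 : k) ≠ 0) (n : ℕ) : ∀ {X : Type} [AddCommGroup X] [Module k X]
    [FiniteDimensional k X] (Q : QuadraticForm k X), Module.finrank k X = n → Nondeg Q →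
    ∀ {Q₁ : QuadraticForm k V} {Q₂ : QuadraticForm k W},
      (Q.prod Q₁).Equivalent (Q.prod Q₂) → Q₁.Equivalent Q₂ := by
  induction n with
  | zero =>
    intro X _ _ _ Q hX hQ Q₁ Q₂ h
    have : Subsingleton X := Module.finrank_zero_iff.1 hX
    have aux {Y : Type} [AddCommGroup Y] [Module k Y] (Q' : QuadraticForm k Y) :
        (Q.prod Q').Equivalent Q' :=
      letI : Unique X := ⟨⟨0⟩, fun _ => Subsingleton.elim _ _⟩
      ⟨{ LinearEquiv.uniqueProd (R := k) (M := Y) (M₂ := X) with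
         map_app' := fun p => by
           have : p.1 = 0 := Subsingleton.elim _ _
           simp [this] }⟩
    exact (aux Q₁).symm.trans (h.trans (aux Q₂))
  | succ n ih =>
    intro X _ _ _ Q hX hQ Q₁ Q₂ h
    have : Nontrivial X := Module.nontrivial_of_finrank_pos (R := k) (by omega)
    obtain ⟨u, hu⟩ := exists_ne_zero hQ
    have hs := split h2 Q rfl hu
    have h' : ((oneDim (Q u)).prod ((perp Q u).prod Q₁)).Equivalent
        ((oneDim (Q u)).prod ((perp Q u).prod Q₂)) :=
      (prod_assoc_equivalent _ _ _).symm.trans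
        (((hs.prod (.refl _)).trans (h.trans (hs.symm.prod (.refl _)))).trans
          (prod_assoc_equivalent _ _ _))
    exact ih (perp Q u) (by have := finrank_perp h2 Q hu; omega) (nondeg_perp h2 hQ hu)
      (cancel_oneDim h2 hu h')

theorem exists_hyperbolic_pair {Q : QuadraticForm k V} (hQ : Nondeg Q)
    (hi : ¬ Q.Anisotropic) : ∃ e f, Q e = 0 ∧ Q f = 0 ∧ polar Q e f = 1 := by
  rw [not_anisotropic_iff_exists] at hi
  obtain ⟨e, he, h0⟩ := hi
  have : ∃ y, polar Q e y ≠ 0 := by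
    by_contra! h
    exact he (hQ e h)
  obtain ⟨y, hy⟩ := this
  have hy' := hy
  set c := polar Q e y
  refine ⟨e, c⁻¹ • y + (-(Q y) * c⁻¹ ^ 2) • e, h0, ?_, ?_⟩
  · rw [map_lin_comb, h0, polar_comm Q y e]
    change _ + _ + _ * c = 0
    field_simp; ring
  · rw [polar_add_right, polar_smul_right, polar_smul_right, polar_self', h0]
    change c⁻¹ * c + _ = 1
    simp [hy']

theorem split_isotropic (h2 : (2 : k) ≠ 0) [FiniteDimensional k V] {Q : QuadraticForm k V}
    (hQ : Nondeg Q) (hi : ¬ Q.Anisotropic) :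
    ∃ S : Submodule k V, ∃ Q' : QuadraticForm k S, Nondeg Q' ∧
      Module.finrank k S + 2 = Module.finrank k V ∧
      ((oneDim (1 : k)).prod ((oneDim (-1 : k)).prod Q')).Equivalent Q := by
  obtain ⟨e, f, he, hf, hef⟩ := exists_hyperbolic_pair hQ hi
  have h1 : Q (e + f) = 1 := by rw [map_add_eq, he, hf, hef]; simp
  have hm : Q (e - f) = -1 := by
    have := map_lin_comb Q 1 (-1) e f
    simp only [one_smul, neg_smul, ← sub_eq_add_neg] at this
    rw [this, he, hf, hef]; ring
  have ho : polar Q (e + f) (e - f) = 0 := by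
    rw [polar_add_left, polar_sub_right, polar_sub_right, polar_self', polar_self', he, hf,
      polar_comm Q f e]; ring
  let v : LinearMap.ker (Q.polarBilin (e + f)) := ⟨e - f, by
    simpa only [LinearMap.mem_ker, polarBilin_apply_apply] using ho⟩
  have hv : perp Q (e + f) v = -1 := hm
  have hn1 : Nondeg (perp Q (e + f)) := nondeg_perp h2 hQ (by rw [h1]; exact one_ne_zero)
  have s1 := split h2 Q h1 one_ne_zero
  have s2 := split h2 (perp Q (e + f)) hv (by simp)
  have r1 := finrank_perp h2 Q (u := e + f) (by rw [h1]; exact one_ne_zero)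
  have r2 := finrank_perp h2 (perp Q (e + f)) (u := v) (by rw [hv]; simp)
  let S' := LinearMap.ker ((perp Q (e + f)).polarBilin v)
  let inj : S' →ₗ[k] V := (Submodule.subtype _).comp (Submodule.subtype _)
  have hinj : Function.Injective inj :=
    Subtype.val_injective.comp Subtype.val_injective
  let ee := LinearEquiv.ofInjective inj hinj
  let Q' : QuadraticForm k (LinearMap.range inj) :=
    (perp (perp Q (e + f)) v).comp (ee.symm : LinearMap.range inj →ₗ[k] S')
  have hQ' : (perp (perp Q (e + f)) v).Equivalent Q' :=
    ⟨{ ee with map_app' := fun m => by simp [Q'] }⟩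
  refine ⟨LinearMap.range inj, Q', nondeg_of_equivalent hQ'
    (nondeg_perp h2 hn1 (by rw [hv]; simp)), ?_, ?_⟩
  · rw [← ee.finrank_eq]
    change Module.finrank k S' + 1 = _ at r2
    omega
  · exact ((Equivalent.refl _).prod (((Equivalent.refl _).prod hQ'.symm).trans s2)).trans s1

end Witt

end QuadraticSpace

/-- Equality up to the square of a nonzero scalar. -/
def SqEq (a b : k) : Prop := ∃ c : k, c ≠ 0 ∧ a = c * c * b

namespace SqEq

theorem refl (a : k) : SqEq a a := ⟨1, one_ne_zero, by simp⟩

theorem symm {a b : k} (h : SqEq a b) : SqEq b a := by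
  obtain ⟨c, hc, rfl⟩ := h
  exact ⟨c⁻¹, inv_ne_zero hc, by field_simp⟩

theorem trans {a b d : k} (h : SqEq a b) (h' : SqEq b d) : SqEq a d := by
  obtain ⟨c, hc, rfl⟩ := h
  obtain ⟨c', hc', rfl⟩ := h'
  exact ⟨c * c', mul_ne_zero hc hc', by ring⟩

theorem mul {a b a' b' : k} (h : SqEq a b) (h' : SqEq a' b') : SqEq (a * a') (b * b') := by
  obtain ⟨c, hc, rfl⟩ := h
  obtain ⟨c', hc', rfl⟩ := h'
  exact ⟨c * c', mul_ne_zero hc hc', by ring⟩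

theorem of_eq {a b : k} (h : a = b) : SqEq a b := h ▸ refl a

theorem isSquare_iff {a b : k} (h : SqEq a b) : IsSquare a ↔ IsSquare b := by
  have key {a b : k} (h : SqEq a b) (hb : IsSquare b) : IsSquare a := by
    obtain ⟨c, -, rfl⟩ := h
    exact (IsSquare.mul_self c).mul hb
  exact ⟨key h.symm, key h⟩

theorem of_isSquare_mul {a b : k} (ha : a ≠ 0) (hb : b ≠ 0) (h : IsSquare (a * b)) :
    SqEq a b := by
  obtain ⟨c, hc⟩ := h
  have hc0 : c ≠ 0 := by rintro rfl; simp [ha, hb] at hc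
  exact ⟨c / b, div_ne_zero hc0 hb, by field_simp; rw [pow_two, ← hc]⟩

theorem isSquare_mul {a b : k} (h : SqEq a b) : IsSquare (a * b) := by
  obtain ⟨c, -, rfl⟩ := h
  exact ⟨c * b, by ring⟩

end SqEq

section DetOf

variable {V W : Type} [AddCommGroup V] [Module k V] [AddCommGroup W] [Module k W]
  [FiniteDimensional k V] [FiniteDimensional k W]

theorem det_toMatrix₂_sqEq_detOf {ι : Type} [Fintype ι] [DecidableEq ι] (b : Module.Basis ι k V)
    (B : LinearMap.BilinForm k V) : SqEq (LinearMap.toMatrix₂ b b B).det (detOf B) := by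
  let f := Module.finBasis k V
  let e := b.indexEquiv f
  let b' := b.reindex e
  have h1 : (LinearMap.toMatrix₂ b b B).det = (LinearMap.toMatrix₂ b' b' B).det := by
    rw [← Matrix.det_reindex_self e]
    congr 1
    ext i j
    simp [LinearMap.toMatrix₂_apply, b']
  have hu : IsUnit (f.toMatrix b') := by
    have := f.invertibleToMatrix b'
    exact isUnit_of_invertible _
  refine ⟨(f.toMatrix b').det, (Matrix.isUnit_iff_isUnit_det _).1 hu |>.ne_zero, ?_⟩
  rw [h1, ← LinearMap.toMatrix₂_mul_basis_toMatrix f f b' b', Matrix.det_mul, Matrix.det_mul,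
    Matrix.det_transpose, detOf, gramOf]
  ring

theorem detOf_sqEq_of_equiv (B : LinearMap.BilinForm k V) (B' : LinearMap.BilinForm k W)
    (e : V ≃ₗ[k] W) (h : ∀ x y, B' (e x) (e y) = B x y) : SqEq (detOf B) (detOf B') := by
  refine (SqEq.of_eq ?_).trans
    (det_toMatrix₂_sqEq_detOf ((Module.finBasis k V).map e) B')
  rw [detOf, gramOf]
  congr 1
  ext i j
  simp [LinearMap.toMatrix₂_apply, h]

theorem detOf_ne_zero_iff (B : LinearMap.BilinForm k V) :
    detOf B ≠ 0 ↔ ∀ x, (∀ y, B x y = 0) → x = 0 :=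
  (LinearMap.separatingLeft_iff_det_ne_zero _).symm

theorem detOf_prod (B : LinearMap.BilinForm k V) (B' : LinearMap.BilinForm k W)
    (C : LinearMap.BilinForm k (V × W))
    (h : ∀ x y, C x y = B x.1 y.1 + B' x.2 y.2) : SqEq (detOf C) (detOf B * detOf B') := by
  refine (det_toMatrix₂_sqEq_detOf ((Module.finBasis k V).prod (Module.finBasis k W)) C).symm.trans
    (SqEq.of_eq ?_)
  rw [detOf, detOf, gramOf, gramOf, ← Matrix.det_fromBlocks_zero₂₁ _ 0]
  congr 1
  ext (i | i) (j | j) <;> simp [LinearMap.toMatrix₂_apply, h]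

theorem detOf_smul (B : LinearMap.BilinForm k V) (c : k) :
    detOf (c • B) = c ^ Module.finrank k V * detOf B := by
  rw [detOf, detOf, gramOf, gramOf, map_smul, Matrix.det_smul, Fintype.card_fin]

theorem detOf_finrank_zero (B : LinearMap.BilinForm k V) (h : Module.finrank k V = 0) :
    detOf B = 1 := by
  have : IsEmpty (Fin (Module.finrank k V)) := by rw [h]; infer_instance
  exact Matrix.det_isEmpty

theorem detOf_self_sqEq (B : LinearMap.BilinForm k k) : SqEq (detOf B) (B 1 1) := by
  refine (det_toMatrix₂_sqEq_detOf (Module.Basis.singleton Unit k) B).symm.trans (SqEq.of_eq ?_)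
  rw [Matrix.det_unique, LinearMap.toMatrix₂_apply]
  simp

end DetOf

namespace QuadraticSpace

open QuadraticMap

section Disc

variable {V W U : Type} [AddCommGroup V] [Module k V] [AddCommGroup W] [Module k W]
  [AddCommGroup U] [Module k U]
  [FiniteDimensional k V] [FiniteDimensional k W] [FiniteDimensional k U]

/-- The determinant of the polar form of `Q` (well defined modulo nonzero squares). -/
def disc (Q : QuadraticForm k V) : k := detOf Q.polarBilin

theorem disc_sqEq_of_equivalent {Q₁ : QuadraticForm k V} {Q₂ : QuadraticForm k W}
    (h : Q₁.Equivalent Q₂) : SqEq (disc Q₁) (disc Q₂) := by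
  obtain ⟨e⟩ := h
  exact detOf_sqEq_of_equiv _ _ e.toLinearEquiv fun x y => polar_map e x y

theorem disc_prod (Q₁ : QuadraticForm k V) (Q₂ : QuadraticForm k W) :
    SqEq (disc (Q₁.prod Q₂)) (disc Q₁ * disc Q₂) :=
  detOf_prod _ _ _ fun x y => polar_prod Q₁ Q₂ x y

theorem disc_neg (Q : QuadraticForm k V) :
    disc (-Q) = (-1) ^ Module.finrank k V * disc Q := by
  rw [disc, disc, ← detOf_smul]
  congr 1
  ext x y
  simp [polar_neg]

theorem disc_oneDim (a : k) : SqEq (disc (oneDim a)) (2 * a) := by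
  refine (detOf_self_sqEq _).trans (SqEq.of_eq ?_)
  rw [polarBilin_apply_apply, polar_self']
  simp

theorem equivalent_of_finrank_zero (Q₁ : QuadraticForm k V) (Q₂ : QuadraticForm k W)
    (hV : Module.finrank k V = 0) (hW : Module.finrank k W = 0) : Q₁.Equivalent Q₂ := by
  have : Subsingleton V := Module.finrank_zero_iff.1 hV
  refine ⟨{ LinearEquiv.ofFinrankEq V W (hV.trans hW.symm) with map_app' := fun m => ?_ }⟩
  rw [Subsingleton.elim m 0]
  change Q₂ (LinearEquiv.ofFinrankEq V W (hV.trans hW.symm) 0) = _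
  rw [map_zero, QuadraticMap.map_zero, QuadraticMap.map_zero]

/-- A nondegenerate form of dimension `2 r` with trivial signed discriminant. -/
structure DiscTriv (r : ℕ) (Q : QuadraticForm k V) : Prop where
  nondeg : Nondeg Q
  finrank : Module.finrank k V = 2 * r
  isSquare : IsSquare ((-1) ^ r * disc Q)

theorem DiscTriv.exists_remainder (h2 : (2 : k) ≠ 0) {r : ℕ} {Q : QuadraticForm k V}
    (h : DiscTriv (r + 1) Q) (hi : ¬ Q.Anisotropic) :
    ∃ S : Submodule k V, ∃ Q' : QuadraticForm k S, DiscTriv r Q' ∧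
      ((oneDim (1 : k)).prod ((oneDim (-1 : k)).prod Q')).Equivalent Q := by
  obtain ⟨S, Q', hn, hr, he⟩ := split_isotropic h2 h.nondeg hi
  refine ⟨S, Q', ⟨hn, by have := h.finrank; omega, ?_⟩, he⟩
  have h1 := ((disc_sqEq_of_equivalent he).symm.trans (disc_prod _ _)).trans
    ((disc_oneDim 1).mul ((disc_prod _ _).trans ((disc_oneDim (-1)).mul (SqEq.refl _))))
  have h3 : SqEq ((-1) ^ (r + 1) * disc Q) ((-1) ^ r * disc Q') := by
    refine ((SqEq.refl ((-1) ^ (r + 1))).mul h1).trans ⟨2, h2, ?_⟩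
    ring
  exact h3.isSquare_iff.1 h.isSquare

theorem DiscTriv.not_anisotropic_of_one (h2 : (2 : k) ≠ 0) {Q : QuadraticForm k V}
    (h : DiscTriv 1 Q) : ¬ Q.Anisotropic := by
  intro ha
  have hf := h.finrank
  have : Nontrivial V := Module.nontrivial_of_finrank_pos (R := k) (by omega)
  obtain ⟨u, hu⟩ := exists_ne_zero h.nondeg
  have hf1 := finrank_perp h2 Q hu
  have hn1 := nondeg_perp h2 h.nondeg hu
  have : Nontrivial (LinearMap.ker (Q.polarBilin u)) :=
    Module.nontrivial_of_finrank_pos (R := k) (by omega)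
  obtain ⟨w, hw⟩ := exists_ne_zero hn1
  have hf2 := finrank_perp h2 _ hw
  have e1 := (disc_sqEq_of_equivalent (split h2 Q rfl hu)).symm.trans
    ((disc_prod _ _).trans ((disc_oneDim _).mul
      ((disc_sqEq_of_equivalent (split h2 _ rfl hw)).symm.trans
        ((disc_prod _ _).trans ((disc_oneDim _).mul (SqEq.refl _))))))
  have hd : disc (perp (perp Q u) w) = 1 := detOf_finrank_zero _ (by omega)
  rw [hd] at e1
  have e2 : IsSquare (-(Q u * perp Q u w)) := by
    refine (SqEq.isSquare_iff ?_).1 h.isSquare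
    refine ((SqEq.refl ((-1) ^ 1)).mul e1).trans ⟨2, h2, ?_⟩
    ring
  obtain ⟨s, hs⟩ := e2
  rw [perp_apply] at hs hw
  have hpw : polar Q u (w : V) = 0 := LinearMap.mem_ker.1 w.2
  have h0 := ha (s • u + (Q u) • (w : V)) (by
    rw [map_lin_comb, hpw]; linear_combination (-Q u) * hs)
  have := congrArg (fun z => polar Q z (w : V)) h0
  simp only [polar_add_left, polar_smul_left, hpw, polar_self', polar_zero_left, smul_eq_mul,
    mul_zero, zero_add] at this
  simp [h2, hu, hw] at this

theorem DiscTriv.equivalent_of_one (h2 : (2 : k) ≠ 0) {Q₁ : QuadraticForm k V}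
    {Q₂ : QuadraticForm k W} (h₁ : DiscTriv 1 Q₁) (h₂ : DiscTriv 1 Q₂) : Q₁.Equivalent Q₂ := by
  obtain ⟨S, R, hR, e⟩ := h₁.exists_remainder h2 (h₁.not_anisotropic_of_one h2)
  obtain ⟨S', R', hR', e'⟩ := h₂.exists_remainder h2 (h₂.not_anisotropic_of_one h2)
  exact (e.symm.trans ((Equivalent.refl _).prod ((Equivalent.refl _).prod
    (equivalent_of_finrank_zero R R' hR.finrank hR'.finrank)))).trans e'

theorem DiscTriv.equivalent_of_two (h2 : (2 : k) ≠ 0) {Q₁ : QuadraticForm k V}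
    {Q₂ : QuadraticForm k W} (h₁ : DiscTriv 2 Q₁) (h₂ : DiscTriv 2 Q₂) (i₁ : ¬ Q₁.Anisotropic)
    (i₂ : ¬ Q₂.Anisotropic) : Q₁.Equivalent Q₂ := by
  obtain ⟨S, R, hR, e⟩ := h₁.exists_remainder h2 i₁
  obtain ⟨S', R', hR', e'⟩ := h₂.exists_remainder h2 i₂
  exact (e.symm.trans ((Equivalent.refl _).prod ((Equivalent.refl _).prod
    (hR.equivalent_of_one h2 hR')))).trans e'

variable (k) in
/-- All forms of dimension at least five are isotropic, and anisotropic forms of dimension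
four are unique up to equivalence. -/
structure LocalAnisotropy : Prop where
  isotropic : ∀ {V : Type} [AddCommGroup V] [Module k V] [FiniteDimensional k V]
    (Q : QuadraticForm k V), 5 ≤ Module.finrank k V → ¬ Q.Anisotropic
  unique : ∀ {V W : Type} [AddCommGroup V] [Module k V] [FiniteDimensional k V]
    [AddCommGroup W] [Module k W] [FiniteDimensional k W]
    (Q₁ : QuadraticForm k V) (Q₂ : QuadraticForm k W), Module.finrank k V = 4 →
    Module.finrank k W = 4 → Q₁.Anisotropic → Q₂.Anisotropic → Q₁.Equivalent Q₂

theorem DiscTriv.equivalent_of_three (h2 : (2 : k) ≠ 0) (hk : LocalAnisotropy k) (r : ℕ) :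
    ∀ {V₁ V₂ V₃ : Type} [AddCommGroup V₁] [Module k V₁] [FiniteDimensional k V₁]
      [AddCommGroup V₂] [Module k V₂] [FiniteDimensional k V₂]
      [AddCommGroup V₃] [Module k V₃] [FiniteDimensional k V₃]
      {Q₁ : QuadraticForm k V₁} {Q₂ : QuadraticForm k V₂} {Q₃ : QuadraticForm k V₃},
      DiscTriv r Q₁ → DiscTriv r Q₂ → DiscTriv r Q₃ →
      Q₁.Equivalent Q₂ ∨ Q₁.Equivalent Q₃ ∨ Q₂.Equivalent Q₃ := by
  induction r with
  | zero =>
    intro V₁ V₂ V₃ _ _ _ _ _ _ _ _ _ Q₁ Q₂ Q₃ h₁ h₂ h₃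
    exact .inl (equivalent_of_finrank_zero _ _ h₁.finrank h₂.finrank)
  | succ r ih =>
    intro V₁ V₂ V₃ _ _ _ _ _ _ _ _ _ Q₁ Q₂ Q₃ h₁ h₂ h₃
    obtain rfl | rfl | hr : r = 0 ∨ r = 1 ∨ 2 ≤ r := by omega
    · exact .inl (h₁.equivalent_of_one h2 h₂)
    · have u12 := hk.unique Q₁ Q₂ h₁.finrank h₂.finrank
      have u13 := hk.unique Q₁ Q₃ h₁.finrank h₃.finrank
      have u23 := hk.unique Q₂ Q₃ h₂.finrank h₃.finrank
      have i12 := h₁.equivalent_of_two h2 h₂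
      have i13 := h₁.equivalent_of_two h2 h₃
      have i23 := h₂.equivalent_of_two h2 h₃
      tauto
    · have f1 := h₁.finrank
      have f2 := h₂.finrank
      have f3 := h₃.finrank
      obtain ⟨S₁, R₁, t₁, e₁⟩ := h₁.exists_remainder h2 (hk.isotropic _ (by omega))
      obtain ⟨S₂, R₂, t₂, e₂⟩ := h₂.exists_remainder h2 (hk.isotropic _ (by omega))
      obtain ⟨S₃, R₃, t₃, e₃⟩ := h₃.exists_remainder h2 (hk.isotropic _ (by omega))
      have key {X Y : Type} [AddCommGroup X] [Module k X] [AddCommGroup Y] [Module k Y]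
          {A : QuadraticForm k X} {B : QuadraticForm k Y} (h : A.Equivalent B) :
          ((oneDim (1 : k)).prod ((oneDim (-1 : k)).prod A)).Equivalent
            ((oneDim (1 : k)).prod ((oneDim (-1 : k)).prod B)) :=
        (Equivalent.refl _).prod ((Equivalent.refl _).prod h)
      rcases ih t₁ t₂ t₃ with h | h | h
      · exact .inl ((e₁.symm.trans (key h)).trans e₂)
      · exact .inr (.inl ((e₁.symm.trans (key h)).trans e₃))
      · exact .inr (.inr ((e₂.symm.trans (key h)).trans e₃))

theorem discTriv_prod_neg {n : ℕ} {Q₁ : QuadraticForm k V} {Q₂ : QuadraticForm k W}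
    (h₁ : Nondeg Q₁) (h₂ : Nondeg Q₂) (f₁ : Module.finrank k V = n)
    (f₂ : Module.finrank k W = n) (hd : SqEq (disc Q₁) (disc Q₂)) :
    DiscTriv n (Q₁.prod (-Q₂)) := by
  refine ⟨nondeg_prod.2 ⟨h₁, nondeg_neg h₂⟩, by rw [Module.finrank_prod]; omega, ?_⟩
  have h : SqEq ((-1) ^ n * disc (Q₁.prod (-Q₂))) (disc Q₁ * disc Q₂) := by
    refine ((SqEq.refl _).mul (disc_prod _ _)).trans (SqEq.of_eq ?_)
    rw [disc_neg, f₂]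
    have : ((-1 : k) ^ n) * (-1) ^ n = 1 := by rw [← mul_pow]; simp
    linear_combination (disc Q₁ * disc Q₂) * this
  exact h.isSquare_iff.2 hd.isSquare_mul

/-- Over a local field there are at most two classes of forms of given dimension and
discriminant. -/
theorem equivalent_or_equivalent (h2 : (2 : k) ≠ 0) (hk : LocalAnisotropy k) {n : ℕ}
    {Q₁ : QuadraticForm k V} {Q₂ : QuadraticForm k W} {Q₃ : QuadraticForm k U}
    (h₁ : Nondeg Q₁) (h₂ : Nondeg Q₂) (h₃ : Nondeg Q₃) (f₁ : Module.finrank k V = n)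
    (f₂ : Module.finrank k W = n) (f₃ : Module.finrank k U = n)
    (d₂ : SqEq (disc Q₁) (disc Q₂)) (d₃ : SqEq (disc Q₁) (disc Q₃)) (hne : ¬ Q₂.Equivalent Q₃) :
    Q₁.Equivalent Q₂ ∨ Q₁.Equivalent Q₃ := by
  have neg {X Y : Type} [AddCommGroup X] [Module k X] [AddCommGroup Y] [Module k Y]
      {A : QuadraticForm k X} {B : QuadraticForm k Y} (h : (-A).Equivalent (-B)) :
      A.Equivalent B := by
    obtain ⟨e⟩ := h
    exact ⟨{ e.toLinearEquiv with map_app' := fun m => by simpa using e.map_app m }⟩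
  have c {X Y : Type} [AddCommGroup X] [Module k X] [AddCommGroup Y] [Module k Y]
      {A : QuadraticForm k X} {B : QuadraticForm k Y}
      (h : (Q₁.prod (-A)).Equivalent (Q₁.prod (-B))) : A.Equivalent B :=
    neg (cancel h2 n Q₁ f₁ h₁ h)
  rcases DiscTriv.equivalent_of_three h2 hk n
    (discTriv_prod_neg h₁ h₁ f₁ f₁ (SqEq.refl _)) (discTriv_prod_neg h₁ h₂ f₁ f₂ d₂)
    (discTriv_prod_neg h₁ h₃ f₁ f₃ d₃) with h | h | h
  · exact .inl (c h)
  · exact .inr (c h)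
  · exact absurd (c h) hne

end Disc

end QuadraticSpace

section Alternating

variable {V : Type} [AddCommGroup V] [Module k V] [FiniteDimensional k V]

/-- Splitting off a hyperbolic pair of an alternating form. -/
def altSplitEquiv (C : LinearMap.BilinForm k V) (hC : ∀ x, C x x = 0) (e f : V)
    (h : C e f = 1) : V ≃ₗ[k] (k × k) × ↥(LinearMap.ker (C e) ⊓ LinearMap.ker (C f)) :=
  have hf : C f e = -1 := by rw [← LinearMap.IsAlt.neg hC e f, h]
  { toFun := fun x => ((-C f x, C e x), ⟨x + C f x • e - C e x • f, by
      constructor <;> simp [hC, h, hf]⟩)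
    invFun := fun p => p.1.1 • e + p.1.2 • f + (p.2 : V)
    left_inv := fun x => by
      simp only [neg_smul]; abel
    right_inv := by
      rintro ⟨⟨a, b⟩, x, hx, hx'⟩
      have hx : C e x = 0 := hx
      have hx' : C f x = 0 := hx'
      ext <;> simp [hC, h, hf, hx, hx']
      abel
    map_add' := fun x y => by
      ext <;> simp [add_smul]
      · ring
      · abel
    map_smul' := fun a x => by
      ext <;> simp [smul_sub, mul_smul] }

theorem alternating_detOf (n : ℕ) : ∀ {V : Type} [AddCommGroup V] [Module k V]
    [FiniteDimensional k V] (C : LinearMap.BilinForm k V), (∀ x, C x x = 0) →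
    Module.finrank k V = n → detOf C ≠ 0 → IsSquare (detOf C) ∧ Even n := by
  induction n using Nat.strong_induction_on with
  | _ n ih =>
    intro V _ _ _ C hC hn hd
    obtain rfl | hn0 := Nat.eq_zero_or_pos n
    · rw [detOf_finrank_zero C hn]
      exact ⟨⟨1, by simp⟩, ⟨0, rfl⟩⟩
    have : Nontrivial V := Module.nontrivial_of_finrank_pos (R := k) (by omega)
    obtain ⟨e, he⟩ := exists_ne (0 : V)
    have : ∃ y, C e y ≠ 0 := by
      by_contra! h
      exact he ((detOf_ne_zero_iff C).1 hd e h)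
    obtain ⟨y, hy⟩ := this
    obtain ⟨f, h⟩ : ∃ f, C e f = 1 := ⟨(C e y)⁻¹ • y, by simp [hy]⟩
    have hf : C f e = -1 := by rw [← LinearMap.IsAlt.neg hC e f, h]
    let S := LinearMap.ker (C e) ⊓ LinearMap.ker (C f)
    let E := altSplitEquiv C hC e f h
    let C' : LinearMap.BilinForm k S := C.compl₁₂ S.subtype S.subtype
    let P : LinearMap.BilinForm k (k × k) :=
      (LinearMap.mul k k).compl₁₂ (LinearMap.fst k k k) (LinearMap.snd k k k) -
        (LinearMap.mul k k).compl₁₂ (LinearMap.snd k k k) (LinearMap.fst k k k)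
    let T : LinearMap.BilinForm k ((k × k) × S) :=
      C.compl₁₂ E.symm.toLinearMap E.symm.toLinearMap
    have hT : ∀ x y, T x y = P x.1 y.1 + C' x.2 y.2 := by
      rintro ⟨⟨a, b⟩, x, hx, hx'⟩ ⟨⟨a', b'⟩, y, hy, hy'⟩
      have h1 : C e x = 0 := hx
      have h2 : C f x = 0 := hx'
      have h3 : C e y = 0 := hy
      have h4 : C f y = 0 := hy'
      have h5 : C x e = 0 := by rw [← LinearMap.IsAlt.neg hC e x, h1, neg_zero]
      have h6 : C x f = 0 := by rw [← LinearMap.IsAlt.neg hC f x, h2, neg_zero]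
      change C (a • e + b • f + x) (a' • e + b' • f + y) = (a * b' - b * a') + C x y
      simp [hC, h, hf, h3, h4, h5, h6]
      ring
    have hP : SqEq (detOf P) 1 := by
      refine (det_toMatrix₂_sqEq_detOf (Module.Basis.finTwoProd k) P).symm.trans (SqEq.of_eq ?_)
      rw [Matrix.det_fin_two]
      simp [LinearMap.toMatrix₂_apply, P]
    have hCT : SqEq (detOf C) (detOf C') := by
      refine ((detOf_sqEq_of_equiv C T E fun x y => by simp [T]).trans
        ((detOf_prod P C' T hT).trans (hP.mul (SqEq.refl _)))).trans (SqEq.of_eq (one_mul _))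
    have hr : 2 + Module.finrank k S = n := by
      rw [← hn, E.finrank_eq, Module.finrank_prod, Module.finrank_prod, Module.finrank_self]
    have := ih (Module.finrank k S) (by omega) C' (fun x => hC x) rfl (by
      obtain ⟨c, -, hc⟩ := hCT
      intro h0
      exact hd (by rw [hc, h0, mul_zero]))
    refine ⟨hCT.isSquare_iff.2 this.1, ?_⟩
    rw [← hr]
    exact even_two.add this.2

theorem detOf_compLeft (B : LinearMap.BilinForm k V) (g : V →ₗ[k] V) :
    detOf (B ∘ₗ g) = LinearMap.det g * detOf B := by
  rw [detOf, detOf, gramOf, gramOf, LinearMap.toMatrix₂_comp (Module.finBasis k V), Matrix.det_mul,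
    Matrix.det_transpose, LinearMap.det_toMatrix]

theorem detOf_compRight (B : LinearMap.BilinForm k V) (g : V →ₗ[k] V) :
    detOf (B.compl₂ g) = LinearMap.det g * detOf B := by
  rw [detOf, detOf, gramOf, gramOf, LinearMap.toMatrix₂_compl₂ _ (Module.finBasis k V),
    Matrix.det_mul, LinearMap.det_toMatrix, mul_comm]

/-- The determinant relation satisfied by an isometry. -/
theorem isSquare_detOf_mul_of_isometry {B : LinearMap.BilinForm k V} (hB : IsQuadraticSpace B)
    {t : V ≃ₗ[k] V} (ht : IsIsometryOf B t) :
    IsSquare (detOf B *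
      (LinearMap.det (1 - t.toLinearMap) * LinearMap.det (-1 - t.toLinearMap))) := by
  set T : Module.End k V := t.toLinearMap with hT
  set T' : Module.End k V := t.symm.toLinearMap with hT'
  have hTT : T * T' = 1 := by ext x; simp [T, T']
  have hadj : ∀ x y, B (T' x) y = B x (T y) := fun x y => by
    rw [← ht (T' x) y]; simp [T, T']
  by_cases h0 : LinearMap.det (1 - T) * LinearMap.det (-1 - T) = 0
  · rw [h0, mul_zero]; exact IsSquare.zero
  have hd : detOf B ≠ 0 := (detOf_ne_zero_iff B).2 hB.2
  have hprod : LinearMap.det (1 - T) * LinearMap.det (-1 - T) =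
      LinearMap.det T * LinearMap.det (T - T') := by
    rw [← map_mul, ← map_mul]
    congr 1
    rw [mul_sub T T T', hTT]
    noncomm_ring
  have hC : ∀ x, (B ∘ₗ (T - T')) x x = 0 := fun x => by
    simp [hadj, hB.1 x (T x)]
  have hCd := detOf_compLeft B (T - T')
  obtain ⟨hs, hn⟩ := alternating_detOf _ (B ∘ₗ (T - T')) hC rfl (by
    rw [hCd]
    refine mul_ne_zero (fun h => h0 ?_) hd
    rw [hprod, h, mul_zero])
  have h1 : LinearMap.det (T' - 1) = LinearMap.det (T - 1) := by
    have : B ∘ₗ (T' - 1) = B.compl₂ (T - 1) := by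
      ext x y; simp [hadj]
    have := congrArg detOf this
    rw [detOf_compLeft, detOf_compRight] at this
    exact mul_right_cancel₀ hd this
  have h2 : LinearMap.det (T - 1) = LinearMap.det (1 - T) := by
    rw [← neg_sub, ← neg_one_smul k, LinearMap.det_smul, hn.neg_one_pow, one_mul]
  have h3 : LinearMap.det (1 - T) = LinearMap.det T * LinearMap.det (T' - 1) := by
    rw [← map_mul, mul_sub, hTT, mul_one]
  have h4 : LinearMap.det T = 1 := by
    rw [h1, h2] at h3
    exact mul_right_cancel₀ (left_ne_zero_of_mul h0) (h3.symm.trans (one_mul _).symm)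
  rw [hprod, h4, one_mul, mul_comm, ← hCd]
  exact hs

end Alternating

section DetPi

theorem det_pi_of_apply (ι : Type) [Fintype ι] : ∀ {M : ι → Type} [∀ i, AddCommGroup (M i)]
    [∀ i, Module k (M i)] [∀ i, FiniteDimensional k (M i)] (f : ∀ i, M i →ₗ[k] M i)
    (F : (∀ i, M i) →ₗ[k] (∀ i, M i)), (∀ x i, F x i = f i (x i)) →
    LinearMap.det F = ∏ i, LinearMap.det (f i) := by
  refine Fintype.induction_empty_option (P := fun ι _ => ∀ {M : ι → Type} [∀ i, AddCommGroup (M i)]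
    [∀ i, Module k (M i)] [∀ i, FiniteDimensional k (M i)] (f : ∀ i, M i →ₗ[k] M i)
    (F : (∀ i, M i) →ₗ[k] (∀ i, M i)), (∀ x i, F x i = f i (x i)) →
    LinearMap.det F = ∏ i, LinearMap.det (f i)) ?_ ?_ ?_ ι
  · intro α β _ e ih M _ _ _ f F hF
    let E := LinearEquiv.piCongrLeft k M e
    have hE : ∀ y a, E.symm y a = y (e a) := fun y a => rfl
    let _ := Fintype.ofEquiv β e.symm
    rw [← e.prod_comp, ← LinearMap.det_conj F E.symm]
    refine ih (fun a => f (e a)) _ fun x a => ?_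
    have : E x (e a) = x a := by
      rw [← hE (E x) a, E.symm_apply_apply]
    simp [hE, hF, this]
  · intro M _ _ _ f F hF
    have : F = 1 := LinearMap.ext fun x => Subsingleton.elim _ _
    simp [this]
  · intro α _ ih M _ _ _ f F hF
    let E : (∀ o, M o) ≃ₗ[k] M none × ∀ a, M (some a) :=
      { Equiv.piOptionEquivProd (β := M) with
        map_add' := fun _ _ => rfl
        map_smul' := fun _ _ => rfl }
    let G : (∀ a, M (some a)) →ₗ[k] (∀ a, M (some a)) :=
      LinearMap.pi fun a => f (some a) ∘ₗ LinearMap.proj a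
    rw [Fintype.prod_option, ← ih (fun a => f (some a)) G fun x a => rfl, ← LinearMap.det_prodMap,
      ← LinearMap.det_conj F E]
    congr 1
    refine LinearMap.ext fun x => Prod.ext ?_ (funext fun a => ?_)
    · exact hF _ _
    · exact hF _ _

end DetPi

section InvariantForms

variable {N N' : Type} [AddCommGroup N] [Module k N] [AddCommGroup N'] [Module k N']

/-- The orthogonal sum of two bilinear forms. -/
def prodForm (B : LinearMap.BilinForm k N) (B' : LinearMap.BilinForm k N') :
    LinearMap.BilinForm k (N × N') :=
  B.compl₁₂ (LinearMap.fst k N N') (LinearMap.fst k N N') +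
    B'.compl₁₂ (LinearMap.snd k N N') (LinearMap.snd k N N')

@[simp] theorem prodForm_apply (B : LinearMap.BilinForm k N) (B' : LinearMap.BilinForm k N')
    (x y : N × N') : prodForm B B' x y = B x.1 y.1 + B' x.2 y.2 := rfl

theorem sqEq_of_isSquare_mul {a b c : k} (ha : a ≠ 0) (hb : b ≠ 0) (hc : c ≠ 0)
    (h : IsSquare (a * c)) (h' : IsSquare (b * c)) : SqEq a b :=
  (SqEq.of_isSquare_mul ha hc h).trans (SqEq.of_isSquare_mul hb hc h').symm

theorem IsQuadraticSpace.detOf_ne_zero [FiniteDimensional k N] {B : LinearMap.BilinForm k N}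
    (h : IsQuadraticSpace B) : detOf B ≠ 0 := (detOf_ne_zero_iff B).2 h.2

theorem detOf_prodForm [FiniteDimensional k N] [FiniteDimensional k N']
    (B : LinearMap.BilinForm k N) (B' : LinearMap.BilinForm k N') :
    SqEq (detOf (prodForm B B')) (detOf B * detOf B') :=
  detOf_prod B B' _ fun _ _ => rfl

theorem IsQuadraticSpace.prodForm {B : LinearMap.BilinForm k N} {B' : LinearMap.BilinForm k N'}
    (h : IsQuadraticSpace B) (h' : IsQuadraticSpace B') : IsQuadraticSpace (prodForm B B') := by
  refine ⟨fun x y => by simp [h.1 x.1, h'.1 x.2], fun x hx => ?_⟩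
  refine Prod.ext (h.2 _ fun y => ?_) (h'.2 _ fun y => ?_)
  · simpa using hx (y, 0)
  · simpa using hx (0, y)

variable [Module k[X] N] [Module k[X] N']

/-- A quadratic space structure on a `k[X]`-module for which `X` acts as an isometry. -/
structure IsInvForm (B : LinearMap.BilinForm k N) : Prop where
  quadratic : IsQuadraticSpace B
  inv : ∀ x y, B ((X : k[X]) • x) ((X : k[X]) • y) = B x y

theorem IsInvForm.prod {B : LinearMap.BilinForm k N} {B' : LinearMap.BilinForm k N'}
    (h : IsInvForm B) (h' : IsInvForm B') : IsInvForm (prodForm B B') where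
  quadratic := h.quadratic.prodForm h'.quadratic
  inv x y := by simp [h.inv, h'.inv]

theorem IsInvForm.pi {ι : Type} [Fintype ι] {M : ι → Type} [∀ i, AddCommGroup (M i)]
    [∀ i, Module k (M i)] [∀ i, Module k[X] (M i)] {B : ∀ i, LinearMap.BilinForm k (M i)}
    (h : ∀ i, IsInvForm (B i)) :
    IsInvForm (∑ i, (B i).compl₁₂ (LinearMap.proj i) (LinearMap.proj i) :
      LinearMap.BilinForm k (∀ i, M i)) where
  quadratic := by
    classical
    refine ⟨fun x y => ?_, fun x hx => funext fun i => (h i).quadratic.2 _ fun y => ?_⟩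
    · simp [(h _).quadratic.1 (x _)]
    · have := hx (Pi.single i y)
      simp only [LinearMap.sum_apply, LinearMap.compl₁₂_apply, LinearMap.proj_apply] at this
      rwa [Finset.sum_eq_single i (fun j _ hj => by simp [hj]) (by simp), Pi.single_eq_same] at this
  inv x y := by simp [(h _).inv]

/-- A perfect pairing for which `X` acts compatibly on both sides. -/
structure IsInvPairing (b : N →ₗ[k] N' →ₗ[k] k) : Prop where
  left : ∀ x, (∀ y, b x y = 0) → x = 0
  right : ∀ y, (∀ x, b x y = 0) → y = 0
  inv : ∀ x y, b ((X : k[X]) • x) ((X : k[X]) • y) = b x y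

theorem IsInvPairing.exists_isInvForm {b : N →ₗ[k] N' →ₗ[k] k} (h : IsInvPairing b) :
    ∃ B : LinearMap.BilinForm k (N × N'), IsInvForm B := by
  refine ⟨b.compl₁₂ (LinearMap.fst k N N') (LinearMap.snd k N N') +
    b.flip.compl₁₂ (LinearMap.snd k N N') (LinearMap.fst k N N'),
    ⟨fun x y => ?_, fun x hx => ?_⟩, fun x y => ?_⟩
  · simp [add_comm]
  · refine Prod.ext (h.left _ fun y => ?_) (h.right _ fun y => ?_)
    · simpa using hx (0, y)
    · simpa using hx (y, 0)
  · simp [h.inv]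

theorem IsInvPairing.pi {ι : Type} [Fintype ι] {M M' : ι → Type} [∀ i, AddCommGroup (M i)]
    [∀ i, Module k (M i)] [∀ i, Module k[X] (M i)] [∀ i, AddCommGroup (M' i)]
    [∀ i, Module k (M' i)] [∀ i, Module k[X] (M' i)] {b : ∀ i, M i →ₗ[k] M' i →ₗ[k] k}
    (h : ∀ i, IsInvPairing (b i)) :
    IsInvPairing (∑ i, (b i).compl₁₂ (LinearMap.proj i) (LinearMap.proj i) :
      (∀ i, M i) →ₗ[k] (∀ i, M' i) →ₗ[k] k) where
  left x hx := by
    classical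
    refine funext fun i => (h i).left _ fun y => ?_
    have := hx (Pi.single i y)
    simp only [LinearMap.sum_apply, LinearMap.compl₁₂_apply, LinearMap.proj_apply] at this
    rwa [Finset.sum_eq_single i (fun j _ hj => by simp [hj]) (by simp), Pi.single_eq_same] at this
  right y hy := by
    classical
    refine funext fun i => (h i).right _ fun x => ?_
    have := hy (Pi.single i x)
    simp only [LinearMap.sum_apply, LinearMap.compl₁₂_apply, LinearMap.proj_apply] at this
    rwa [Finset.sum_eq_single i (fun j _ hj => by simp [hj]) (by simp), Pi.single_eq_same] at this
  inv x y := by simp [(h _).inv]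

variable [IsScalarTower k k[X] N] [IsScalarTower k k[X] N']

variable (k N) in
/-- Multiplication by `X` on a `k[X]`-module. -/
def mulX : Module.End k N := Algebra.lsmul k k N (X : k[X])

@[simp] theorem mulX_apply (x : N) : mulX k N x = (X : k[X]) • x := rfl

variable (k N) in
/-- The value at `c` of the characteristic polynomial of `X` acting on `N`. -/
def charDet (c : k) : k := LinearMap.det (c • (1 : Module.End k N) - mulX k N)

theorem charDet_congr (e : N ≃ₗ[k[X]] N') (c : k) : charDet k N c = charDet k N' c := by
  let e' := e.restrictScalars k
  rw [charDet, ← LinearMap.det_conj _ e', charDet]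
  congr 1
  ext x
  have : e (c • e.symm x) = c • x := by
    rw [show e (c • e.symm x) = c • e (e.symm x) from e'.map_smul c (e.symm x),
      e.apply_symm_apply]
  simpa [e'] using this

theorem charDet_of_isometry {V : Type} [AddCommGroup V] [Module k V] (e : V ≃ₗ[k] N)
    (t : V ≃ₗ[k] V) (h : ∀ v, e (t v) = (X : k[X]) • e v) (c : k) :
    LinearMap.det (c • (1 : Module.End k V) - t.toLinearMap) = charDet k N c := by
  rw [charDet, ← LinearMap.det_conj _ e]
  congr 1
  ext x
  simp [h]

theorem charDet_pi {ι : Type} [Fintype ι] {M : ι → Type} [∀ i, AddCommGroup (M i)]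
    [∀ i, Module k (M i)] [∀ i, Module k[X] (M i)] [∀ i, IsScalarTower k k[X] (M i)]
    [∀ i, FiniteDimensional k (M i)] (c : k) :
    charDet k (∀ i, M i) c = ∏ i, charDet k (M i) c :=
  det_pi_of_apply ι _ _ fun _ _ => rfl

/-- The multiplication by `X` as an automorphism. -/
def IsInvForm.mulXEquiv [FiniteDimensional k N] {B : LinearMap.BilinForm k N} (h : IsInvForm B) :
    N ≃ₗ[k] N :=
  LinearEquiv.ofInjectiveEndo (mulX k N) (by
    rw [← LinearMap.ker_eq_bot]
    refine (Submodule.eq_bot_iff _).2 fun x hx => h.quadratic.2 x fun y => ?_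
    rw [← h.inv, ← mulX_apply, LinearMap.mem_ker.1 hx, map_zero, LinearMap.zero_apply])

theorem IsInvForm.mulXEquiv_apply [FiniteDimensional k N] {B : LinearMap.BilinForm k N}
    (h : IsInvForm B) (x : N) : h.mulXEquiv x = (X : k[X]) • x := by
  rfl

theorem isSquare_detOf_mul_charDet {V : Type} [AddCommGroup V] [Module k V]
    [FiniteDimensional k V] {B : LinearMap.BilinForm k V} (hB : IsQuadraticSpace B)
    {t : V ≃ₗ[k] V} (ht : IsIsometryOf B t) (e : V ≃ₗ[k] N)
    (h : ∀ v, e (t v) = (X : k[X]) • e v) :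
    IsSquare (detOf B * (charDet k N 1 * charDet k N (-1))) := by
  rw [← charDet_of_isometry e t h, ← charDet_of_isometry e t h]
  simpa using isSquare_detOf_mul_of_isometry hB ht

theorem IsInvForm.isSquare [FiniteDimensional k N] {B : LinearMap.BilinForm k N}
    (h : IsInvForm B) : IsSquare (detOf B * (charDet k N 1 * charDet k N (-1))) :=
  isSquare_detOf_mul_charDet h.quadratic (t := h.mulXEquiv)
    (fun x y => by rw [h.mulXEquiv_apply, h.mulXEquiv_apply, h.inv]) (LinearEquiv.refl k N)
    fun v => h.mulXEquiv_apply v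

theorem hasIsometryWithModule_of_isInvForm {V : Type} [AddCommGroup V] [Module k V]
    [FiniteDimensional k N]
    {B : LinearMap.BilinForm k V} {D : ModuleData k} {B' : LinearMap.BilinForm k N}
    (h : IsInvForm B') (e : N ≃ₗ[k[X]] D.SpaceVia (RingHom.id k)) (g : V ≃ₗ[k] N)
    (hg : ∀ x y, B' (g x) (g y) = B x y) : HasIsometryWithModule B D := by
  refine ⟨g.trans (h.mulXEquiv.trans g.symm), fun x y => ?_, g.trans (e.restrictScalars k),
    fun w => ?_⟩
  · rw [← hg]
    simp [h.mulXEquiv_apply, h.inv, hg]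
  · simp [h.mulXEquiv_apply]

end InvariantForms

section QuotMod

/-- The `k[X]`-module `k[X]/(f)`. -/
abbrev QuotMod (f : k[X]) : Type := k[X] ⧸ Ideal.span {f}

/-- `k[X]/(f)` as a `k`-algebra. -/
def quotModEquiv (f : k[X]) : QuotMod f ≃ₗ[k] AdjoinRoot f where
  toFun x := x
  invFun x := x
  map_add' _ _ := rfl
  map_smul' c x := by
    obtain ⟨p, rfl⟩ := Ideal.Quotient.mk_surjective x
    rfl
  left_inv _ := rfl
  right_inv _ := rfl

theorem quotModEquiv_X_smul (f : k[X]) (x : QuotMod f) :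
    quotModEquiv f ((X : k[X]) • x) = AdjoinRoot.root f * quotModEquiv f x := by
  obtain ⟨p, rfl⟩ := Ideal.Quotient.mk_surjective x
  rfl

theorem finiteDimensional_quotMod {f : k[X]} (hf : f ≠ 0) : FiniteDimensional k (QuotMod f) := by
  have := (AdjoinRoot.powerBasis hf).finite
  exact Module.Finite.equiv (quotModEquiv f).symm

theorem charDet_quotMod {f : k[X]} (hf : f.Monic) (c : k) : charDet k (QuotMod f) c = f.eval c := by
  have := (AdjoinRoot.powerBasis hf.ne_zero).finite
  let P := AdjoinRoot.powerBasis hf.ne_zero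
  rw [charDet, ← LinearMap.det_conj _ (quotModEquiv f)]
  have h1 : f = (Algebra.lmul k (AdjoinRoot f) (AdjoinRoot.root f)).charpoly := by
    rw [← LinearMap.charpoly_toMatrix _ P.basis, ← Algebra.leftMulMatrix_apply]
    have := charpoly_leftMulMatrix P
    rw [AdjoinRoot.minpoly_powerBasis_gen_of_monic hf] at this
    exact this.symm
  conv_rhs => rw [h1, LinearMap.eval_charpoly]
  congr 1

theorem coeff_zero_ne_zero_of_starPoly {f : k[X]} (h : starPoly f ≠ 0) : f.coeff 0 ≠ 0 := by
  intro h0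
  rw [starPoly, h0] at h
  simp at h

theorem natDegree_starPoly {f : k[X]} (h : f.coeff 0 ≠ 0) :
    (starPoly f).natDegree = f.natDegree := by
  rw [starPoly, natDegree_C_mul (inv_ne_zero h), reverse_natDegree,
    natTrailingDegree_eq_zero.2 (Or.inr h), Nat.sub_zero]

theorem root_ne_zero {f : k[X]} [Fact (Irreducible f)] (h : f.coeff 0 ≠ 0) :
    AdjoinRoot.root f ≠ 0 := by
  intro h0
  have h1 : aeval (AdjoinRoot.root f) f = 0 := by rw [AdjoinRoot.aeval_eq, AdjoinRoot.mk_self]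
  rw [h0, aeval_def, eval₂_at_zero] at h1
  exact h (by simpa using h1)

/-- The homomorphism `k[X]/(f*) → k[X]/(f)` inverting `X`. -/
theorem exists_invHom {f g : k[X]} [Fact (Irreducible f)] (hg : g = starPoly f)
    (h : f.coeff 0 ≠ 0) :
    ∃ i : AdjoinRoot g →ₐ[k] AdjoinRoot f, i (AdjoinRoot.root g) = (AdjoinRoot.root f)⁻¹ := by
  let _ := invertibleOfNonzero (root_ne_zero h)
  refine ⟨AdjoinRoot.liftAlgHom g (Algebra.ofId k _) (AdjoinRoot.root f)⁻¹ ?_, ?_⟩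
  · rw [hg, starPoly, eval₂_mul]
    have := (eval₂_reverse_eq_zero_iff (algebraMap k (AdjoinRoot f)) (AdjoinRoot.root f) f).2
      (by rw [← aeval_def, AdjoinRoot.aeval_eq, AdjoinRoot.mk_self])
    rw [invOf_eq_inv] at this
    exact mul_eq_zero_of_right _ this
  · exact AdjoinRoot.liftAlgHom_root ..

theorem exists_isInvPairing {f g : k[X]} (hf : Irreducible f) (hg : Irreducible g)
    (hfg : g = starPoly f) :
    ∃ b : QuotMod f →ₗ[k] QuotMod g →ₗ[k] k, IsInvPairing b := by
  have : Fact (Irreducible f) := ⟨hf⟩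
  have : Fact (Irreducible g) := ⟨hg⟩
  have h0 : f.coeff 0 ≠ 0 := coeff_zero_ne_zero_of_starPoly (hfg ▸ hg.ne_zero)
  obtain ⟨i, hi⟩ := exists_invHom hfg h0
  have := (AdjoinRoot.powerBasis hf.ne_zero).finite
  have := (AdjoinRoot.powerBasis hg.ne_zero).finite
  have hinj : Function.Injective i := i.toRingHom.injective
  have hsurj : Function.Surjective i := by
    refine (LinearMap.injective_iff_surjective_of_finrank_eq_finrank (f := i.toLinearMap) ?_).1 hinj
    rw [(AdjoinRoot.powerBasis hf.ne_zero).finrank, (AdjoinRoot.powerBasis hg.ne_zero).finrank,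
      AdjoinRoot.powerBasis_dim, AdjoinRoot.powerBasis_dim, hfg, natDegree_starPoly h0]
  obtain ⟨s, hs⟩ := Module.Projective.exists_dual_eq_one k (one_ne_zero : (1 : AdjoinRoot f) ≠ 0)
  refine ⟨((LinearMap.mul k (AdjoinRoot f)).compr₂ s).compl₁₂ (quotModEquiv f).toLinearMap
    (i.toLinearMap ∘ₗ (quotModEquiv g).toLinearMap), ?_, ?_, ?_⟩
  · refine fun x hx => (quotModEquiv f).map_eq_zero_iff.1 (by_contra fun hx0 => ?_)
    obtain ⟨y, hy⟩ := hsurj (quotModEquiv f x)⁻¹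
    have := hx ((quotModEquiv g).symm y)
    simp [hy, hx0, hs] at this
  · refine fun y hy => (quotModEquiv g).map_eq_zero_iff.1 (by_contra fun hy0 => ?_)
    have h1 : i (quotModEquiv g y) ≠ 0 := (map_ne_zero i).2 hy0
    have := hy ((quotModEquiv f).symm (i (quotModEquiv g y))⁻¹)
    simp [h1, hs] at this
  · intro x y
    have h1 := root_ne_zero h0
    have h2 : AdjoinRoot.root f * quotModEquiv f x * ((AdjoinRoot.root f)⁻¹ *
        i (quotModEquiv g y)) = quotModEquiv f x * i (quotModEquiv g y) := by field_simp
    simp [quotModEquiv_X_smul, hi, h2]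

section Hermitian

variable {L : Type} [Field L] [Algebra k L]

/-- The bilinear form `(x, y) ↦ s (u * x * i y)`. -/
def hermForm (i : L →ₐ[k] L) (s : L →ₗ[k] k) (u : L) : LinearMap.BilinForm k L :=
  ((LinearMap.mul k L).compr₂ s).compl₁₂ (LinearMap.mulLeft k u) i.toLinearMap

@[simp] theorem hermForm_apply (i : L →ₐ[k] L) (s : L →ₗ[k] k) (u x y : L) :
    hermForm i s u x y = s (u * x * i y) := rfl

theorem isQuadraticSpace_hermForm {i : L →ₐ[k] L} (hi : ∀ x, i (i x) = x) {s : L →ₗ[k] k}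
    (hs : ∀ x, s (i x) = s x) (hs1 : s 1 ≠ 0) {u : L} (hu : i u = u) (hu0 : u ≠ 0) :
    IsQuadraticSpace (hermForm i s u) := by
  refine ⟨fun x y => ?_, fun x hx => by_contra fun hx0 => hs1 ?_⟩
  · rw [hermForm_apply, ← hs, hermForm_apply]
    simp only [map_mul, hi, hu]
    ring_nf
  · have := hx (i (u * x)⁻¹)
    rwa [hermForm_apply, hi, mul_inv_cancel₀ (mul_ne_zero hu0 hx0)] at this

end Hermitian

/-- A self-dual `f` gives an involution of `k[X]/(f)` inverting `X` and an invariant functional. -/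
theorem exists_involution (h2 : (2 : k) ≠ 0) {f : k[X]} [Fact (Irreducible f)]
    (hf : f = starPoly f) :
    ∃ (i : AdjoinRoot f →ₐ[k] AdjoinRoot f) (s : AdjoinRoot f →ₗ[k] k),
      i (AdjoinRoot.root f) = (AdjoinRoot.root f)⁻¹ ∧ (∀ x, i (i x) = x) ∧
      (∀ x, s (i x) = s x) ∧ s 1 ≠ 0 := by
  have hirr : Irreducible f := Fact.out
  have h0 : f.coeff 0 ≠ 0 := coeff_zero_ne_zero_of_starPoly (hf ▸ hirr.ne_zero)
  obtain ⟨i, hi⟩ := exists_invHom hf h0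
  obtain ⟨s, hs⟩ := Module.Projective.exists_dual_eq_one k (one_ne_zero : (1 : AdjoinRoot f) ≠ 0)
  have hii : ∀ x, i (i x) = x := by
    have : i.comp i = AlgHom.id k _ := AdjoinRoot.algHom_ext (by simp [hi])
    exact fun x => DFunLike.congr_fun this x
  refine ⟨i, s + s ∘ₗ i.toLinearMap, hi, hii, fun x => ?_, ?_⟩
  · simp [hii, add_comm]
  · simpa [hs, one_add_one_eq_two] using h2

theorem isInvForm_hermForm {f : k[X]} [Fact (Irreducible f)] (h0 : f.coeff 0 ≠ 0)
    {i : AdjoinRoot f →ₐ[k] AdjoinRoot f}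
    (hr : i (AdjoinRoot.root f) = (AdjoinRoot.root f)⁻¹) (hi : ∀ x, i (i x) = x)
    {s : AdjoinRoot f →ₗ[k] k} (hs : ∀ x, s (i x) = s x) (hs1 : s 1 ≠ 0) {u : AdjoinRoot f}
    (hu : i u = u) (hu0 : u ≠ 0) :
    IsInvForm ((hermForm i s u).compl₁₂ (quotModEquiv f).toLinearMap
      (quotModEquiv f).toLinearMap) where
  quadratic := by
    obtain ⟨h1, h2⟩ := isQuadraticSpace_hermForm hi hs hs1 hu hu0
    refine ⟨fun x y => h1 _ _, fun x hx => (quotModEquiv f).map_eq_zero_iff.1 (h2 _ fun y => ?_)⟩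
    simpa using hx ((quotModEquiv f).symm y)
  inv x y := by
    have h1 := root_ne_zero h0
    have h2 : u * (AdjoinRoot.root f * quotModEquiv f x) * ((AdjoinRoot.root f)⁻¹ *
        i (quotModEquiv f y)) = u * quotModEquiv f x * i (quotModEquiv f y) := by field_simp
    simp [quotModEquiv_X_smul, hr, h2]

theorem exists_isInvForm_of_eq_starPoly (h2 : (2 : k) ≠ 0) {f : k[X]} (hirr : Irreducible f)
    (hf : f = starPoly f) : ∃ B : LinearMap.BilinForm k (QuotMod f), IsInvForm B := by
  have : Fact (Irreducible f) := ⟨hirr⟩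
  obtain ⟨i, s, hr, hi, hs, hs1⟩ := exists_involution h2 hf
  exact ⟨_, isInvForm_hermForm (coeff_zero_ne_zero_of_starPoly (hf ▸ hirr.ne_zero)) hr hi hs hs1
    (map_one i) one_ne_zero⟩

theorem IsInvForm.smul {N : Type} [AddCommGroup N] [Module k N] [Module k[X] N]
    {B : LinearMap.BilinForm k N} (h : IsInvForm B) {c : k} (hc : c ≠ 0) :
    IsInvForm (c • B) where
  quadratic := ⟨fun x y => by simp [h.quadratic.1 x y], fun x hx => h.quadratic.2 x fun y => by
    simpa [hc] using hx y⟩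
  inv x y := by simp [h.inv]

end QuotMod

section Decomposition

theorem starPoly_starPoly {f : k[X]} (hf : f.Monic) (h : f.coeff 0 ≠ 0) :
    starPoly (starPoly f) = f := by
  have h1 : (starPoly f).coeff 0 = (f.coeff 0)⁻¹ := by
    rw [starPoly, coeff_C_mul, coeff_zero_reverse, hf.leadingCoeff, mul_one]
  rw [starPoly, h1, starPoly, inv_inv, reverse_mul_of_domain, reverse_C, ← mul_assoc, ← C_mul,
    mul_inv_cancel₀ h, C_1, one_mul, reverse, reverse_natDegree,
    natTrailingDegree_eq_zero.2 (Or.inr h), Nat.sub_zero]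
  simp [reverse]

/-- Splitting off one factor of a product. -/
def piSplitAt {R ι : Type} [DecidableEq ι] [Semiring R] (M : ι → Type) [∀ i, AddCommMonoid (M i)]
    [∀ i, Module R (M i)] (i₀ : ι) :
    (∀ i, M i) ≃ₗ[R] M i₀ × ∀ i : {i // i ≠ i₀}, M i :=
  LinearEquiv.ofBijective
    ((LinearMap.proj i₀).prod (LinearMap.pi fun i : {i // i ≠ i₀} => LinearMap.proj i.1)) <| by
    refine ⟨fun x y h => funext fun i => ?_, fun z => ⟨fun i => if h : i = i₀ then h ▸ z.1 else
      z.2 ⟨i, h⟩, ?_⟩⟩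
    · by_cases hi : i = i₀
      · subst hi
        exact congrArg Prod.fst h
      · exact congrFun (congrArg Prod.snd h) ⟨i, hi⟩
    · refine Prod.ext (by simp) (funext fun i => ?_)
      simp [i.2]

variable {P : Type} {g : P → k[X]} {τ : Equiv.Perm P}

/-- A self-dual product of modules `k[X]/(g p)` is the product of the self-dual factors with a
product of pairs of dual factors. -/
theorem exists_pi_equiv (hm : ∀ p, (g p).Monic) (hτ : ∀ p, g (τ p) = starPoly (g p)) :
    Nonempty ((∀ p, QuotMod (g p)) ≃ₗ[k[X]] (∀ p : {p // g p = starPoly (g p)}, QuotMod (g p.1)) ×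
      ((∀ p : {p // WellOrderingRel (g p) (starPoly (g p))}, QuotMod (g p.1)) ×
        ∀ p : {p // WellOrderingRel (g p) (starPoly (g p))}, QuotMod (g (τ p.1)))) := by
  have hss : ∀ p, starPoly (starPoly (g p)) = g p := fun p =>
    starPoly_starPoly (hm p) (coeff_zero_ne_zero_of_starPoly (hτ p ▸ (hm _).ne_zero))
  let S := {p // g p = starPoly (g p)}
  let T := {p // WellOrderingRel (g p) (starPoly (g p))}
  let φ : S ⊕ (T ⊕ T) → P :=
    Sum.elim (fun p => p.1) (Sum.elim (fun p => p.1) fun p => τ p.1)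
  have hirr : ∀ f : k[X], ¬WellOrderingRel f f := fun f => irrefl_of WellOrderingRel f
  have hφ : Function.Bijective φ := by
    constructor
    · have hST : ∀ (a : S) (b : T), a.1 ≠ b.1 := fun a b h => hirr (g b.1) (by
        have h1 := b.2
        rwa [← h, ← a.2, h] at h1)
      have hST' : ∀ (a : S) (b : T), a.1 ≠ τ b.1 := fun a b h => hirr (g b.1) (by
        have h1 := a.2
        have h2 := b.2
        rw [h, hτ, hss] at h1
        rwa [h1] at h2)
      have hTT : ∀ a b : T, a.1 ≠ τ b.1 := fun a b h => by
        have h1 := a.2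
        rw [h, hτ, hss] at h1
        exact asymm_of WellOrderingRel h1 b.2
      rintro (a | a | a) (b | b | b) h
      · exact congrArg _ (Subtype.ext h)
      · exact (hST a b h).elim
      · exact (hST' a b h).elim
      · exact (hST b a h.symm).elim
      · exact congrArg _ (congrArg _ (Subtype.ext h))
      · exact (hTT a b h).elim
      · exact (hST' b a h.symm).elim
      · exact (hTT b a h.symm).elim
      · exact congrArg _ (congrArg _ (Subtype.ext (τ.injective h)))
    · intro p
      rcases trichotomous_of WellOrderingRel (g p) (starPoly (g p)) with h | h | h
      · exact ⟨Sum.inr (Sum.inl ⟨p, h⟩), rfl⟩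
      · exact ⟨Sum.inl ⟨p, h⟩, rfl⟩
      · have h1 : g p = starPoly (g (τ.symm p)) := by rw [← hτ, τ.apply_symm_apply]
        refine ⟨Sum.inr (Sum.inr ⟨τ.symm p, ?_⟩), τ.apply_symm_apply p⟩
        rwa [h1, hss] at h
  let e : S ⊕ (T ⊕ T) ≃ P := Equiv.ofBijective φ hφ
  exact ⟨(LinearEquiv.piCongrLeft k[X] (fun p => QuotMod (g p)) e).symm ≪≫ₗ
    LinearEquiv.sumPiEquivProdPi k[X] S (T ⊕ T) (fun a => QuotMod (g (e a))) ≪≫ₗ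
    LinearEquiv.prodCongr (LinearEquiv.refl _ _)
      (LinearEquiv.sumPiEquivProdPi k[X] T T fun a => QuotMod (g (e (Sum.inr a))))⟩

variable [Finite P]

theorem exists_isInvForm_pi_of_eq_starPoly {P : Type} [Finite P] {g : P → k[X]}
    (h2 : (2 : k) ≠ 0) (hirr : ∀ p, Irreducible (g p)) (h : ∀ p, g p = starPoly (g p)) :
    ∃ B : LinearMap.BilinForm k (∀ p, QuotMod (g p)), IsInvForm B := by
  have := Fintype.ofFinite P
  choose B hB using fun p => exists_isInvForm_of_eq_starPoly h2 (hirr p) (h p)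
  exact ⟨_, IsInvForm.pi hB⟩

theorem exists_isInvForm_pairs (hirr : ∀ p, Irreducible (g p))
    (hτ : ∀ p, g (τ p) = starPoly (g p)) :
    ∃ B : LinearMap.BilinForm k ((∀ p : {p // WellOrderingRel (g p) (starPoly (g p))},
      QuotMod (g p.1)) × ∀ p : {p // WellOrderingRel (g p) (starPoly (g p))}, QuotMod (g (τ p.1))),
      IsInvForm B := by
  have := Fintype.ofFinite {p // WellOrderingRel (g p) (starPoly (g p))}
  choose b hb using fun p => exists_isInvPairing (hirr p) (hirr (τ p)) (hτ p)
  exact (IsInvPairing.pi fun p : {p // WellOrderingRel (g p) (starPoly (g p))} =>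
    hb p.1).exists_isInvForm

theorem exists_decomposition (h2 : (2 : k) ≠ 0) (hm : ∀ p, (g p).Monic)
    (hirr : ∀ p, Irreducible (g p)) (hτ : ∀ p, g (τ p) = starPoly (g p)) {p₀ : P}
    (h₀ : g p₀ = starPoly (g p₀)) :
    ∃ (R : Type) (_ : AddCommGroup R) (_ : Module k R) (_ : Module k[X] R)
      (_ : IsScalarTower k k[X] R) (_ : FiniteDimensional k R) (r : LinearMap.BilinForm k R),
      IsInvForm r ∧ Nonempty ((QuotMod (g p₀) × R) ≃ₗ[k[X]] ∀ p, QuotMod (g p)) := by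
  classical
  obtain ⟨e⟩ := exists_pi_equiv hm hτ
  obtain ⟨b, hb⟩ := exists_isInvForm_pairs hirr hτ
  let S := {p // g p = starPoly (g p)}
  let s₀ : S := ⟨p₀, h₀⟩
  obtain ⟨a, ha⟩ := exists_isInvForm_pi_of_eq_starPoly (P := {s : S // s ≠ s₀})
    (g := fun s => g s.1.1) h2 (fun s => hirr _) fun s => s.1.2
  have := fun p => finiteDimensional_quotMod (hm p).ne_zero
  exact ⟨_, _, _, _, inferInstance, inferInstance, _, ha.prod hb,
    ⟨((LinearEquiv.prodAssoc ..).symm ≪≫ₗ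
    LinearEquiv.prodCongr (piSplitAt (fun s : S => QuotMod (g s.1)) s₀).symm
      (LinearEquiv.refl _ _)) ≪≫ₗ e.symm⟩⟩

theorem exists_decomposition_two (h2 : (2 : k) ≠ 0) (hm : ∀ p, (g p).Monic)
    (hirr : ∀ p, Irreducible (g p)) (hτ : ∀ p, g (τ p) = starPoly (g p)) {p₀ p₁ : P}
    (h₀ : g p₀ = starPoly (g p₀)) (h₁ : g p₁ = starPoly (g p₁)) (hne : p₁ ≠ p₀) :
    ∃ (R : Type) (_ : AddCommGroup R) (_ : Module k R) (_ : Module k[X] R)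
      (_ : IsScalarTower k k[X] R) (_ : FiniteDimensional k R) (r : LinearMap.BilinForm k R),
      IsInvForm r ∧
      Nonempty ((QuotMod (g p₀) × QuotMod (g p₁) × R) ≃ₗ[k[X]] ∀ p, QuotMod (g p)) := by
  classical
  obtain ⟨e⟩ := exists_pi_equiv hm hτ
  obtain ⟨b, hb⟩ := exists_isInvForm_pairs hirr hτ
  let S := {p // g p = starPoly (g p)}
  let s₀ : S := ⟨p₀, h₀⟩
  let s₁ : {s : S // s ≠ s₀} := ⟨⟨p₁, h₁⟩, fun h => hne (congrArg Subtype.val h)⟩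
  obtain ⟨a, ha⟩ := exists_isInvForm_pi_of_eq_starPoly (P := {s : {s : S // s ≠ s₀} // s ≠ s₁})
    (g := fun s => g s.1.1.1) h2 (fun s => hirr _) fun s => s.1.1.2
  have := fun p => finiteDimensional_quotMod (hm p).ne_zero
  exact ⟨_, _, _, _, inferInstance, inferInstance, _, ha.prod hb,
    ⟨LinearEquiv.prodCongr (LinearEquiv.refl _ _) (LinearEquiv.prodAssoc ..).symm ≪≫ₗ
      (LinearEquiv.prodAssoc ..).symm ≪≫ₗ
      LinearEquiv.prodCongr
        (LinearEquiv.prodCongr (LinearEquiv.refl _ _)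
          (piSplitAt (fun s : {s : S // s ≠ s₀} => QuotMod (g s.1.1)) s₁).symm ≪≫ₗ
          (piSplitAt (fun s : S => QuotMod (g s.1)) s₀).symm)
        (LinearEquiv.refl _ _) ≪≫ₗ e.symm⟩⟩

end Decomposition

section ModuleData

variable (D : ModuleData k)

/-- The summands of `D`, counted with multiplicity. -/
abbrev ModuleData.Idx : Type := Σ i, Fin (D.n i)

theorem ModuleData.exists_perm_idx :
    ∃ τ : Equiv.Perm D.Idx, ∀ p, D.f (τ p).1 = starPoly (D.f p.1) := by
  obtain ⟨σ, hσ⟩ := D.selfdual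
  exact ⟨Equiv.sigmaCongr σ fun i => finCongr (hσ i).2.2.symm, fun p => (hσ p.1).1⟩

variable {D}

/-- A semi-simple module as a product of simple ones. -/
def ModuleData.Semisimple.piEquiv (h : D.Semisimple) :
    (∀ p : D.Idx, QuotMod (D.f p.1)) ≃ₗ[k[X]] D.SpaceVia (RingHom.id k) :=
  LinearEquiv.piCurry k[X] (fun i (_ : Fin (D.n i)) => QuotMod (D.f i)) ≪≫ₗ
    LinearEquiv.piCongrRight fun i => LinearEquiv.piCongrRight fun _ =>
      Submodule.quotEquivOfEq _ _ (by rw [h i, pow_one, Polynomial.map_id])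

theorem ModuleData.Semisimple.charDet_eq (h : D.Semisimple) (c : k) :
    charDet k (D.SpaceVia (RingHom.id k)) c = D.charPoly.eval c := by
  have := fun i => finiteDimensional_quotMod (D.monic i).ne_zero
  rw [← charDet_congr h.piEquiv, charDet_pi, ModuleData.charPoly, eval_prod, Fintype.prod_sigma]
  simp [charDet_quotMod (D.monic _), h _]

theorem ModuleData.Semisimple.finrank_eq (h : D.Semisimple) :
    Module.finrank k (D.SpaceVia (RingHom.id k)) = D.dim := by
  have := fun i => finiteDimensional_quotMod (D.monic i).ne_zero
  rw [← (h.piEquiv.restrictScalars k).finrank_eq, Module.finrank_pi_fintype, ModuleData.dim,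
    Fintype.sum_sigma]
  simp [finrank_quotient_span_eq_natDegree, h _]

end ModuleData

section LocalField

open scoped Valued

variable [Valued k (WithZero (Multiplicative ℤ))]

theorem isDiscreteValuationRing_integer
    (hdisc : Function.Surjective (Valued.v : Valuation k (WithZero (Multiplicative ℤ)))) :
    IsDiscreteValuationRing 𝒪[k] := by
  let v : Valuation k (WithZero (Multiplicative ℤ)) := Valued.v
  have : v.IsNontrivial := ⟨by
    obtain ⟨x, hx⟩ := hdisc (WithZero.exp 1)
    exact ⟨x, by rw [hx]; simp, by rw [hx]; decide⟩⟩
  have hp : IsPrincipalIdealRing 𝒪[k] := by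
    refine (Valuation.integer.integers v).isPrincipalIdealRing_iff_not_denselyOrdered_mrange.2
      fun h => ?_
    obtain ⟨x, hx⟩ := hdisc (WithZero.exp 1)
    obtain ⟨⟨z, hz⟩, h1, h2⟩ := h.dense (1 : MonoidHom.mrange v) ⟨WithZero.exp 1, x, hx⟩
      (Subtype.mk_lt_mk.2 (by rw [← WithZero.exp_zero]; exact WithZero.exp_lt_exp.2 one_pos))
    have h1' : 1 < z := h1
    have h2' : z < WithZero.exp 1 := h2
    obtain ⟨n, rfl⟩ : ∃ n, z = WithZero.exp n :=
      ⟨_, (WithZero.exp_log (ne_zero_of_lt h1')).symm⟩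
    rw [← WithZero.exp_zero, WithZero.exp_lt_exp] at h1'
    rw [WithZero.exp_lt_exp] at h2'
    omega
  exact { hp with not_a_field' := v.isNontrivial_iff_not_a_field.1 inferInstance }

theorem isCompact_integer [CompleteSpace k]
    (hdisc : Function.Surjective (Valued.v : Valuation k (WithZero (Multiplicative ℤ))))
    (hres : Finite (Valued.ResidueField k)) : IsCompact {x : k | Valued.v x ≤ 1} := by
  let v : Valuation k (WithZero (Multiplicative ℤ)) := Valued.v
  have : v.IsNontrivial := ⟨by
    obtain ⟨x, hx⟩ := hdisc (WithZero.exp 1)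
    exact ⟨x, by rw [hx]; simp, by rw [hx]; decide⟩⟩
  have : MulArchimedean (MonoidWithZeroHom.ValueGroup₀ (.ofClass v)) :=
    MulArchimedean.comap MonoidWithZeroHom.ValueGroup₀.embedding.toMonoidHom
      MonoidWithZeroHom.ValueGroup₀.embedding_strictMono
  have hr : Nonempty v.RankOne := Valuation.nonempty_rankOne_iff_mulArchimedean.2 inferInstance
  obtain ⟨_⟩ := hr
  have := isDiscreteValuationRing_integer hdisc
  have hcl : IsClosed {x : k | Valued.v x ≤ 1} := Valued.isClosed_integer k
  have : CompleteSpace 𝒪[k] := hcl.completeSpace_coe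
  exact isCompact_iff_compactSpace.2 <|
    Valued.integer.compactSpace_iff_completeSpace_and_isDiscreteValuationRing_and_finite_residueField.2
      ⟨this, inferInstance, hres⟩

theorem exists_le_valuation {A ι : Type} [TopologicalSpace A] {C : Set A} (hC : IsCompact C)
    {F : ι → A → k} (hF : ∀ i, Continuous (F i)) (h : ∀ x ∈ C, ∃ i, F i x ≠ 0) :
    ∃ γ : WithZero (Multiplicative ℤ), γ ≠ 0 ∧ ∀ x ∈ C, ∃ i, γ ≤ Valued.v (F i x) := by
  refine hC.induction_on (p := fun C => ∃ γ : WithZero (Multiplicative ℤ), γ ≠ 0 ∧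
    ∀ x ∈ C, ∃ i, γ ≤ Valued.v (F i x)) ⟨1, one_ne_zero, by simp⟩ ?_ ?_ ?_
  · rintro s t hst ⟨γ, h0, hγ⟩
    exact ⟨γ, h0, fun x hx => hγ x (hst hx)⟩
  · rintro s t ⟨γ, h0, hγ⟩ ⟨γ', h0', hγ'⟩
    refine ⟨min γ γ', by rcases min_choice γ γ' with h | h <;> rwa [h], ?_⟩
    rintro x (hx | hx)
    · exact (hγ x hx).imp fun i hi => (min_le_left _ _).trans hi
    · exact (hγ' x hx).imp fun i hi => (min_le_right _ _).trans hi
  · intro x hx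
    obtain ⟨i, hi⟩ := h x hx
    have hv : Valued.v (F i x) ≠ 0 := (Valuation.ne_zero_iff _).2 hi
    refine ⟨{y | Valued.v (F i y) = Valued.v (F i x)},
      mem_nhdsWithin_of_mem_nhds ((hF i).continuousAt (Valued.locally_const hv)),
      Valued.v (F i x), hv, fun y hy => ⟨i, (show Valued.v (F i y) = _ from hy).ge⟩⟩

theorem isClosed_valuation_eq_one : IsClosed {x : k | Valued.v x = 1} := by
  simpa using Valued.isClosed_sphere k 1

variable (k) in
/-- The vectors whose largest coordinate is a unit. -/
def primitiveVectors (n : ℕ) : Set (Fin n → k) :=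
  {x | (∀ i, Valued.v (x i) ≤ 1) ∧ ∃ i, Valued.v (x i) = 1}

theorem isCompact_primitiveVectors (hc : IsCompact {x : k | Valued.v x ≤ 1}) (n : ℕ) :
    IsCompact (primitiveVectors k n) := by
  have h1 : IsCompact {x : Fin n → k | ∀ i, x i ∈ {x : k | Valued.v x ≤ 1}} :=
    isCompact_pi_infinite fun _ => hc
  have h2 : IsClosed {x : Fin n → k | ∃ i, Valued.v (x i) = 1} := by
    rw [Set.ofPred_exists]
    exact isClosed_iUnion_of_finite fun i =>
      isClosed_valuation_eq_one.preimage (continuous_apply (A := fun _ => k) i)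
  exact h1.inter_right h2

/-- Scaling a nonzero vector to a primitive one. -/
theorem exists_smul_mem_primitiveVectors {n : ℕ} {x : Fin n → k} (hx : x ≠ 0) :
    ∃ i, x i ≠ 0 ∧ (x i)⁻¹ • x ∈ primitiveVectors k n ∧ ∀ j, Valued.v (x j) ≤ Valued.v (x i) := by
  obtain ⟨j, hj⟩ := Function.ne_iff.1 hx
  have : Nonempty (Fin n) := ⟨j⟩
  obtain ⟨i, hi⟩ := Finite.exists_max fun i => Valued.v (x i)
  have hi0 : x i ≠ 0 := fun h => hj (by simpa [h] using hi j)
  have hv : Valued.v (x i) ≠ 0 := (Valuation.ne_zero_iff _).2 hi0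
  refine ⟨i, hi0, ⟨fun j => ?_, i, by simp [hi0]⟩, hi⟩
  simp only [Pi.smul_apply, smul_eq_mul, map_mul, map_inv₀]
  exact inv_mul_le_one_of_le₀ (hi j) zero_le

/-- A root of `c u² - u + 1` for small `c`. -/
theorem exists_root_of_valuation_lt_one (hc : IsCompact {x : k | Valued.v x ≤ 1}) {c : k}
    (h : Valued.v c < 1) : ∃ u : k, c * u ^ 2 - u + 1 = 0 := by
  by_contra! hne
  obtain ⟨γ, h0, hγ⟩ := exists_le_valuation hc
    (F := fun (_ : Unit) (u : k) => c * u ^ 2 - u + 1) (fun _ => by fun_prop)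
    (fun x _ => ⟨(), hne x⟩)
  have key : ∀ n : ℕ, ∃ u : k, Valued.v u ≤ 1 ∧ Valued.v (c * u ^ 2 - u + 1) ≤ Valued.v c ^ n := by
    intro n
    induction n with
    | zero => exact ⟨0, by simp, by simp⟩
    | succ n ih =>
      obtain ⟨u, hu, hn⟩ := ih
      set d := c * u ^ 2 - u + 1
      have hd : Valued.v d ≤ 1 := hn.trans (pow_le_one₀ zero_le h.le)
      have hud : Valued.v (u + d) ≤ 1 := (Valuation.map_add _ _ _).trans (max_le hu hd)
      refine ⟨u + d, hud, ?_⟩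
      have e : c * (u + d) ^ 2 - (u + d) + 1 = c * d * ((u + d) + u) := by
        simp only [d]; ring
      rw [e, map_mul, map_mul, pow_succ', mul_assoc]
      gcongr
      calc Valued.v d * Valued.v (u + d + u) ≤ Valued.v d * 1 := by
            gcongr
            exact (Valuation.map_add _ _ _).trans (max_le hud hu)
        _ ≤ _ := by rwa [mul_one]
  obtain ⟨n, hn⟩ := exists_pow_lt₀ h (Units.mk0 γ h0)
  obtain ⟨u, hu, hn'⟩ := key n
  obtain ⟨_, hu'⟩ := hγ u hu
  exact absurd hn (not_lt.2 (hu'.trans hn'))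

theorem exists_sq_eq_one_add_four_mul (hc : IsCompact {x : k | Valued.v x ≤ 1}) {c : k}
    (h : Valued.v c < 1) : ∃ s : k, s ^ 2 = 1 + 4 * c := by
  obtain ⟨u, hu⟩ := exists_root_of_valuation_lt_one hc (c := -c) (by rwa [Valuation.map_neg])
  exact ⟨2 * (-c) * u - 1, by linear_combination (-4 * c) * hu⟩

end LocalField

section FiniteField

variable {F : Type} [Field F] [Finite F]

theorem exists_forall_sq_add_self_add_ne_zero : ∃ e : F, ∀ x : F, x ^ 2 + x + e ≠ 0 := by
  by_contra! h
  have hs : Function.Surjective fun x : F => x ^ 2 + x := fun e => by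
    obtain ⟨x, hx⟩ := h (-e)
    exact ⟨x, by linear_combination hx⟩
  have := Finite.injective_iff_surjective.2 hs (a₁ := 0) (a₂ := -1) (by ring)
  simp at this

/-- The class modulo squares of the discriminant of an irreducible `X ^ 2 + X + e` is unique. -/
theorem exists_sq_sub_self_mul_eq {e g : F} (he : ∀ x, x ^ 2 + x + e ≠ 0)
    (hg : ∀ x, x ^ 2 + x + g ≠ 0) : ∃ a : F, (a ^ 2 - a) * (1 - 4 * e) = e - g := by
  by_cases h2 : (2 : F) = 0
  · have : CharP F 2 := CharTwo.of_one_ne_zero_of_two_eq_zero one_ne_zero h2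
    let φ : F →+ F := AddMonoidHom.mk' (fun x => x ^ 2 + x) fun x y => by
      linear_combination x * y * h2
    have hφ : ∀ x, φ x = x ^ 2 + x := fun _ => rfl
    have hker : Nat.card φ.ker = 2 := by
      have : (φ.ker : Set F) = {0, 1} := by
        ext x
        rw [SetLike.mem_coe, AddMonoidHom.mem_ker, hφ]
        constructor
        · intro h
          rcases mul_eq_zero.1 (show x * (x + 1) = 0 by linear_combination h) with h | h
          · exact Or.inl h
          · exact Or.inr (Set.mem_singleton_iff.2 (by linear_combination h - h2))
        · rintro (rfl | rfl)
          · simp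
          · simpa [one_add_one_eq_two] using h2
      rw [← SetLike.coe_sort_coe, this, Nat.card_coe_set_eq, Set.ncard_pair zero_ne_one]
    have hidx : φ.range.index = 2 := by
      have h1 := φ.ker.card_mul_index
      have h3 := φ.range.card_mul_index
      rw [AddSubgroup.index_ker] at h1
      rw [← h3, mul_comm, hker] at h1
      exact (Nat.eq_of_mul_eq_mul_left Nat.card_pos (by rw [h1])).symm
    have hmem : ∀ z : F, (∀ x, x ^ 2 + x + z ≠ 0) → z ∉ φ.range := by
      rintro z hz ⟨x, hx⟩
      exact hz x (by rw [← hφ, hx]; linear_combination z * h2)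
    obtain ⟨a, ha⟩ := (AddSubgroup.add_mem_iff_of_index_two hidx (a := e) (b := g)).2
      (iff_of_false (hmem e he) (hmem g hg))
    rw [hφ] at ha
    exact ⟨a, by linear_combination ha - (2 * e * (a ^ 2 - a) + a - g) * h2⟩
  · have hsq : ∀ z : F, (∀ x, x ^ 2 + x + z ≠ 0) → ¬IsSquare (1 - 4 * z) := by
      rintro z hz ⟨s, hs⟩
      refine hz ((s - 1) / 2) ?_
      field_simp
      linear_combination -hs
    have := Fintype.ofFinite F
    classical
    have hF : ringChar F ≠ 2 := fun h => h2 (by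
      have := ringChar.Nat.cast_ringChar (R := F)
      rwa [h] at this)
    have h0 : 1 - 4 * e ≠ 0 := fun h => hsq e he (by simp [h])
    have hχ : quadraticChar F ((1 - 4 * e) * (1 - 4 * g)) = 1 := by
      rw [map_mul, quadraticChar_neg_one_iff_not_isSquare.2 (hsq e he),
        quadraticChar_neg_one_iff_not_isSquare.2 (hsq g hg)]
      rfl
    have h0' : 1 - 4 * g ≠ 0 := fun h => hsq g hg (by simp [h])
    obtain ⟨s, hs⟩ := (quadraticChar_one_iff_isSquare (mul_ne_zero h0 h0')).1 hχ
    refine ⟨(1 + s / (1 - 4 * e)) / 2, ?_⟩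
    have h4 : (4 : F) ≠ 0 := by
      rw [show (4 : F) = 2 * 2 by norm_num]
      exact mul_ne_zero h2 h2
    field_simp
    linear_combination -hs

theorem exists_ternary_zero (a b c u : F) :
    ∃ x y z : F, ¬(x = 0 ∧ y = 0 ∧ z = 0) ∧ a * x ^ 2 + b * x * y + c * y ^ 2 = u * z ^ 2 := by
  classical
  have := Fintype.ofFinite F
  let p := ringChar F
  have hp : Fact p.Prime := ⟨CharP.char_is_prime F p⟩
  let f : MvPolynomial (Fin 3) F := .C a * .X 0 ^ 2 + .C b * .X 0 * .X 1 + .C c * .X 1 ^ 2 +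
    .C (-u) * .X 2 ^ 2
  have hf : f.totalDegree < Fintype.card (Fin 3) := by
    have hm : ∀ (a : F) (i j : Fin 3),
        (MvPolynomial.C a * .X i * .X j : MvPolynomial (Fin 3) F).totalDegree ≤ 2 := fun a i j => by
      refine (MvPolynomial.totalDegree_mul _ _).trans ?_
      grw [MvPolynomial.totalDegree_mul]
      simp
    have h1 : f = .C a * .X 0 * .X 0 + .C b * .X 0 * .X 1 + .C c * .X 1 * .X 1 +
      .C (-u) * .X 2 * .X 2 := by simp only [f]; ring
    rw [h1, Fintype.card_fin, Nat.lt_succ_iff]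
    refine (MvPolynomial.totalDegree_add _ _).trans (max_le ?_ (hm ..))
    refine (MvPolynomial.totalDegree_add _ _).trans (max_le ?_ (hm ..))
    exact (MvPolynomial.totalDegree_add _ _).trans (max_le (hm ..) (hm ..))
  have hdvd := char_dvd_card_solutions p hf
  have h0 : MvPolynomial.eval (0 : Fin 3 → F) f = 0 := by simp [f]
  have hcard : 1 < Fintype.card {x : Fin 3 → F // MvPolynomial.eval x f = 0} :=
    hp.out.one_lt.trans_le (Nat.le_of_dvd (Fintype.card_pos_iff.2 ⟨⟨0, h0⟩⟩) hdvd)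
  obtain ⟨⟨x, hx⟩, hne⟩ := Fintype.exists_ne_of_one_lt_card hcard ⟨0, h0⟩
  refine ⟨x 0, x 1, x 2, fun h => hne (Subtype.ext (funext fun i => ?_)), ?_⟩
  · fin_cases i
    · exact h.1
    · exact h.2.1
    · exact h.2.2
  · simp only [f, map_add, map_mul, map_pow, MvPolynomial.eval_C, MvPolynomial.eval_X] at hx
    linear_combination hx

end FiniteField

section BinaryForms

open scoped Valued

variable [Valued k (WithZero (Multiplicative ℤ))]

theorem residue_eq_zero_iff (x : 𝒪[k]) :
    IsLocalRing.residue 𝒪[k] x = 0 ↔ Valued.v (x : k) < 1 := by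
  rw [IsLocalRing.residue_eq_zero_iff, IsLocalRing.mem_maximalIdeal, mem_nonunits_iff,
    Valuation.Integer.not_isUnit_iff_valuation_lt_one]

theorem valuation_add_le_one {x y : k} (hx : Valued.v x ≤ 1) (hy : Valued.v y ≤ 1) :
    Valued.v (x + y) ≤ 1 :=
  (Valuation.map_add _ _ _).trans (max_le hx hy)

theorem valuation_mul_le_one {x y : k} (hx : Valued.v x ≤ 1) (hy : Valued.v y ≤ 1) :
    Valued.v (x * y) ≤ 1 := by
  rw [map_mul]
  exact mul_le_one' hx hy

theorem valuation_mul_lt_one {x y : k} (hx : Valued.v x ≤ 1) (hy : Valued.v y < 1) :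
    Valued.v (x * y) < 1 := by
  rw [map_mul]
  exact (mul_le_of_le_one_left' hx).trans_lt hy

theorem valuation_two_le_one : Valued.v (2 : k) ≤ 1 := by
  rw [← one_add_one_eq_two]
  exact valuation_add_le_one (by simp) (by simp)

theorem valuation_four_le_one : Valued.v (4 : k) ≤ 1 := by
  rw [show (4 : k) = 2 * 2 by norm_num]
  exact valuation_mul_le_one valuation_two_le_one valuation_two_le_one

/-- `X ^ 2 + X + e` is integral and has no root modulo the maximal ideal. -/
def ResidueIrreducible (e : k) : Prop :=
  Valued.v e ≤ 1 ∧ ∀ x : k, Valued.v x ≤ 1 → Valued.v (x ^ 2 + x + e) = 1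

theorem ResidueIrreducible.residue_ne_zero {e : k} (h : ResidueIrreducible e)
    (x : Valued.ResidueField k) :
    x ^ 2 + x + IsLocalRing.residue 𝒪[k] ⟨e, h.1⟩ ≠ 0 := by
  obtain ⟨y, rfl⟩ := IsLocalRing.residue_surjective x
  rw [← map_pow, ← map_add, ← map_add, Ne, residue_eq_zero_iff]
  exact (h.2 y y.2).not_lt

theorem exists_residueIrreducible (hres : Finite (Valued.ResidueField k)) :
    ∃ e : k, ResidueIrreducible e := by
  obtain ⟨e, he⟩ := exists_forall_sq_add_self_add_ne_zero (F := Valued.ResidueField k)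
  obtain ⟨e, rfl⟩ := IsLocalRing.residue_surjective e
  refine ⟨e, e.2, fun x hx => ?_⟩
  have := he (IsLocalRing.residue 𝒪[k] ⟨x, hx⟩)
  rw [← map_pow, ← map_add, ← map_add, Ne, residue_eq_zero_iff] at this
  exact le_antisymm
    (valuation_add_le_one (valuation_add_le_one (by simpa using pow_le_one₀ zero_le hx) hx) e.2)
    (not_lt.1 this)

theorem ResidueIrreducible.exists_sq_sub_self (hres : Finite (Valued.ResidueField k)) {e g : k}
    (he : ResidueIrreducible e) (hg : ResidueIrreducible g) :
    ∃ a : k, Valued.v ((a ^ 2 - a) * (1 - 4 * e) - (e - g)) < 1 := by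
  obtain ⟨a, ha⟩ := exists_sq_sub_self_mul_eq he.residue_ne_zero hg.residue_ne_zero
  obtain ⟨a, rfl⟩ := IsLocalRing.residue_surjective a
  refine ⟨a, (residue_eq_zero_iff ((a ^ 2 - a) * (1 - 4 * ⟨e, he.1⟩) -
    (⟨e, he.1⟩ - ⟨g, hg.1⟩))).1 ?_⟩
  simp only [map_sub, map_mul, map_pow, map_one, map_ofNat] at ha ⊢
  rw [ha, sub_self]

theorem ResidueIrreducible.valuation_disc {e : k} (he : ResidueIrreducible e) :
    Valued.v (1 - 4 * e) = 1 := by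
  have h4 : (4 : k) = 2 * 2 := by norm_num
  rcases (valuation_two_le_one (k := k)).lt_or_eq with h2 | h2
  · refine Valuation.map_one_sub_of_lt _ ?_
    rw [h4, mul_comm, ← mul_assoc]
    exact valuation_mul_lt_one (valuation_mul_le_one he.1 h2.le) h2
  · have h0 : (2 : k) ≠ 0 := (Valuation.ne_zero_iff Valued.v).1 (by simp [h2])
    have h := he.2 (-1 / 2) (by simp [h2])
    have e1 : 1 - 4 * e = -(2 * 2) * ((-1 / 2) ^ 2 + -1 / 2 + e) := by
      field_simp
      ring
    rw [e1, map_mul, h, Valuation.map_neg, map_mul, h2]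
    simp

theorem exists_ternary_valuation_lt_one (hres : Finite (Valued.ResidueField k)) {a b c u : k}
    (ha : Valued.v a ≤ 1) (hb : Valued.v b ≤ 1) (hc : Valued.v c ≤ 1) (hu : Valued.v u ≤ 1) :
    ∃ x y z : k, Valued.v x ≤ 1 ∧ Valued.v y ≤ 1 ∧ Valued.v z ≤ 1 ∧
      ¬(Valued.v x < 1 ∧ Valued.v y < 1 ∧ Valued.v z < 1) ∧
      Valued.v (a * x ^ 2 + b * x * y + c * y ^ 2 - u * z ^ 2) < 1 := by
  let r := IsLocalRing.residue 𝒪[k]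
  obtain ⟨x, y, z, h0, h⟩ := exists_ternary_zero (r ⟨a, ha⟩) (r ⟨b, hb⟩) (r ⟨c, hc⟩) (r ⟨u, hu⟩)
  obtain ⟨x, rfl⟩ := IsLocalRing.residue_surjective x
  obtain ⟨y, rfl⟩ := IsLocalRing.residue_surjective y
  obtain ⟨z, rfl⟩ := IsLocalRing.residue_surjective z
  refine ⟨x, y, z, x.2, y.2, z.2, by simpa only [residue_eq_zero_iff] using h0,
    (residue_eq_zero_iff (⟨a, ha⟩ * x ^ 2 + ⟨b, hb⟩ * x * y + ⟨c, hc⟩ * y ^ 2 -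
      ⟨u, hu⟩ * z ^ 2)).1 ?_⟩
  simp only [r, ← map_mul, ← map_pow, ← map_add] at h
  rw [map_sub, h, sub_self]

theorem exists_sq_add_valuation_lt_one (hres : Finite (Valued.ResidueField k))
    (h2 : Valued.v (2 : k) < 1) {c : k} (hc : Valued.v c ≤ 1) :
    ∃ x : k, Valued.v x ≤ 1 ∧ Valued.v (x ^ 2 + c) < 1 := by
  have h2' : (2 : Valued.ResidueField k) = 0 := by
    rw [← map_ofNat (IsLocalRing.residue 𝒪[k]) 2, residue_eq_zero_iff]
    exact h2
  have : ringChar (Valued.ResidueField k) = 2 :=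
    have := CharTwo.of_one_ne_zero_of_two_eq_zero one_ne_zero h2'
    ringChar.eq _ 2
  obtain ⟨x, hx⟩ := FiniteField.isSquare_of_char_two this
    (-IsLocalRing.residue 𝒪[k] ⟨c, hc⟩)
  obtain ⟨x, rfl⟩ := IsLocalRing.residue_surjective x
  refine ⟨x, x.2, (residue_eq_zero_iff (x ^ 2 + ⟨c, hc⟩)).1 ?_⟩
  rw [map_add, map_pow, pow_two, ← hx, neg_add_cancel]

/-- The binary form with coefficients `a, b, c` has the values of a norm form of an unramified
quadratic extension. -/
def IsUnramifiedForm (a b c : k) : Prop :=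
  ∀ x y : k, Valued.v (a * x ^ 2 + b * x * y + c * y ^ 2) = max (Valued.v x) (Valued.v y) ^ 2

namespace IsUnramifiedForm

variable {a b c : k}

theorem valuation_left (h : IsUnramifiedForm a b c) : Valued.v a = 1 := by
  simpa using h 1 0

theorem valuation_right (h : IsUnramifiedForm a b c) : Valued.v c = 1 := by
  simpa using h 0 1

theorem valuation_mid (h : IsUnramifiedForm a b c) : Valued.v b ≤ 1 := by
  have h1 : b = (a * 1 ^ 2 + b * 1 * 1 + c * 1 ^ 2) - (a + c) := by ring
  rw [h1]
  refine (Valuation.map_sub _ _ _).trans (max_le ?_ ?_)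
  · rw [h 1 1]
    simp
  · exact valuation_add_le_one h.valuation_left.le h.valuation_right.le

/-- After a change of variables the middle coefficient is a unit. -/
theorem shear (h : IsUnramifiedForm a b c) : IsUnramifiedForm a (b + 2 * a) (a + b + c) := by
  intro x y
  have h1 : a * x ^ 2 + (b + 2 * a) * x * y + (a + b + c) * y ^ 2 =
    a * (x + y) ^ 2 + b * (x + y) * y + c * y ^ 2 := by ring
  rw [h1, h]
  congr 1
  refine le_antisymm (max_le ((Valuation.map_add _ _ _).trans le_rfl) (le_max_right _ _))
    (max_le ?_ (le_max_right _ _))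
  have : x = (x + y) - y := by ring
  conv_lhs => rw [this]
  exact Valuation.map_sub _ _ _

theorem valuation_mid_or (hres : Finite (Valued.ResidueField k)) (h : IsUnramifiedForm a b c) :
    Valued.v b = 1 ∨ Valued.v (b + 2 * a) = 1 := by
  by_contra! hb
  have hb1 : Valued.v b < 1 := lt_of_le_of_ne h.valuation_mid hb.1
  have h2a : Valued.v (2 * a) < 1 := by
    have : 2 * a = (b + 2 * a) - b := by ring
    rw [this]
    exact (Valuation.map_sub _ _ _).trans_lt
      (max_lt (lt_of_le_of_ne h.shear.valuation_mid hb.2) hb1)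
  have h2 : Valued.v (2 : k) < 1 := by rwa [map_mul, h.valuation_left, mul_one] at h2a
  have ha0 : a ≠ 0 := (Valuation.ne_zero_iff Valued.v).1 (by simp [h.valuation_left])
  obtain ⟨x, hx, hx'⟩ := exists_sq_add_valuation_lt_one hres h2 (c := c / a)
    (by simp [h.valuation_left, h.valuation_right])
  have e : a * x ^ 2 + b * x * 1 + c * 1 ^ 2 = a * (x ^ 2 + c / a) + x * b := by
    field_simp
    ring
  have h1 := h x 1
  rw [e, map_one, max_eq_right hx, one_pow] at h1
  refine absurd h1 (ne_of_lt ?_)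
  exact (Valuation.map_add _ _ _).trans_lt
    (max_lt (valuation_mul_lt_one h.valuation_left.le hx') (valuation_mul_lt_one hx hb1))

theorem residueIrreducible (h : IsUnramifiedForm a b c) (hb : Valued.v b = 1) :
    ResidueIrreducible (a * c / b ^ 2) := by
  have ha0 : a ≠ 0 := (Valuation.ne_zero_iff Valued.v).1 (by simp [h.valuation_left])
  have hb0 : b ≠ 0 := (Valuation.ne_zero_iff Valued.v).1 (by simp [hb])
  refine ⟨by simp [h.valuation_left, h.valuation_right, hb], fun x hx => ?_⟩
  have h1 := h (b * x / a) 1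
  have e : a * (b * x / a) ^ 2 + b * (b * x / a) * 1 + c * 1 ^ 2 =
      b ^ 2 / a * (x ^ 2 + x + a * c / b ^ 2) := by
    field_simp
  rw [e, map_mul, map_div₀, map_pow, hb, h.valuation_left] at h1
  simpa [hb, h.valuation_left, max_eq_right hx] using h1

/-- The discriminant of an unramified form. -/
theorem sqEq_disc (hc : IsCompact {x : k | Valued.v x ≤ 1})
    (hres : Finite (Valued.ResidueField k)) (h : IsUnramifiedForm a b c)
    (hb : Valued.v b = 1) {e : k} (he : ResidueIrreducible e) :
    SqEq (b ^ 2 - 4 * a * c) (1 - 4 * e) := by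
  have hb0 : b ≠ 0 := (Valuation.ne_zero_iff Valued.v).1 (by simp [hb])
  have hg := h.residueIrreducible hb
  set g := a * c / b ^ 2 with hgdef
  obtain ⟨t, ht⟩ := he.exists_sq_sub_self hres hg
  have hg1 := hg.valuation_disc
  have hg0 : 1 - 4 * g ≠ 0 := (Valuation.ne_zero_iff Valued.v).1 (by simp [hg1])
  have he0 : 1 - 4 * e ≠ 0 := (Valuation.ne_zero_iff Valued.v).1 (by simp [he.valuation_disc])
  obtain ⟨s, hs⟩ := exists_sq_eq_one_add_four_mul hc
    (c := ((t ^ 2 - t) * (1 - 4 * e) - (e - g)) / (1 - 4 * g)) (by simpa [hg1] using ht)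
  have hac : a * c = g * b ^ 2 := by
    rw [hgdef]
    field_simp
  have key : (1 - 4 * g) * s ^ 2 = (1 - 4 * e) * (2 * t - 1) ^ 2 := by
    rw [hs]
    field_simp
    ring
  have hs0 : s ≠ 0 := by
    rintro rfl
    have h4 : 1 + 4 * (((t ^ 2 - t) * (1 - 4 * e) - (e - g)) / (1 - 4 * g)) = 0 := by
      rw [← hs]
      ring
    have : Valued.v (4 * (((t ^ 2 - t) * (1 - 4 * e) - (e - g)) / (1 - 4 * g))) < 1 :=
      valuation_mul_lt_one valuation_four_le_one (by simpa [hg1] using ht)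
    rw [eq_neg_of_add_eq_zero_right h4] at this
    simp at this
  have ht0 : 2 * t - 1 ≠ 0 := by
    intro h0
    rw [h0] at key
    simp [hg0, hs0] at key
  refine ⟨b * (2 * t - 1) / s, div_ne_zero (mul_ne_zero hb0 ht0) hs0, ?_⟩
  field_simp
  linear_combination b ^ 2 * key - 4 * s ^ 2 * hac

/-- A zero modulo the maximal ideal with a unit partial derivative lifts. -/
theorem exists_eq_of_polar (hc : IsCompact {x : k | Valued.v x ≤ 1}) {m β κ : k}
    (hm : Valued.v m < 1) (hβ : Valued.v β = 1) (hκ : Valued.v κ ≤ 1) :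
    ∃ s : k, m + s * β + s ^ 2 * κ = 0 := by
  have hβ0 : β ≠ 0 := (Valuation.ne_zero_iff Valued.v).1 (by simp [hβ])
  obtain ⟨w, hw⟩ := exists_root_of_valuation_lt_one hc (c := κ * m / β ^ 2)
    (by simpa [hβ] using valuation_mul_lt_one hκ hm)
  refine ⟨-w * m / β, ?_⟩
  field_simp at hw ⊢
  linear_combination m * hw

/-- An unramified form represents all units. -/
theorem exists_eq (hc : IsCompact {x : k | Valued.v x ≤ 1})
    (hres : Finite (Valued.ResidueField k)) (h : IsUnramifiedForm a b c)
    (hb : Valued.v b = 1) {u : k} (hu : Valued.v u = 1) :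
    ∃ x y : k, a * x ^ 2 + b * x * y + c * y ^ 2 = u := by
  obtain ⟨x, y, z, hx, hy, hz, hxyz, hm⟩ := exists_ternary_valuation_lt_one hres
    h.valuation_left.le hb.le h.valuation_right.le hu.le
  set q := a * x ^ 2 + b * x * y + c * y ^ 2 with hq
  have hz1 : Valued.v z = 1 := by
    by_contra hz1
    have hz1 : Valued.v z < 1 := lt_of_le_of_ne hz hz1
    have h1 : Valued.v q < 1 := by
      have : q = (q - u * z ^ 2) + u * z ^ 2 := by ring
      rw [this]
      refine (Valuation.map_add _ _ _).trans_lt (max_lt hm ?_)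
      rw [pow_two, ← mul_assoc]
      exact valuation_mul_lt_one (valuation_mul_le_one hu.le hz) hz1
    rw [hq, h] at h1
    have h2 : max (Valued.v x) (Valued.v y) < 1 :=
      lt_of_not_ge fun h2 => h1.not_ge (one_le_pow₀ h2)
    exact hxyz ⟨(le_max_left _ _).trans_lt h2, (le_max_right _ _).trans_lt h2, hz1⟩
  have hz0 : z ≠ 0 := (Valuation.ne_zero_iff Valued.v).1 (by simp [hz1])
  have hq1 : Valued.v q = 1 := by
    have : q = (q - u * z ^ 2) + u * z ^ 2 := by ring
    rw [this, Valuation.map_add_eq_of_lt_right _ (by simpa [hu, hz1] using hm)]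
    simp [hu, hz1]
  suffices ∃ x y : k, a * x ^ 2 + b * x * y + c * y ^ 2 = u * z ^ 2 by
    obtain ⟨x, y, hxy⟩ := this
    refine ⟨x / z, y / z, ?_⟩
    field_simp
    linear_combination hxy
  have hβ : Valued.v (2 * a * x + b * y) = 1 ∨ Valued.v (b * x + 2 * c * y) = 1 := by
    by_contra! hβ
    have h2 := valuation_two_le_one (k := k)
    have hax := valuation_mul_le_one h.valuation_left.le hx
    have hcy := valuation_mul_le_one h.valuation_right.le hy
    have h1 : Valued.v (2 * a * x + b * y) < 1 := lt_of_le_of_ne (by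
      rw [mul_assoc]
      exact valuation_add_le_one (valuation_mul_le_one h2 hax)
        (valuation_mul_le_one hb.le hy)) hβ.1
    have h1' : Valued.v (b * x + 2 * c * y) < 1 := lt_of_le_of_ne (by
      rw [mul_assoc]
      exact valuation_add_le_one (valuation_mul_le_one hb.le hx)
        (valuation_mul_le_one h2 hcy)) hβ.2
    rcases h2.lt_or_eq with h2 | h2
    · have hy1 : Valued.v y < 1 := by
        have e : b * y = (2 * a * x + b * y) - a * x * 2 := by ring
        have : Valued.v (b * y) = Valued.v y := by rw [map_mul, hb, one_mul]
        rw [← this, e]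
        exact (Valuation.map_sub _ _ _).trans_lt (max_lt h1 (valuation_mul_lt_one hax h2))
      have hx1 : Valued.v x < 1 := by
        have e : b * x = (b * x + 2 * c * y) - c * y * 2 := by ring
        have : Valued.v (b * x) = Valued.v x := by rw [map_mul, hb, one_mul]
        rw [← this, e]
        exact (Valuation.map_sub _ _ _).trans_lt (max_lt h1' (valuation_mul_lt_one hcy h2))
      rw [hq, h] at hq1
      exact hq1.not_lt (pow_lt_one₀ zero_le (max_lt hx1 hy1) two_ne_zero)
    · have e : 2 * q = x * (2 * a * x + b * y) + y * (b * x + 2 * c * y) := by ring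
      have : Valued.v (2 * q) < 1 := by
        rw [e]
        exact (Valuation.map_add _ _ _).trans_lt
          (max_lt (valuation_mul_lt_one hx h1) (valuation_mul_lt_one hy h1'))
      rw [map_mul, h2, hq1] at this
      exact absurd this (by simp)
  rcases hβ with hβ | hβ
  · obtain ⟨s, hs⟩ := exists_eq_of_polar hc hm hβ h.valuation_left.le
    exact ⟨x + s, y, by linear_combination hs⟩
  · obtain ⟨s, hs⟩ := exists_eq_of_polar hc hm hβ h.valuation_right.le
    exact ⟨x, y + s, by linear_combination hs⟩

end IsUnramifiedForm

end BinaryForms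

namespace QuadraticSpace

open QuadraticMap

section Ultrametric

variable {V : Type} [AddCommGroup V] [Module k V]

theorem exists_injective_of_le_finrank [FiniteDimensional k V] {n : ℕ}
    (hV : n ≤ Module.finrank k V) : ∃ g : (Fin n → k) →ₗ[k] V, Function.Injective g := by
  obtain ⟨f, hf⟩ := exists_linearIndependent_of_le_finrank hV
  exact ⟨Fintype.linearCombination k f,
    linearIndependent_iff_injective_fintypeLinearCombination.1 hf⟩

theorem anisotropic_comp {W : Type} [AddCommGroup W] [Module k W] {Q : QuadraticForm k V}
    (hQ : Q.Anisotropic) {g : W →ₗ[k] V} (hg : Function.Injective g) :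
    (Q.comp g).Anisotropic := fun _ hx =>
  hg ((hQ _ hx).trans (map_zero g).symm)

variable [Valued k (WithZero (Multiplicative ℤ))]

theorem valuation_polar_sq_le (hc : IsCompact {x : k | Valued.v x ≤ 1})
    {Q : QuadraticForm k V} (hQ : Q.Anisotropic) (x y : V) :
    Valued.v (polar Q x y) ^ 2 ≤ Valued.v (Q x) * Valued.v (Q y) := by
  by_contra! hlt
  set b := polar Q x y with hb
  have hb0 : b ≠ 0 := by
    rintro h
    simp [h] at hlt
  obtain ⟨u, hu⟩ := exists_root_of_valuation_lt_one hc (c := Q x * Q y / b ^ 2) (by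
    rw [map_div₀, map_mul, map_pow]
    exact (div_lt_one₀ (zero_le.trans_lt hlt)).2 hlt)
  have h1 : Q ((-u * Q y / b) • x + (1 : k) • y) = 0 := by
    rw [map_lin_comb, ← hb]
    field_simp at hu ⊢
    linear_combination Q y * hu
  have hy : y = (u * Q y / b) • x := by
    have := hQ _ h1
    rw [one_smul, add_comm, add_eq_zero_iff_eq_neg, ← neg_smul] at this
    rwa [neg_mul, neg_div, neg_neg] at this
  have hQy : Q y = (u * Q y / b) * (u * Q y / b) * Q x := by
    conv_lhs => rw [hy, map_smul_eq]
  have hbe : b = (u * Q y / b) * (2 * Q x) := by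
    conv_lhs => rw [hb, hy, polar_smul_right, polar_self', smul_eq_mul]
  set s := u * Q y / b
  have h4 : b ^ 2 = 2 * 2 * (Q x * Q y) := by
    rw [hQy, hbe]
    ring
  rw [← map_mul, ← map_pow, h4, map_mul _ (2 * 2), map_mul] at hlt
  refine hlt.not_ge (mul_le_of_le_one_left' ?_)
  exact valuation_mul_le_one valuation_two_le_one valuation_two_le_one

theorem valuation_map_add_le (hc : IsCompact {x : k | Valued.v x ≤ 1})
    {Q : QuadraticForm k V} (hQ : Q.Anisotropic) (x y : V) :
    Valued.v (Q (x + y)) ≤ max (Valued.v (Q x)) (Valued.v (Q y)) := by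
  rw [map_add_eq]
  refine (Valuation.map_add _ _ _).trans (max_le (Valuation.map_add _ _ _) ?_)
  have h := valuation_polar_sq_le hc hQ x y
  refine le_of_not_gt fun hlt => h.not_gt ?_
  rw [pow_two]
  exact mul_lt_mul'' ((le_max_left _ _).trans_lt hlt) ((le_max_right _ _).trans_lt hlt)
    zero_le zero_le

theorem continuous_form (h2 : (2 : k) ≠ 0) {n : ℕ} (Q : QuadraticForm k (Fin n → k)) :
    Continuous Q := by
  have h : (Q : (Fin n → k) → k) = fun x => 2⁻¹ * ∑ i, x i * Q.polarBilin (Pi.single i 1) x := by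
    funext x
    have h1 : polar Q x x = ∑ i, x i * Q.polarBilin (Pi.single i 1) x := by
      have h3 := congrArg (fun z => Q.polarBilin z x) (pi_eq_sum_univ' x)
      simpa using h3
    rw [← h1, polar_self', inv_mul_cancel_left₀ h2]
  rw [h]
  refine continuous_const.mul (continuous_finsetSum _ fun i _ => (continuous_apply i).mul ?_)
  exact LinearMap.continuous_on_pi _

/-- Minimal value of an anisotropic form on a set of vectors with a coordinate equal to one. -/
theorem exists_min (h2 : (2 : k) ≠ 0) (hc : IsCompact {x : k | Valued.v x ≤ 1}) {n : ℕ}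
    {Q : QuadraticForm k (Fin n → k)} (hQ : Q.Anisotropic) {j : Fin n} {S : Set (Fin n → k)}
    (hS : ∀ x ∈ S, x j = 1) (hne : S.Nonempty) :
    ∃ w ∈ S, ∀ x ∈ S, Valued.v (Q w) ≤ Valued.v (Q x) := by
  obtain ⟨γ, h0, hγ⟩ := exists_le_valuation (isCompact_primitiveVectors hc n)
    (F := fun (_ : Unit) => Q) (fun _ => continuous_form h2 Q) (fun x hx => ⟨(), fun h => by
      obtain ⟨i, hi⟩ := hx.2
      simp [hQ x h] at hi⟩)
  have hx0 : ∀ x ∈ S, Q x ≠ 0 := fun x hx h => by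
    have := hS x hx
    simp [hQ x h] at this
  have hle : ∀ x ∈ S, γ ≤ Valued.v (Q x) := fun x hx => by
    have hx0 : x ≠ 0 := fun h => hx0 x hx (by rw [h, QuadraticMap.map_zero])
    obtain ⟨i, hi, hp, hmax⟩ := exists_smul_mem_primitiveVectors hx0
    obtain ⟨_, h⟩ := hγ _ hp
    refine h.trans ?_
    rw [map_smul_eq, map_mul]
    refine mul_le_of_le_one_left' ?_
    have : Valued.v (x i)⁻¹ ≤ 1 := by
      have h1 := hmax j
      rw [hS x hx, map_one] at h1
      rw [map_inv₀]
      exact inv_le_one_of_one_le₀ h1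
    exact valuation_mul_le_one this this
  have hv0 : ∀ x ∈ S, Valued.v (Q x) ≠ 0 := fun x hx => (Valuation.ne_zero_iff _).2 (hx0 x hx)
  obtain ⟨m, ⟨w, hw, rfl⟩, hm⟩ := Int.exists_least_of_bdd
    (P := fun z => ∃ x ∈ S, WithZero.log (Valued.v (Q x)) = z)
    ⟨WithZero.log γ, by
      rintro _ ⟨x, hx, rfl⟩
      exact (WithZero.log_le_log h0 (hv0 x hx)).2 (hle x hx)⟩
    (by
      obtain ⟨x, hx⟩ := hne
      exact ⟨_, x, hx, rfl⟩)
  exact ⟨w, hw, fun x hx => (WithZero.log_le_log (hv0 w hw) (hv0 x hx)).1 (hm _ ⟨x, hx, rfl⟩)⟩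

/-- Orthogonality with respect to the norm attached to an anisotropic form. -/
def NormIndep (Q : QuadraticForm k V) (x y : V) : Prop :=
  ∀ a b : k, Valued.v (Q (a • x + b • y)) =
    max (Valued.v a ^ 2 * Valued.v (Q x)) (Valued.v b ^ 2 * Valued.v (Q y))

theorem valuation_map_smul (Q : QuadraticForm k V) (a : k) (x : V) :
    Valued.v (Q (a • x)) = Valued.v a ^ 2 * Valued.v (Q x) := by
  rw [map_smul_eq, map_mul, map_mul, pow_two]

theorem normIndep_of_min (hc : IsCompact {x : k | Valued.v x ≤ 1})
    {Q : QuadraticForm k V} (hQ : Q.Anisotropic) {x y : V}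
    (h : ∀ a : k, Valued.v (Q y) ≤ Valued.v (Q (y + a • x))) : NormIndep Q x y := by
  intro a b
  have hle := valuation_map_add_le hc hQ (a • x) (b • y)
  simp only [valuation_map_smul] at hle
  refine le_antisymm hle ?_
  have h1 : Valued.v b ^ 2 * Valued.v (Q y) ≤ Valued.v (Q (a • x + b • y)) := by
    by_cases hb : b = 0
    · simp [hb]
    · have e : a • x + b • y = b • (y + (b⁻¹ * a) • x) := by
        rw [smul_add, smul_smul, mul_inv_cancel_left₀ hb, add_comm]
      rw [e, valuation_map_smul]
      gcongr
      exact h _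
  refine max_le ?_ h1
  have h3 := valuation_map_add_le hc hQ (a • x + b • y) ((-b) • y)
  rw [add_assoc, ← add_smul, add_neg_cancel, zero_smul, add_zero, valuation_map_smul,
    valuation_map_smul, Valuation.map_neg] at h3
  exact h3.trans (max_le le_rfl h1)

theorem NormIndep.of_comp {W : Type} [AddCommGroup W] [Module k W] {Q : QuadraticForm k V}
    {g : W →ₗ[k] V} {x y : W} (h : NormIndep (Q.comp g) x y) : NormIndep Q (g x) (g y) :=
  fun a b => by simpa using h a b

theorem exists_normIndep_two (h2 : (2 : k) ≠ 0) (hc : IsCompact {x : k | Valued.v x ≤ 1})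
    [FiniteDimensional k V] {Q : QuadraticForm k V} (hQ : Q.Anisotropic)
    (hV : 2 ≤ Module.finrank k V) : ∃ x y, x ≠ 0 ∧ y ≠ 0 ∧ NormIndep Q x y := by
  obtain ⟨g, hg⟩ := exists_injective_of_le_finrank hV
  have hQ' := anisotropic_comp hQ hg
  have ne : ∀ {x : Fin 2 → k}, x ≠ 0 → g x ≠ 0 := fun hx => (map_ne_zero_iff g hg).2 hx
  obtain ⟨y, hy1, hy⟩ := exists_min h2 hc hQ' (j := 1) (S := {x | x 1 = 1})
    (fun x hx => hx) ⟨Pi.single 1 1, by simp⟩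
  have hy1 : y 1 = 1 := hy1
  refine ⟨g (Pi.single 0 1), g y, ne fun h => ?_, ne fun h => ?_,
    (normIndep_of_min hc hQ' fun a => hy _ ?_).of_comp⟩
  · simp at h
  · simp [h] at hy1
  · simp [hy1]

theorem exists_normIndep_three (h2 : (2 : k) ≠ 0) (hc : IsCompact {x : k | Valued.v x ≤ 1})
    [FiniteDimensional k V] {Q : QuadraticForm k V} (hQ : Q.Anisotropic)
    (hV : 3 ≤ Module.finrank k V) : ∃ x y z, x ≠ 0 ∧ y ≠ 0 ∧ z ≠ 0 ∧ NormIndep Q x y ∧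
      NormIndep Q x z ∧ NormIndep Q y z := by
  obtain ⟨g, hg⟩ := exists_injective_of_le_finrank hV
  have hQ' := anisotropic_comp hQ hg
  have ne : ∀ {x : Fin 3 → k}, x ≠ 0 → g x ≠ 0 := fun hx => (map_ne_zero_iff g hg).2 hx
  obtain ⟨y, ⟨hy1, hy2⟩, hy⟩ := exists_min h2 hc hQ' (j := 1) (S := {x | x 1 = 1 ∧ x 2 = 0})
    (fun x hx => hx.1) ⟨Pi.single 1 1, by simp⟩
  obtain ⟨z, hz2, hz⟩ := exists_min h2 hc hQ' (j := 2) (S := {x | x 2 = 1})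
    (fun x hx => hx) ⟨Pi.single 2 1, by simp⟩
  have hz2 : z 2 = 1 := hz2
  refine ⟨g (Pi.single 0 1), g y, g z, ne fun h => ?_, ne fun h => ?_, ne fun h => ?_,
    (normIndep_of_min hc hQ' fun a => hy _ ?_).of_comp,
    (normIndep_of_min hc hQ' fun a => hz _ ?_).of_comp,
    (normIndep_of_min hc hQ' fun a => hz _ ?_).of_comp⟩
  · simp at h
  · simp [h] at hy1
  · simp [h] at hz2
  · simp [hy1, hy2]
  · simp [hz2]
  · simp [hz2, hy2]

end Ultrametric

end QuadraticSpace

section NormForm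

variable [Valued k (WithZero (Multiplicative ℤ))]

theorem ResidueIrreducible.isUnramifiedForm {e : k} (he : ResidueIrreducible e) :
    IsUnramifiedForm 1 1 e := by
  intro x y
  rcases le_or_gt (Valued.v x) (Valued.v y) with h | h
  · rw [max_eq_right h]
    by_cases hy : y = 0
    · have hx : x = 0 := by simpa [hy] using h
      simp [hx, hy]
    · have e1 : 1 * x ^ 2 + 1 * x * y + e * y ^ 2 = y ^ 2 * ((x / y) ^ 2 + x / y + e) := by
        field_simp
      rw [e1, map_mul, he.2 (x / y), mul_one, map_pow]
      rw [map_div₀]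
      exact div_le_one_of_le₀ h zero_le
  · rw [max_eq_left h.le]
    have e1 : 1 * x ^ 2 + 1 * x * y + e * y ^ 2 = x ^ 2 + y * (x + e * y) := by ring
    rw [e1, Valuation.map_add_eq_of_lt_left, map_pow]
    rw [map_mul, map_pow, pow_two]
    have hx : 0 < Valued.v x := zero_le.trans_lt h
    have : Valued.v (x + e * y) ≤ Valued.v x := by
      refine (Valuation.map_add _ _ _).trans (max_le le_rfl ?_)
      rw [map_mul]
      exact (mul_le_of_le_one_left' he.1).trans h.le
    calc Valued.v y * Valued.v (x + e * y) ≤ Valued.v y * Valued.v x := by gcongr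
      _ < Valued.v x * Valued.v x := mul_lt_mul_of_pos_right h hx

theorem ResidueIrreducible.exists_norm_eq (h2 : (2 : k) ≠ 0)
    (hc : IsCompact {x : k | Valued.v x ≤ 1})
    (hres : Finite (Valued.ResidueField k)) {e : k} (he : ResidueIrreducible e) {u : k}
    (hu : Valued.v u = 1) : ∃ s t : k, s ^ 2 - (1 - 4 * e) * t ^ 2 = u := by
  obtain ⟨x, y, h⟩ := he.isUnramifiedForm.exists_eq hc hres (by simp) hu
  refine ⟨x + y / 2, y / 2, ?_⟩
  rw [← h]
  field_simp
  ring

end NormForm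

namespace QuadraticSpace

open QuadraticMap

section Splitting

variable {V : Type} [AddCommGroup V] [Module k V]

variable [Valued k (WithZero (Multiplicative ℤ))]

/-- Splitting off a scaled unramified plane. -/
theorem exists_split_of_isUnramifiedForm [FiniteDimensional k V] (h2 : (2 : k) ≠ 0)
    (hc : IsCompact {x : k | Valued.v x ≤ 1}) (hres : Finite (Valued.ResidueField k)) {e : k}
    (he : ResidueIrreducible e) {Q : QuadraticForm k V} {δ : k} (hδ : δ ≠ 0) {x y : V}
    (h : IsUnramifiedForm (Q x / δ) (polar Q x y / δ) (Q y / δ)) :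
    ∃ (W : Type) (_ : AddCommGroup W) (_ : Module k W) (_ : FiniteDimensional k W)
      (Q' : QuadraticForm k W), Module.finrank k W + 2 = Module.finrank k V ∧
      ((oneDim δ).prod ((oneDim (-(δ * (1 - 4 * e)))).prod Q')).Equivalent Q := by
  wlog hb : Valued.v (polar Q x y / δ) = 1 generalizing y
  · refine this (y := x + y) ?_ ?_
    · convert h.shear using 1
      · rw [polar_add_right, polar_self']
        field_simp
        ring
      · rw [map_add_eq]
        field_simp
        ring
    · have := (h.valuation_mid_or hres).resolve_left hb
      rw [polar_add_right, polar_self']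
      convert this using 2
      field_simp
      ring
  obtain ⟨c, hc0, hd⟩ := h.sqEq_disc hc hres hb he
  have he0 : 1 - 4 * e ≠ 0 :=
    (Valuation.ne_zero_iff Valued.v).1 (by simp [he.valuation_disc])
  obtain ⟨s, t, hst⟩ := h.exists_eq hc hres hb (u := 1) (by simp)
  set b := polar Q x y
  have hp : Q (s • x + t • y) = δ := by
    rw [map_lin_comb]
    field_simp at hst
    linear_combination hst
  set p := s • x + t • y with hpdef
  have hpx : polar Q p x = 2 * s * Q x + t * b := by
    rw [hpdef, polar_add_left, polar_smul_left, polar_smul_left, polar_self', polar_comm Q y x]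
    simp only [smul_eq_mul]
    ring
  have hpy : polar Q p y = s * b + 2 * t * Q y := by
    rw [hpdef, polar_add_left, polar_smul_left, polar_smul_left, polar_self']
    simp only [smul_eq_mul]
    ring
  let u : V := (polar Q p y / (c * δ)) • x + (-polar Q p x / (c * δ)) • y
  have hu : polar Q p u = 0 := by
    simp only [u, polar_add_right, polar_smul_right, smul_eq_mul]
    ring
  have hp' := hp
  rw [hpdef, map_lin_comb] at hp'
  have hQu : Q u = -(δ * (1 - 4 * e)) := by
    simp only [u]
    rw [map_lin_comb, hpx, hpy]
    have hd' : b ^ 2 - 4 * Q x * Q y = c ^ 2 * δ ^ 2 * (1 - 4 * e) := by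
      field_simp at hd
      linear_combination hd
    field_simp
    linear_combination (-δ) * hd' + (4 * Q x * Q y - b ^ 2) * hp'
  have hu' : perp Q p ⟨u, by simpa using hu⟩ = -(δ * (1 - 4 * e)) := hQu
  have hδe : -(δ * (1 - 4 * e)) ≠ 0 := neg_ne_zero.2 (mul_ne_zero hδ he0)
  refine ⟨_, inferInstance, inferInstance, inferInstance, perp (perp Q p) ⟨u, by simpa using hu⟩,
    ?_, ?_⟩
  · have h1 := finrank_perp h2 Q (u := p) (by rwa [hp])
    have h3 := finrank_perp h2 (perp Q p) (by rwa [hu'])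
    omega
  · exact ((Equivalent.refl _).prod (split h2 _ hu' hδe)).trans (split h2 Q hp hδ)

/-- The parity of the valuation on the complement of a scaled unramified plane. -/
theorem eq_zero_of_anisotropic_prod (h2 : (2 : k) ≠ 0)
    (hc : IsCompact {x : k | Valued.v x ≤ 1}) (hres : Finite (Valued.ResidueField k)) {e : k}
    (he : ResidueIrreducible e) {Q : QuadraticForm k V} {δ : k} (hδ : δ ≠ 0)
    (hQ : ((oneDim δ).prod ((oneDim (-(δ * (1 - 4 * e)))).prod Q)).Anisotropic) {w : V} {s : k}
    (hs : s ≠ 0) (hw : Valued.v (Q w) = Valued.v δ * Valued.v s ^ 2) : False := by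
  obtain ⟨x, y, hxy⟩ := he.exists_norm_eq h2 hc hres (u := -Q w / (δ * s ^ 2)) (by
    rw [map_div₀, Valuation.map_neg, hw, map_mul, map_pow]
    exact div_self (mul_ne_zero ((Valuation.ne_zero_iff _).2 hδ)
      (pow_ne_zero _ ((Valuation.ne_zero_iff _).2 hs))))
  have h0 := hQ (s * x, s * y, w) (by
    simp only [QuadraticMap.prod_apply, oneDim_apply]
    field_simp at hxy
    linear_combination hxy)
  have hw0 : w = 0 := by simpa using congrArg (fun z => z.2.2) h0
  rw [hw0, QuadraticMap.map_zero, map_zero] at hw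
  exact (mul_ne_zero ((Valuation.ne_zero_iff _).2 hδ)
      (pow_ne_zero _ ((Valuation.ne_zero_iff _).2 hs))) hw.symm

/-- The valuations of `1` and `π` represent the classes modulo squares. -/
theorem exists_parity (hdisc : Function.Surjective (Valued.v : Valuation k _)) {π : k}
    (hπ : Valued.v π = WithZero.exp (-1 : ℤ)) {a : k} (ha : a ≠ 0) :
    ∃ s : k, s ≠ 0 ∧ (Valued.v a = Valued.v s ^ 2 ∨ Valued.v a = Valued.v π * Valued.v s ^ 2) := by
  have hva : Valued.v a ≠ 0 := (Valuation.ne_zero_iff _).2 ha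
  have ne : ∀ {s : k} {n : ℤ}, Valued.v s = WithZero.exp n → s ≠ 0 := fun h =>
    (Valuation.ne_zero_iff Valued.v).1 (by simp [h])
  have hlog := WithZero.exp_log hva
  obtain ⟨n, hn | hn⟩ := Int.even_or_odd' (WithZero.log (Valued.v a))
  · obtain ⟨s, hs⟩ := hdisc (WithZero.exp n)
    refine ⟨s, ne hs, Or.inl ?_⟩
    rw [← hlog, hn, hs, two_mul, WithZero.exp_add, pow_two]
  · obtain ⟨s, hs⟩ := hdisc (WithZero.exp (n + 1))
    refine ⟨s, ne hs, Or.inr ?_⟩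
    rw [← hlog, hn, hs, hπ, pow_two, ← WithZero.exp_add, ← WithZero.exp_add]
    congr 1
    ring

theorem NormIndep.exists_split [FiniteDimensional k V] (h2 : (2 : k) ≠ 0)
    (hc : IsCompact {x : k | Valued.v x ≤ 1}) (hres : Finite (Valued.ResidueField k)) {e : k}
    (he : ResidueIrreducible e) {Q : QuadraticForm k V} {δ : k} (hδ : δ ≠ 0) {x y : V}
    (h : NormIndep Q x y) {s t : k} (hs : s ≠ 0) (ht : t ≠ 0)
    (hx : Valued.v (Q x) = Valued.v δ * Valued.v s ^ 2)
    (hy : Valued.v (Q y) = Valued.v δ * Valued.v t ^ 2) :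
    ∃ (W : Type) (_ : AddCommGroup W) (_ : Module k W) (_ : FiniteDimensional k W)
      (Q' : QuadraticForm k W), Module.finrank k W + 2 = Module.finrank k V ∧
      ((oneDim δ).prod ((oneDim (-(δ * (1 - 4 * e)))).prod Q')).Equivalent Q := by
  refine exists_split_of_isUnramifiedForm h2 hc hres he hδ (x := s⁻¹ • x) (y := t⁻¹ • y) ?_
  intro a b
  have e1 : Q (s⁻¹ • x) / δ * a ^ 2 + polar Q (s⁻¹ • x) (t⁻¹ • y) / δ * a * b +
      Q (t⁻¹ • y) / δ * b ^ 2 = Q ((a * s⁻¹) • x + (b * t⁻¹) • y) / δ := by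
    rw [mul_smul, mul_smul, map_lin_comb]
    ring
  have hδ' : Valued.v δ ≠ 0 := (Valuation.ne_zero_iff _).2 hδ
  have hs' : Valued.v s ≠ 0 := (Valuation.ne_zero_iff _).2 hs
  have ht' : Valued.v t ≠ 0 := (Valuation.ne_zero_iff _).2 ht
  have e2 : Valued.v (a * s⁻¹) ^ 2 * Valued.v (Q x) = Valued.v δ * Valued.v a ^ 2 := by
    rw [hx, map_mul, map_inv₀]
    field_simp
  have e3 : Valued.v (b * t⁻¹) ^ 2 * Valued.v (Q y) = Valued.v δ * Valued.v b ^ 2 := by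
    rw [hy, map_mul, map_inv₀]
    field_simp
  rw [e1, map_div₀, h, e2, e3]
  rcases le_total (Valued.v a) (Valued.v b) with hab | hab
  · rw [max_eq_right hab, max_eq_right (by gcongr), mul_div_cancel_left₀ _ hδ']
  · rw [max_eq_left hab, max_eq_left (by gcongr), mul_div_cancel_left₀ _ hδ']

/-- Normal form of anisotropic forms of large dimension. -/
theorem exists_split_two [FiniteDimensional k V] (h2 : (2 : k) ≠ 0)
    (hc : IsCompact {x : k | Valued.v x ≤ 1}) (hres : Finite (Valued.ResidueField k))
    (hdisc : Function.Surjective (Valued.v : Valuation k _)) {e : k}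
    (he : ResidueIrreducible e) {π : k} (hπ : Valued.v π = WithZero.exp (-1 : ℤ))
    {Q : QuadraticForm k V} (hQ : Q.Anisotropic) (hV : 4 ≤ Module.finrank k V) :
    Module.finrank k V = 4 ∧ ∃ (W : Type) (_ : AddCommGroup W) (_ : Module k W)
      (_ : FiniteDimensional k W) (Q' : QuadraticForm k W), Module.finrank k W = 0 ∧
      ((oneDim 1).prod ((oneDim (-(1 * (1 - 4 * e)))).prod ((oneDim π).prod
        ((oneDim (-(π * (1 - 4 * e)))).prod Q')))).Equivalent Q := by
  have hπ0 : π ≠ 0 := (Valuation.ne_zero_iff Valued.v).1 (by simp [hπ])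
  have par : ∀ a : k, a ≠ 0 → ∃ s : k, s ≠ 0 ∧ (Valued.v a = Valued.v (1 : k) * Valued.v s ^ 2 ∨
      Valued.v a = Valued.v π * Valued.v s ^ 2) := by
    simpa using fun a ha => exists_parity hdisc hπ (a := a) ha
  have hQ0 : ∀ {x}, x ≠ 0 → Q x ≠ 0 := fun hx h => hx (hQ _ h)
  -- the second plane, given the first one
  have second : ∀ {δ δ' : k}, δ ≠ 0 → δ' ≠ 0 → (∀ a : k, a ≠ 0 → ∃ s : k, s ≠ 0 ∧
      (Valued.v a = Valued.v δ * Valued.v s ^ 2 ∨ Valued.v a = Valued.v δ' * Valued.v s ^ 2)) →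
      (∃ (W : Type) (_ : AddCommGroup W) (_ : Module k W) (_ : FiniteDimensional k W)
        (Q' : QuadraticForm k W), Module.finrank k W + 2 = Module.finrank k V ∧
        ((oneDim δ).prod ((oneDim (-(δ * (1 - 4 * e)))).prod Q')).Equivalent Q) →
      Module.finrank k V = 4 ∧ ∃ (W : Type) (_ : AddCommGroup W) (_ : Module k W)
        (_ : FiniteDimensional k W) (Q' : QuadraticForm k W), Module.finrank k W = 0 ∧
        ((oneDim δ).prod ((oneDim (-(δ * (1 - 4 * e)))).prod ((oneDim δ').prod
          ((oneDim (-(δ' * (1 - 4 * e)))).prod Q')))).Equivalent Q := by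
    rintro δ δ' hδ hδ' hpar ⟨W, _, _, _, Q', hW, heq⟩
    have hA := anisotropic_of_equivalent heq.symm hQ
    have hA' : Q'.Anisotropic := (anisotropic_of_prod (anisotropic_of_prod hA).2).2
    have hex : ∀ w ≠ 0, ∃ s : k, s ≠ 0 ∧ Valued.v (Q' w) = Valued.v δ' * Valued.v s ^ 2 := by
      intro w hw
      obtain ⟨s, hs, h | h⟩ := hpar (Q' w) fun h => hw (hA' _ h)
      · exact (eq_zero_of_anisotropic_prod h2 hc hres he hδ hA hs h).elim
      · exact ⟨s, hs, h⟩
    obtain ⟨x, y, hx, hy, hxy⟩ := exists_normIndep_two h2 hc hA' (by omega)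
    obtain ⟨s, hs, hxs⟩ := hex x hx
    obtain ⟨t, ht, hyt⟩ := hex y hy
    obtain ⟨Z, _, _, _, Q'', hZ, heq'⟩ := hxy.exists_split h2 hc hres he hδ' hs ht hxs hyt
    have hZ0 : Module.finrank k Z = 0 := by
      by_contra hZ0
      have := Module.finrank_pos_iff.1 (Nat.pos_of_ne_zero hZ0)
      obtain ⟨z, hz⟩ := exists_ne (0 : Z)
      obtain ⟨g⟩ := id heq'
      have hgz : g (0, 0, z) ≠ 0 := fun h => hz (by
        have := g.toLinearEquiv.injective (h.trans (map_zero g.toLinearEquiv).symm)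
        exact congrArg (fun z => z.2.2) this)
      obtain ⟨s, hs, hgs⟩ := hex _ hgz
      rw [g.map_app] at hgs
      refine eq_zero_of_anisotropic_prod h2 hc hres he hδ'
        (anisotropic_of_equivalent heq'.symm hA') hs (w := z) ?_
      simpa using hgs
    refine ⟨by omega, Z, _, _, inferInstance, Q'', hZ0, ?_⟩
    exact ((Equivalent.refl _).prod ((Equivalent.refl _).prod heq')).trans heq
  have first : ∀ {x y : V} {δ s t : k}, δ ≠ 0 → NormIndep Q x y → s ≠ 0 → t ≠ 0 →
      Valued.v (Q x) = Valued.v δ * Valued.v s ^ 2 →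
      Valued.v (Q y) = Valued.v δ * Valued.v t ^ 2 → _ := fun hδ hxy hs ht hx hy =>
    hxy.exists_split h2 hc hres he hδ hs ht hx hy
  obtain ⟨x, y, z, hx, hy, hz, hxy, hxz, hyz⟩ := exists_normIndep_three h2 hc hQ (by omega)
  have hsplit : (∃ (W : Type) (_ : AddCommGroup W) (_ : Module k W) (_ : FiniteDimensional k W)
        (Q' : QuadraticForm k W), Module.finrank k W + 2 = Module.finrank k V ∧
        ((oneDim 1).prod ((oneDim (-(1 * (1 - 4 * e)))).prod Q')).Equivalent Q) ∨
      (∃ (W : Type) (_ : AddCommGroup W) (_ : Module k W) (_ : FiniteDimensional k W)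
        (Q' : QuadraticForm k W), Module.finrank k W + 2 = Module.finrank k V ∧
        ((oneDim π).prod ((oneDim (-(π * (1 - 4 * e)))).prod Q')).Equivalent Q) := by
    obtain ⟨r, hr, hxr⟩ := par _ (hQ0 hx)
    obtain ⟨s, hs, hys⟩ := par _ (hQ0 hy)
    obtain ⟨t, ht, hzt⟩ := par _ (hQ0 hz)
    rcases hxr with hxr | hxr <;> rcases hys with hys | hys <;> rcases hzt with hzt | hzt
    · exact Or.inl (first one_ne_zero hxy hr hs hxr hys)
    · exact Or.inl (first one_ne_zero hxy hr hs hxr hys)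
    · exact Or.inl (first one_ne_zero hxz hr ht hxr hzt)
    · exact Or.inr (first hπ0 hyz hs ht hys hzt)
    · exact Or.inl (first one_ne_zero hyz hs ht hys hzt)
    · exact Or.inr (first hπ0 hxz hr ht hxr hzt)
    · exact Or.inr (first hπ0 hxy hr hs hxr hys)
    · exact Or.inr (first hπ0 hxy hr hs hxr hys)
  rcases hsplit with h | h
  · exact second one_ne_zero hπ0 par h
  · obtain ⟨h4, W, _, _, _, Q', hW, heq⟩ := second hπ0 one_ne_zero
      (fun a ha => (par a ha).imp fun s hs => ⟨hs.1, hs.2.symm⟩) h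
    refine ⟨h4, W, _, _, inferInstance, Q', hW, ?_⟩
    refine Equivalent.trans ⟨?_⟩ heq
    exact
      { toFun := fun z => (z.2.2.1, z.2.2.2.1, z.1, z.2.1, z.2.2.2.2)
        invFun := fun z => (z.2.2.1, z.2.2.2.1, z.1, z.2.1, z.2.2.2.2)
        left_inv := fun _ => rfl
        right_inv := fun _ => rfl
        map_add' := fun _ _ => rfl
        map_smul' := fun _ _ => rfl
        map_app' := fun z => by
          simp only [QuadraticMap.prod_apply]
          ring }

/-- Nonarchimedean local fields satisfy `LocalAnisotropy`. -/
theorem localAnisotropy (h2 : (2 : k) ≠ 0)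
    (hc : IsCompact {x : k | Valued.v x ≤ 1}) (hres : Finite (Valued.ResidueField k))
    (hdisc : Function.Surjective (Valued.v : Valuation k _)) : LocalAnisotropy k := by
  obtain ⟨e, he⟩ := exists_residueIrreducible hres
  obtain ⟨π, hπ⟩ := hdisc (WithZero.exp (-1 : ℤ))
  refine ⟨fun Q hV hQ => ?_, fun Q₁ Q₂ hV hW hQ₁ hQ₂ => ?_⟩
  · have := (exists_split_two h2 hc hres hdisc he hπ hQ (by omega)).1
    omega
  · obtain ⟨-, Z₁, _, _, _, R₁, hZ₁, h₁⟩ :=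
      exists_split_two h2 hc hres hdisc he hπ hQ₁ (by omega)
    obtain ⟨-, Z₂, _, _, _, R₂, hZ₂, h₂⟩ :=
      exists_split_two h2 hc hres hdisc he hπ hQ₂ (by omega)
    exact (h₁.symm.trans ((Equivalent.refl _).prod ((Equivalent.refl _).prod
      ((Equivalent.refl _).prod ((Equivalent.refl _).prod
        (equivalent_of_finrank_zero R₁ R₂ hZ₁ hZ₂)))))).trans h₂

end Splitting

end QuadraticSpace

section GaussSum

open Matrix

theorem sum_comp_eq_card_ker_mul_sum {X Y : Type} [AddCommGroup X] [AddCommGroup Y] [Fintype X]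
    [Fintype Y] [DecidableEq Y] (φ : X →+ Y) (F : Y → ℂ) :
    ∑ x, F (φ x) = Nat.card φ.ker * ∑ y with y ∈ φ.range, F y := by
  classical
  rw [← Finset.sum_fiberwise_of_maps_to (s := Finset.univ) (t := {y | y ∈ φ.range}) (g := φ)
    (by simp), Finset.mul_sum]
  refine Finset.sum_congr rfl fun y hy => ?_
  obtain ⟨x₀, rfl⟩ := (Finset.mem_filter.1 hy).2
  rw [Finset.sum_congr rfl (g := fun _ => F (φ x₀)) (by simp +contextual), Finset.sum_const,
    nsmul_eq_mul]
  congr 2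
  rw [← Fintype.card_subtype, ← Nat.card_eq_fintype_card]
  refine Nat.card_congr ((Equiv.subRight x₀).subtypeEquiv fun x => ?_)
  simp [AddMonoidHom.mem_ker, sub_eq_zero]

variable {A : Type} [CommRing A] {ψ : AddChar A ℂ}

theorem sum_addChar_linear_eq_zero (hψ : ∀ a ≠ 0, ∃ b, ψ (a * b) ≠ 1) {X : Type} [AddCommGroup X]
    [Module A X] [Fintype X] {f : X →ₗ[A] A} (hf : f ≠ 0) : ∑ x, ψ (f x) = 0 := by
  classical
  obtain ⟨x, hx⟩ : ∃ x, f x ≠ 0 := by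
    by_contra! h
    exact hf (LinearMap.ext h)
  obtain ⟨b, hb⟩ := hψ _ hx
  refine (AddChar.sum_eq_zero_iff_ne_zero (ψ := ψ.compAddMonoidHom f.toAddMonoidHom)).2 ?_
  intro h
  have := DFunLike.congr_fun h (b • x)
  simp [mul_comm b] at this
  exact hb this

theorem card_ker_smul {κ : Type} [Fintype κ] (p : A) :
    Nat.card (DistribSMul.toAddMonoidHom (κ → A) p).ker =
      Nat.card {a : A // p * a = 0} ^ Fintype.card κ := by
  rw [← Nat.card_eq_fintype_card (α := κ), ← Nat.card_fun]
  refine Nat.card_congr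
    { toFun := fun x i => ⟨x.1 i, congrFun x.2 i⟩
      invFun := fun x => ⟨fun i => x i, funext fun i => (x i).2⟩
      left_inv := fun _ => rfl
      right_inv := fun _ => rfl }

/-- A Gauss sum with a totally isotropic subgroup that is its own orthogonal modulo isotropic
vectors. -/
theorem gaussSum_eq_card (hψ : ∀ a ≠ 0, ∃ b, ψ (a * b) ≠ 1) {X : Type} [AddCommGroup X]
    [Module A X] [Fintype X] (B : X →ₗ[A] X →ₗ[A] A) (H : Submodule A X)
    (hH : ∀ h ∈ H, B h h = 0)
    (hz : ∀ z, (∀ h ∈ H, B z h + B h z = 0) → B z z = 0) :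
    ∃ n : ℕ, 0 < n ∧ ∑ z, ψ (B z z) = n := by
  classical
  let f : X → H →ₗ[A] A := fun z => (B z + B.flip z) ∘ₗ H.subtype
  refine ⟨Finset.card {z | f z = 0}, Finset.card_pos.2 ⟨0, by simp [f]⟩, ?_⟩
  have h0 : (Nat.card H : ℂ) ≠ 0 := Nat.cast_ne_zero.2 Nat.card_pos.ne'
  refine mul_left_cancel₀ h0 ?_
  have hshift : ∀ h : H, ∑ z, ψ (B z z) = ∑ z, ψ (B z z) * ψ (f z h) := by
    intro h
    rw [← Equiv.sum_comp (Equiv.addRight (h : X))]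
    refine Finset.sum_congr rfl fun z _ => ?_
    rw [← AddChar.map_add_eq_mul]
    congr 1
    simp [f, hH h h.2]
    ring
  calc (Nat.card H : ℂ) * ∑ z, ψ (B z z) = ∑ _h : H, ∑ z, ψ (B z z) := by
        rw [Finset.sum_const, Finset.card_univ, nsmul_eq_mul, Nat.card_eq_fintype_card]
    _ = ∑ h : H, ∑ z, ψ (B z z) * ψ (f z h) := Finset.sum_congr rfl fun h _ => hshift h
    _ = ∑ z, ψ (B z z) * ∑ h : H, ψ (f z h) := by
        rw [Finset.sum_comm]
        simp only [Finset.mul_sum]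
    _ = ∑ z, if f z = 0 then (Nat.card H : ℂ) else 0 := by
        refine Finset.sum_congr rfl fun z _ => ?_
        split_ifs with h
        · have : B z z = 0 := hz z fun w hw => by
            simpa [f] using LinearMap.congr_fun h ⟨w, hw⟩
          simp [h, this]
        · rw [sum_addChar_linear_eq_zero hψ h, mul_zero]
    _ = _ := by
        rw [← Finset.sum_filter, Finset.sum_const, nsmul_eq_mul, mul_comm]

/-- The bilinear form attached to a linear combination of matrices. -/
def combForm {ι κ R : Type} [Fintype ι] [CommRing R] (C : ι → Matrix κ κ R) (ℓ : ι → R) :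
    Matrix κ κ R :=
  ∑ i, ℓ i • C i

theorem dotProduct_combForm_mulVec {ι κ R : Type} [Fintype ι] [Fintype κ] [CommRing R]
    (C : ι → Matrix κ κ R) (ℓ : ι → R) (x y : κ → R) :
    x ⬝ᵥ combForm C ℓ *ᵥ y = ∑ i, ℓ i * (x ⬝ᵥ C i *ᵥ y) := by
  simp [combForm, Matrix.sum_mulVec, Matrix.smul_mulVec, dotProduct_sum]

theorem combForm_map {ι κ R S : Type} [Fintype ι] [CommRing R] [CommRing S] (f : R →+* S)
    (C : ι → Matrix κ κ R) (ℓ : ι → R) :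
    (combForm C ℓ).map f = combForm (fun i => (C i).map f) (f ∘ ℓ) := by
  ext
  simp [combForm, Matrix.sum_apply]

variable [Fintype A] [DecidableEq A] {ι κ : Type} [Fintype ι] [Fintype κ] [DecidableEq ι]
  [DecidableEq κ]

theorem sum_gaussSum_eq_zero (hψ : ∀ a ≠ 0, ∃ b, ψ (a * b) ≠ 1) {p : A}
    (hp : Nat.card {a : A // p ^ 2 * a = 0} = Nat.card {a : A // p * a = 0} ^ 2)
    (C : ι → Matrix κ κ A) (hcard : Fintype.card κ = 2 * Fintype.card ι)
    (hC : ∀ x : κ → A, (∀ i, x ⬝ᵥ C i *ᵥ x = 0) → ∃ y, x = p • y) :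
    ∑ ℓ : ι → A with ¬∃ ℓ', ℓ = p ^ 2 • ℓ', ∑ x, ψ (x ⬝ᵥ combForm C ℓ *ᵥ x) = 0 := by
  set G : (ι → A) → ℂ := fun ℓ => ∑ x, ψ (x ⬝ᵥ combForm C ℓ *ᵥ x) with hG
  set S : (κ → A) → ℂ := fun x => ∑ ℓ, ψ (x ⬝ᵥ combForm C ℓ *ᵥ x) with hS
  have hform := fun x ℓ => dotProduct_combForm_mulVec C ℓ x x
  have hq : (Nat.card {a : A // p * a = 0} : ℂ) ≠ 0 := by
    have : Nonempty {a : A // p * a = 0} := ⟨⟨0, mul_zero p⟩⟩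
    exact Nat.cast_ne_zero.2 Nat.card_pos.ne'
  have h1 := sum_comp_eq_card_ker_mul_sum (DistribSMul.toAddMonoidHom (ι → A) (p ^ 2)) G
  have h2 := sum_comp_eq_card_ker_mul_sum (DistribSMul.toAddMonoidHom (κ → A) p) S
  have h3 : ∑ ℓ, G (p ^ 2 • ℓ) = ∑ x, S (p • x) := by
    simp only [hG, hS]
    rw [Finset.sum_comm]
    refine Finset.sum_congr rfl fun x _ => Finset.sum_congr rfl fun ℓ _ => ?_
    congr 1
    rw [hform, hform]
    refine Finset.sum_congr rfl fun i _ => ?_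
    rw [mulVec_smul, smul_dotProduct, dotProduct_smul, Pi.smul_apply, smul_eq_mul, smul_eq_mul,
      smul_eq_mul]
    ring
  have h4 : ∑ x with x ∈ (DistribSMul.toAddMonoidHom (κ → A) p).range, S x = ∑ ℓ, G ℓ := by
    have hcomm : ∑ ℓ, G ℓ = ∑ x, S x := Finset.sum_comm
    rw [hcomm, Finset.sum_filter]
    refine Finset.sum_congr rfl fun x _ => ?_
    split_ifs with hx
    · rfl
    · have : ∃ i, x ⬝ᵥ C i *ᵥ x ≠ 0 := by
        by_contra! h
        obtain ⟨y, hy⟩ := hC x h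
        exact hx ⟨y, hy.symm⟩
      obtain ⟨i, hi⟩ := this
      let f : (ι → A) →ₗ[A] A := Fintype.linearCombination A fun i => x ⬝ᵥ C i *ᵥ x
      have hf : f ≠ 0 := fun h => hi (by simpa [f] using LinearMap.congr_fun h (Pi.single i 1))
      rw [← sum_addChar_linear_eq_zero hψ hf]
      refine Finset.sum_congr rfl fun ℓ _ => ?_
      rw [hform]
      simp [f, Fintype.linearCombination_apply]
  simp only [DistribSMul.toAddMonoidHom_apply] at h1 h2
  rw [card_ker_smul, hp] at h1
  rw [card_ker_smul, hcard, pow_mul, h4] at h2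
  rw [h1, h2] at h3
  have h5 := mul_left_cancel₀ (by push_cast; exact pow_ne_zero _ (pow_ne_zero _ hq)) h3
  have h6 := Finset.sum_filter_add_sum_filter_not Finset.univ
    (fun ℓ => ℓ ∈ (DistribSMul.toAddMonoidHom (ι → A) (p ^ 2)).range) G
  rw [h5, add_eq_left] at h6
  rw [← h6]
  refine Finset.sum_congr (Finset.filter_congr fun ℓ _ => ?_) fun _ _ => rfl
  simp [eq_comm]

end GaussSum

section LocalGaussSum

open scoped Valued
open Matrix

variable [Valued k (WithZero (Multiplicative ℤ))]

theorem integer_dvd_iff {a b : 𝒪[k]} : a ∣ b ↔ Valued.v (b : k) ≤ Valued.v (a : k) :=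
  (Valuation.integer.integers (Valued.v (R := k))).dvd_iff_le

theorem map_dotProduct_mulVec {ν R S : Type} [Fintype ν] [CommRing R] [CommRing S] (f : R →+* S)
    (D : Matrix ν ν R) (x y : ν → R) : (f ∘ x) ⬝ᵥ D.map f *ᵥ (f ∘ y) = f (x ⬝ᵥ D *ᵥ y) := by
  rw [RingHom.map_dotProduct]
  congr 1
  exact funext fun i => (RingHom.map_mulVec f D y i).symm

theorem exists_smul_integer {ν : Type} [Finite ν] (w : ν → k) :
    ∃ a : k, a ≠ 0 ∧ ∀ i, Valued.v (a * w i) ≤ 1 := by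
  by_cases hw : w = 0
  · exact ⟨1, one_ne_zero, fun i => by simp [hw]⟩
  obtain ⟨j, hj⟩ := Function.ne_iff.1 hw
  have : Nonempty ν := ⟨j⟩
  obtain ⟨i, hi⟩ := Finite.exists_max fun i => Valued.v (w i)
  have hi0 : w i ≠ 0 := fun h => hj (by simpa [h] using hi j)
  refine ⟨(w i)⁻¹, inv_ne_zero hi0, fun j => ?_⟩
  rw [map_mul, map_inv₀]
  exact inv_mul_le_one_of_le₀ (hi j) zero_le

/-- The intersection of a subspace with the standard lattice is a direct summand. -/
theorem exists_integer_projection [IsPrincipalIdealRing 𝒪[k]] {ν : Type} [Fintype ν]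
    (W : Submodule k (ν → k)) :
    ∃ P : (ν → 𝒪[k]) →ₗ[𝒪[k]] (ν → 𝒪[k]), (∀ x, (fun i => (P x i : k)) ∈ W) ∧
      ∀ x : ν → 𝒪[k], (fun i => (x i : k)) ∈ W → P x = x := by
  let H : Submodule 𝒪[k] (ν → 𝒪[k]) :=
    { carrier := {x | (fun i => (x i : k)) ∈ W}
      add_mem' := fun hx hy => W.add_mem hx hy
      zero_mem' := W.zero_mem
      smul_mem' := fun c _ hx => W.smul_mem (c : k) hx }
  have : Module.IsTorsionFree 𝒪[k] ((ν → 𝒪[k]) ⧸ H) := by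
    rw [Module.isTorsionFree_iff_smul_eq_zero]
    intro c m hm
    obtain ⟨x, rfl⟩ := H.mkQ_surjective m
    rw [or_iff_not_imp_left]
    intro hc
    rw [← map_smul, Submodule.mkQ_apply, Submodule.Quotient.mk_eq_zero] at hm
    rw [Submodule.mkQ_apply, Submodule.Quotient.mk_eq_zero]
    have hc' : (c : k) ≠ 0 := by simpa using hc
    exact (W.smul_mem_iff hc').1 hm
  have : Module.Free 𝒪[k] ((ν → 𝒪[k]) ⧸ H) := Module.free_of_finite_type_torsion_free'
  obtain ⟨s, hs⟩ := Module.projective_lifting_property H.mkQ LinearMap.id H.mkQ_surjective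
  have hP : ∀ x, (LinearMap.id - s ∘ₗ H.mkQ : (ν → 𝒪[k]) →ₗ[𝒪[k]] _) x ∈ H := fun x => by
    change x - s (H.mkQ x) ∈ H
    rw [← Submodule.Quotient.mk_eq_zero, ← Submodule.mkQ_apply, map_sub, sub_eq_zero]
    exact (LinearMap.congr_fun hs (H.mkQ x)).symm
  refine ⟨LinearMap.id - s ∘ₗ H.mkQ, fun x => hP x, fun x hx => ?_⟩
  have : H.mkQ x = 0 := (Submodule.Quotient.mk_eq_zero H).2 hx
  simp [this]

theorem valuation_dotProduct_mulVec_le {ν : Type} [Fintype ν] (D : Matrix ν ν 𝒪[k]) {x y : ν → k}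
    {α β : WithZero (Multiplicative ℤ)} (hx : ∀ i, Valued.v (x i) ≤ α)
    (hy : ∀ i, Valued.v (y i) ≤ β) :
    Valued.v (x ⬝ᵥ (D.map 𝒪[k].subtype) *ᵥ y) ≤ α * β := by
  refine Valuation.map_sum_le _ fun i _ => ?_
  rw [map_mul]
  refine mul_le_mul' (hx i) (Valuation.map_sum_le _ fun j _ => ?_)
  rw [map_mul]
  exact mul_le_of_le_one_of_le (D i j).2 (hy j)

/-- Positivity of the Gauss sum of a form with a Lagrangian. -/
theorem gaussSum_eq_card_of_lagrangian [IsPrincipalIdealRing 𝒪[k]] {ν : Type} [Fintype ν]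
    [DecidableEq ν]
    {p : 𝒪[k]} (hp1 : Valued.v (p : k) < 1) {r : ℕ} (hr : r ≠ 0)
    [Fintype (𝒪[k] ⧸ Ideal.span {p ^ (2 * r)})] {ψ : AddChar (𝒪[k] ⧸ Ideal.span {p ^ (2 * r)}) ℂ}
    (hψ : ∀ a ≠ 0, ∃ b, ψ (a * b) ≠ 1) (D : Matrix ν ν 𝒪[k]) (B : (ν → k) →ₗ[k] (ν → k) →ₗ[k] k)
    (hB : ∀ x y, B x y = x ⬝ᵥ D.map 𝒪[k].subtype *ᵥ y) (W : Submodule k (ν → k))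
    (hW : ∀ w ∈ W, B w w = 0) (hW' : ∀ y, (∀ w ∈ W, B y w + B w y = 0) → y ∈ W)
    (hb : ∀ z, (∀ j, Valued.v (B z (Pi.single j 1) + B (Pi.single j 1) z) ≤
      Valued.v (p : k) ^ (2 * r)) → ∀ i, Valued.v (z i) ≤ Valued.v (p : k) ^ r) :
    ∃ n : ℕ, 0 < n ∧
      ∑ z, ψ (z ⬝ᵥ D.map (Ideal.Quotient.mk (Ideal.span {p ^ (2 * r)})) *ᵥ z) = n := by
  classical
  set π := Ideal.Quotient.mk (Ideal.span {p ^ (2 * r)}) with hπ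
  let c : (ν → 𝒪[k]) → ν → k := fun x i => x i
  have hc : ∀ x y : ν → 𝒪[k], B (c x) (c y) = ((x ⬝ᵥ D *ᵥ y : 𝒪[k]) : k) := fun x y => by
    rw [hB]
    exact map_dotProduct_mulVec 𝒪[k].subtype D x y
  have hlift : ∀ z : ν → 𝒪[k] ⧸ Ideal.span {p ^ (2 * r)}, ∃ x : ν → 𝒪[k], z = π ∘ x := fun z => by
    choose x hx using fun i => Ideal.Quotient.mk_surjective (z i)
    exact ⟨x, funext fun i => (hx i).symm⟩
  have hmem : ∀ x : 𝒪[k], π x = 0 ↔ Valued.v (x : k) ≤ Valued.v (p : k) ^ (2 * r) := fun x => by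
    rw [hπ, Ideal.Quotient.eq_zero_iff_dvd, integer_dvd_iff]
    simp
  let H : Submodule (𝒪[k] ⧸ Ideal.span {p ^ (2 * r)}) (ν → 𝒪[k] ⧸ Ideal.span {p ^ (2 * r)}) :=
    { carrier := {x | ∃ h, c h ∈ W ∧ x = π ∘ h}
      add_mem' := by
        rintro _ _ ⟨x, hx, rfl⟩ ⟨y, hy, rfl⟩
        exact ⟨x + y, W.add_mem hx hy, funext fun i => (map_add π _ _).symm⟩
      zero_mem' := ⟨0, W.zero_mem, funext fun i => (map_zero π).symm⟩
      smul_mem' := by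
        rintro a _ ⟨x, hx, rfl⟩
        obtain ⟨a, rfl⟩ := Ideal.Quotient.mk_surjective a
        exact ⟨a • x, W.smul_mem (a : k) hx, funext fun i => (map_mul π _ _).symm⟩ }
  let T : (ν → k) →ₗ[k] ν → k := LinearMap.pi fun j => B.flip (Pi.single j 1) + B (Pi.single j 1)
  have hT : ∀ z y, B z y + B y z = y ⬝ᵥ T z := fun z y => by
    have h : B.flip z + B z = Fintype.linearCombination k (T z) := by
      refine LinearMap.pi_ext' fun j => LinearMap.ext_ring ?_
      simp [T, add_comm]
    have := LinearMap.congr_fun h y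
    simp only [LinearMap.add_apply, LinearMap.flip_apply, Fintype.linearCombination_apply] at this
    rw [add_comm, this]
    rfl
  have hTinj : Function.Injective T := by
    rw [injective_iff_map_eq_zero]
    intro z hz
    by_contra hne
    obtain ⟨i, hi⟩ := Function.ne_iff.1 hne
    have := hb ((z i)⁻¹ • z) (fun j => by
      rw [hT, map_smul, hz, smul_zero, dotProduct_zero, map_zero]
      exact zero_le) i
    rw [Pi.smul_apply, smul_eq_mul, inv_mul_cancel₀ hi, map_one] at this
    exact absurd this (not_le.2 (pow_lt_one₀ zero_le hp1 hr))
  have hTsurj : Function.Surjective T := LinearMap.injective_iff_surjective.1 hTinj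
  obtain ⟨P, hPW, hP⟩ := exists_integer_projection W
  let Bπ : (ν → 𝒪[k] ⧸ Ideal.span {p ^ (2 * r)}) →ₗ[_] (ν → 𝒪[k] ⧸ Ideal.span {p ^ (2 * r)}) →ₗ[_]
    𝒪[k] ⧸ Ideal.span {p ^ (2 * r)} :=
    Matrix.toLinearMap₂' (𝒪[k] ⧸ Ideal.span {p ^ (2 * r)}) (D.map π)
  have hBπ : ∀ x y : ν → 𝒪[k], Bπ (π ∘ x) (π ∘ y) = π (x ⬝ᵥ D *ᵥ y) := fun x y =>
    (Matrix.toLinearMap₂'_apply' ..).trans (map_dotProduct_mulVec π D x y)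
  suffices ∃ n : ℕ, 0 < n ∧ ∑ z, ψ (Bπ z z) = n by
    simpa only [Bπ, Matrix.toLinearMap₂'_apply'] using this
  refine gaussSum_eq_card hψ Bπ H ?_ ?_
  · rintro _ ⟨x, hx, rfl⟩
    have h0 : (x ⬝ᵥ D *ᵥ x) = 0 := Subtype.ext ((hc x x).symm.trans (hW _ hx))
    rw [hBπ, h0, map_zero]
  · intro z hz
    obtain ⟨z, rfl⟩ := hlift z
    rw [hBπ, hmem, ← hc]
    obtain ⟨y, hy⟩ := hTsurj fun j =>
      B (c z) (c (P (Pi.single j 1))) + B (c (P (Pi.single j 1))) (c z)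
    have hzP : ∀ x, B (c z) (c (P x)) + B (c (P x)) (c z) = c x ⬝ᵥ T y := by
      let cL : (ν → 𝒪[k]) →ₗ[𝒪[k]] ν → k :=
        { toFun := c, map_add' := fun _ _ => rfl, map_smul' := fun _ _ => rfl }
      have h : ((B (c z) + B.flip (c z)).restrictScalars 𝒪[k]) ∘ₗ cL ∘ₗ P =
          ((Fintype.linearCombination k (T y)).restrictScalars 𝒪[k]) ∘ₗ cL := by
        refine LinearMap.pi_ext' fun j => LinearMap.ext_ring ?_
        have hj : cL (Pi.single j 1) = Pi.single j 1 := by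
          ext i
          by_cases hij : i = j
          · subst hij
            simp [cL, c]
          · simp [cL, c, hij]
        simp only [LinearMap.comp_apply, LinearMap.restrictScalars_apply, LinearMap.add_apply,
          LinearMap.flip_apply, LinearMap.single_apply, hj, hy]
        simp [cL]
      exact fun x => LinearMap.congr_fun h x
    have hTy : ∀ j, Valued.v (T y j) ≤ Valued.v (p : k) ^ (2 * r) := fun j => by
      have := hz _ ⟨P (Pi.single j 1), hPW _, rfl⟩
      rw [hBπ, hBπ, ← map_add, hmem] at this
      rw [hy]
      simp only [hc]
      exact this
    have hyr := hb y fun j => by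
      rw [hT, single_dotProduct, one_mul]
      exact hTy j
    have hQy : Valued.v (B y y) ≤ Valued.v (p : k) ^ (2 * r) := by
      rw [hB, two_mul, pow_add]
      exact valuation_dotProduct_mulVec_le D hyr hyr
    have hw : c z - y ∈ W := by
      refine hW' _ fun w hw => ?_
      obtain ⟨a, ha, h⟩ := exists_smul_integer w
      obtain ⟨x, hx⟩ : ∃ x, c x = a • w := ⟨fun i => ⟨a * w i, h i⟩, rfl⟩
      have h1 := hzP x
      rw [hP x (show c x ∈ W from hx ▸ W.smul_mem a hw), ← hT, hx] at h1
      refine (mul_eq_zero.1 ?_).resolve_left ha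
      simp only [map_sub, LinearMap.sub_apply, map_smul, LinearMap.smul_apply,
        smul_eq_mul] at h1 ⊢
      linear_combination h1
    have e : B (c z) (c z) = (c z ⬝ᵥ T y) - B y y := by
      have := hW _ hw
      rw [← hT]
      simp only [map_sub, LinearMap.sub_apply] at this
      linear_combination this
    rw [e]
    refine (Valuation.map_sub _ _ _).trans (max_le (Valuation.map_sum_le _ fun i _ => ?_) hQy)
    rw [map_mul]
    exact mul_le_of_le_one_of_le (z i).2 (hTy i)

end LocalGaussSum

section LocalGaussSum

open scoped Valued
open Matrix

variable [Valued k (WithZero (Multiplicative ℤ))]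

/-- The bilinear form over `k` of an integral matrix. -/
def integralForm {ν : Type} [Fintype ν] [DecidableEq ν] (D : Matrix ν ν 𝒪[k]) :
    (ν → k) →ₗ[k] (ν → k) →ₗ[k] k :=
  Matrix.toLinearMap₂' k (D.map 𝒪[k].subtype)

theorem integralForm_apply {ν : Type} [Fintype ν] [DecidableEq ν] (D : Matrix ν ν 𝒪[k])
    (x y : ν → k) : integralForm D x y = x ⬝ᵥ D.map 𝒪[k].subtype *ᵥ y :=
  Matrix.toLinearMap₂'_apply' ..

theorem integralForm_coe {ν : Type} [Fintype ν] [DecidableEq ν] (D : Matrix ν ν 𝒪[k])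
    (x y : ν → 𝒪[k]) :
    integralForm D (fun i => (x i : k)) (fun i => (y i : k)) = ((x ⬝ᵥ D *ᵥ y : 𝒪[k]) : k) :=
  (integralForm_apply ..).trans (map_dotProduct_mulVec 𝒪[k].subtype D x y)

/-- The form of `D` is not too degenerate modulo `p ^ (2 * r)`. -/
def IsBoundedForm {ν : Type} [Fintype ν] [DecidableEq ν] (p : 𝒪[k]) (r : ℕ)
    (D : Matrix ν ν 𝒪[k]) : Prop :=
  ∀ z, (∀ j, Valued.v (integralForm D z (Pi.single j 1) + integralForm D (Pi.single j 1) z) ≤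
    Valued.v (p : k) ^ (2 * r)) → ∀ i, Valued.v (z i) ≤ Valued.v (p : k) ^ r

theorem fromBlocks_neg_apply {κ : Type} [Fintype κ] {R : Type} [CommRing R] (D₁ D₂ : Matrix κ κ R)
    (x x' y y' : κ → R) :
    Sum.elim x y ⬝ᵥ fromBlocks D₁ 0 0 (-D₂) *ᵥ Sum.elim x' y' =
      x ⬝ᵥ D₁ *ᵥ x' - y ⬝ᵥ D₂ *ᵥ y' := by
  rw [fromBlocks_mulVec]
  simp [neg_mulVec, sub_eq_add_neg]

variable {κ : Type} [Fintype κ] [DecidableEq κ] {p : 𝒪[k]} {r : ℕ}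

theorem IsBoundedForm.eq_zero (hp1 : Valued.v (p : k) < 1) (hr : r ≠ 0) {D : Matrix κ κ 𝒪[k]}
    (h : IsBoundedForm p r D) {z : κ → k}
    (hz : ∀ y, integralForm D z y + integralForm D y z = 0) : z = 0 := by
  by_contra hne
  obtain ⟨i, hi⟩ := Function.ne_iff.1 hne
  have := h ((z i)⁻¹ • z) (fun j => by
    rw [map_smul, map_smul, LinearMap.smul_apply, ← smul_add, hz, smul_zero, map_zero]
    exact zero_le) i
  rw [Pi.smul_apply, smul_eq_mul, inv_mul_cancel₀ hi, map_one] at this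
  exact absurd this (not_le.2 (pow_lt_one₀ zero_le hp1 hr))

theorem integralForm_fromBlocks_neg (D₁ D₂ : Matrix κ κ 𝒪[k]) (x x' y y' : κ → k) :
    integralForm (fromBlocks D₁ 0 0 (-D₂)) (Sum.elim x y) (Sum.elim x' y') =
      integralForm D₁ x x' - integralForm D₂ y y' := by
  rw [integralForm_apply, integralForm_apply, integralForm_apply, ← fromBlocks_neg_apply]
  congr 2
  ext (i | i) (j | j) <;> simp

theorem IsBoundedForm.fromBlocks_neg {D₁ D₂ : Matrix κ κ 𝒪[k]} (h₁ : IsBoundedForm p r D₁)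
    (h₂ : IsBoundedForm p r D₂) : IsBoundedForm p r (fromBlocks D₁ 0 0 (-D₂)) := by
  intro z hz
  obtain ⟨x, y, rfl⟩ : ∃ x y, z = Sum.elim x y := ⟨_, _, (Sum.elim_comp_inl_inr z).symm⟩
  have hl : ∀ j, (Pi.single (Sum.inl j) 1 : κ ⊕ κ → k) = Sum.elim (Pi.single j 1) (0 : κ → k) :=
    fun j => by ext (i | i) <;> simp [Pi.single_apply]
  have hr : ∀ j, (Pi.single (Sum.inr j) 1 : κ ⊕ κ → k) = Sum.elim (0 : κ → k) (Pi.single j 1) :=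
    fun j => by ext (i | i) <;> simp [Pi.single_apply]
  have hx := h₁ x fun j => by
    have := hz (Sum.inl j)
    rw [hl, integralForm_fromBlocks_neg, integralForm_fromBlocks_neg, map_zero, map_zero,
      LinearMap.zero_apply, sub_zero, sub_zero] at this
    exact this
  have hy := h₂ y fun j => by
    have := hz (Sum.inr j)
    rw [hr, integralForm_fromBlocks_neg, integralForm_fromBlocks_neg, map_zero, map_zero,
      LinearMap.zero_apply, zero_sub, zero_sub, ← neg_add, Valuation.map_neg] at this
    exact this
  rintro (i | i)
  · exact hx i
  · exact hy i

/-- The Gauss sums of isometric forms have the same argument. -/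
theorem gaussSum_mul_gaussSum_neg [IsPrincipalIdealRing 𝒪[k]]
    (hp1 : Valued.v (p : k) < 1) (hr : r ≠ 0) [Fintype (𝒪[k] ⧸ Ideal.span {p ^ (2 * r)})]
    {ψ : AddChar (𝒪[k] ⧸ Ideal.span {p ^ (2 * r)}) ℂ} (hψ : ∀ a ≠ 0, ∃ b, ψ (a * b) ≠ 1)
    {D₁ D₂ : Matrix κ κ 𝒪[k]} (h₁ : IsBoundedForm p r D₁) (h₂ : IsBoundedForm p r D₂)
    (g : (κ → k) ≃ₗ[k] κ → k)
    (hg : ∀ x, integralForm D₂ (g x) (g x) = integralForm D₁ x x) :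
    ∃ n : ℕ, 0 < n ∧
      (∑ x, ψ (x ⬝ᵥ D₁.map (Ideal.Quotient.mk (Ideal.span {p ^ (2 * r)})) *ᵥ x)) *
      (∑ x, ψ (-(x ⬝ᵥ D₂.map (Ideal.Quotient.mk (Ideal.span {p ^ (2 * r)})) *ᵥ x))) = n := by
  have hg' : ∀ x y, integralForm D₂ (g x) (g y) + integralForm D₂ (g y) (g x) =
      integralForm D₁ x y + integralForm D₁ y x := fun x y => by
    have := hg (x + y)
    simp only [map_add, LinearMap.add_apply, hg] at this
    linear_combination this
  let W : Submodule k (κ ⊕ κ → k) :=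
    { carrier := {z | z ∘ Sum.inr = g (z ∘ Sum.inl)}
      add_mem' := by
        intro x y hx hy
        change x ∘ Sum.inr + y ∘ Sum.inr = g (x ∘ Sum.inl + y ∘ Sum.inl)
        rw [map_add, ← hx, ← hy]
      zero_mem' := (map_zero g).symm
      smul_mem' := by
        intro c x hx
        change c • (x ∘ Sum.inr) = g (c • (x ∘ Sum.inl))
        rw [map_smul, ← hx] }
  have key := gaussSum_eq_card_of_lagrangian hp1 hr hψ (fromBlocks D₁ 0 0 (-D₂))
    (integralForm _) (integralForm_apply _) W ?_ ?_ (h₁.fromBlocks_neg h₂)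
  · obtain ⟨n, hn, h⟩ := key
    refine ⟨n, hn, ?_⟩
    rw [← h, Finset.sum_mul_sum, ← Finset.sum_product', Finset.univ_product_univ,
      ← Equiv.sum_comp (Equiv.sumArrowEquivProdArrow ..).symm]
    refine Finset.sum_congr rfl fun xy _ => ?_
    rw [← AddChar.map_add_eq_mul, ← sub_eq_add_neg, ← fromBlocks_neg_apply]
    have e : fromBlocks (D₁.map (Ideal.Quotient.mk (Ideal.span {p ^ (2 * r)}))) 0 0
        (-D₂.map (Ideal.Quotient.mk (Ideal.span {p ^ (2 * r)}))) = (fromBlocks D₁ 0 0 (-D₂)).map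
          (Ideal.Quotient.mk (Ideal.span {p ^ (2 * r)})) := by
      ext (i | i) (j | j) <;> simp
    rw [e]
    rfl
  · intro z hz
    obtain ⟨x, y, rfl⟩ : ∃ x y, z = Sum.elim x y := ⟨_, _, (Sum.elim_comp_inl_inr z).symm⟩
    have hz' : y = g x := hz
    rw [integralForm_fromBlocks_neg, hz', hg, sub_self]
  · intro z hz
    obtain ⟨x, y, rfl⟩ : ∃ x y, z = Sum.elim x y := ⟨_, _, (Sum.elim_comp_inl_inr z).symm⟩
    change y = g x
    rw [← sub_eq_zero]
    refine h₂.eq_zero hp1 hr fun w => ?_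
    obtain ⟨w, rfl⟩ := g.surjective w
    have := hz (Sum.elim w (g w)) rfl
    rw [integralForm_fromBlocks_neg, integralForm_fromBlocks_neg] at this
    simp only [map_sub, LinearMap.sub_apply]
    linear_combination -this - hg' x w

end LocalGaussSum

section LocalGaussSum

open scoped Valued
open Matrix

theorem card_sq_mul_eq_zero {A : Type} [CommRing A] {p : A}
    (h : ∀ b, p * b = 0 → ∃ c, p * c = b) :
    Nat.card {a : A // p ^ 2 * a = 0} = Nat.card {a : A // p * a = 0} ^ 2 := by
  choose σ hσ using fun b : {a : A // p * a = 0} => h b b.2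
  rw [sq (Nat.card _), ← Nat.card_prod]
  exact Nat.card_congr
    { toFun := fun a =>
        have ha : p * (p * a) = 0 := by rw [← mul_assoc, ← sq, a.2]
        (⟨p * a, ha⟩, ⟨a - σ ⟨p * a, ha⟩, by rw [mul_sub, hσ, sub_self]⟩)
      invFun := fun b => ⟨σ b.1 + b.2, by rw [sq, mul_assoc, mul_add, hσ, b.2.2, add_zero, b.1.2]⟩
      left_inv := fun a => by simp
      right_inv := fun b => by
        have e : p * (σ b.1 + b.2) = b.1 := by rw [mul_add, hσ, b.2.2, add_zero]
        ext
        · exact e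
        · simp [e] }

variable [Valued k (WithZero (Multiplicative ℤ))]

theorem finite_integer_quotient (hc : IsCompact {x : k | Valued.v x ≤ 1}) {a : 𝒪[k]} (ha : a ≠ 0) :
    Finite (𝒪[k] ⧸ Ideal.span {a}) := by
  have : CompactSpace 𝒪[k] := isCompact_iff_compactSpace.1 hc
  have h0 : Valued.v.restrict (a : k) ≠ 0 := (Valuation.ne_zero_iff _).2 (by simpa using ha)
  refine AddSubgroup.quotient_finite_of_isOpen (Ideal.span {a}).toAddSubgroup ?_
  have : IsOpen {x : k | Valued.v x ≤ Valued.v (a : k)} := by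
    simpa only [Valuation.restrict_le_iff] using Valued.isOpen_closedBall k h0
  convert this.preimage continuous_subtype_val
  ext x
  exact Ideal.mem_span_singleton.trans integer_dvd_iff

variable {p : 𝒪[k]} {r : ℕ}

theorem valuation_le_of_lt (hp : Valued.v (p : k) = WithZero.exp (-1)) {x : k} {n : ℕ}
    (h : Valued.v x < Valued.v (p : k) ^ n) : Valued.v x ≤ Valued.v (p : k) ^ (n + 1) := by
  by_cases hx : x = 0
  · simp [hx]
  have hv : Valued.v x ≠ 0 := (Valuation.ne_zero_iff _).2 hx
  obtain ⟨m, hm⟩ : ∃ m, Valued.v x = WithZero.exp m := ⟨_, (WithZero.exp_log hv).symm⟩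
  rw [hp, hm, ← WithZero.exp_nsmul] at h ⊢
  rw [WithZero.exp_lt_exp] at h
  rw [WithZero.exp_le_exp]
  simp only [nsmul_eq_mul, Nat.cast_add, Nat.cast_one] at h ⊢
  linarith

theorem exists_primitive_addChar (hp : Valued.v (p : k) = WithZero.exp (-1)) (n : ℕ)
    [Finite (𝒪[k] ⧸ Ideal.span {p ^ (n + 1)})] :
    ∃ ψ : AddChar (𝒪[k] ⧸ Ideal.span {p ^ (n + 1)}) ℂ, ∀ a ≠ 0, ∃ b, ψ (a * b) ≠ 1 := by
  have h0 : Ideal.Quotient.mk (Ideal.span {p ^ (n + 1)}) (p ^ n) ≠ 0 := by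
    rw [Ne, Ideal.Quotient.eq_zero_iff_dvd, integer_dvd_iff]
    simp only [SubmonoidClass.coe_pow, map_pow, hp]
    rw [not_le, ← WithZero.exp_nsmul, ← WithZero.exp_nsmul, WithZero.exp_lt_exp]
    simp
  obtain ⟨ψ, hψ⟩ := AddChar.exists_apply_ne_zero.2 h0
  refine ⟨ψ, fun a ha => ?_⟩
  obtain ⟨a, rfl⟩ := Ideal.Quotient.mk_surjective a
  rw [Ne, Ideal.Quotient.eq_zero_iff_dvd, integer_dvd_iff, SubmonoidClass.coe_pow, map_pow] at ha
  have hd : a ∣ p ^ n := by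
    rw [integer_dvd_iff, SubmonoidClass.coe_pow, map_pow, ← not_lt]
    exact fun h => ha (valuation_le_of_lt hp h)
  obtain ⟨b, hb⟩ := hd
  exact ⟨Ideal.Quotient.mk _ b, by rwa [← map_mul, ← hb]⟩

theorem exists_mul_eq_of_mul_eq_zero (hp : p ≠ 0) (n : ℕ) (b : 𝒪[k] ⧸ Ideal.span {p ^ (n + 2)})
    (h : Ideal.Quotient.mk _ p * b = 0) : ∃ c, Ideal.Quotient.mk _ p * c = b := by
  obtain ⟨b, rfl⟩ := Ideal.Quotient.mk_surjective b
  rw [← map_mul, Ideal.Quotient.eq_zero_iff_dvd, pow_succ', mul_dvd_mul_iff_left hp,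
    pow_succ'] at h
  obtain ⟨c, rfl⟩ := h
  exact ⟨Ideal.Quotient.mk _ (p ^ n * c), by rw [← map_mul, mul_assoc]⟩

end LocalGaussSum

section LocalGaussSum

open scoped Valued
open Matrix

variable [Valued k (WithZero (Multiplicative ℤ))] {p : 𝒪[k]} {m n : ℕ}
  {C : Fin m → Matrix (Fin n) (Fin n) 𝒪[k]}

theorem integralForm_combForm (ℓ : Fin m → 𝒪[k]) (x y : Fin n → k) :
    integralForm (combForm C ℓ) x y = ∑ i, (ℓ i : k) * integralForm (C i) x y := by
  simp only [integralForm_apply, combForm_map, dotProduct_combForm_mulVec]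
  rfl

theorem continuous_integralForm {X : Type} [TopologicalSpace X] (D : Matrix (Fin n) (Fin n) 𝒪[k])
    {f g : X → Fin n → k} (hf : Continuous f) (hg : Continuous g) :
    Continuous fun x => integralForm D (f x) (g x) := by
  simp only [integralForm_apply, dotProduct, mulVec]
  fun_prop

theorem exists_valuation_le_of_map_le (hc : IsCompact {x : k | Valued.v x ≤ 1})
    (hp : Valued.v (p : k) = WithZero.exp (-1))
    (hN : ∀ x : Fin n → k, x ≠ 0 → ∃ i, integralForm (C i) x x ≠ 0) :
    ∃ r : ℕ, ∀ r' ≥ r, ∀ x : Fin n → k,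
      (∀ i, Valued.v (integralForm (C i) x x) ≤ Valued.v (p : k) ^ r') →
      ∀ j, Valued.v (x j) ≤ Valued.v (p : k) := by
  have hp1 : Valued.v (p : k) < 1 := by rw [hp, ← WithZero.exp_zero, WithZero.exp_lt_exp]; simp
  obtain ⟨γ, h0, hγ⟩ := exists_le_valuation (isCompact_primitiveVectors hc n)
    (F := fun i (x : Fin n → k) => integralForm (C i) x x)
    (fun i => continuous_integralForm (C i) continuous_id continuous_id)
    (fun x hx => hN x fun h => by obtain ⟨_, i, hi⟩ := hx; simp [h] at hi)
  obtain ⟨r, hr⟩ := exists_pow_lt₀ hp1 (Units.mk0 γ h0)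
  refine ⟨r, fun r' hr' x hx j => ?_⟩
  by_cases hx0 : x = 0
  · simp [hx0]
  obtain ⟨a, ha, hprim, hmax⟩ := exists_smul_mem_primitiveVectors hx0
  refine (hmax j).trans ?_
  obtain ⟨i, hi⟩ := hγ _ hprim
  have hlt : Valued.v (x a) < 1 := by
    by_contra! hge
    have h1 : Valued.v (integralForm (C i) x x) < γ :=
      (hx i).trans_lt ((pow_le_pow_right_of_le_one' hp1.le hr').trans_lt hr)
    refine absurd (hi.trans ?_) (not_le.2 h1)
    simp only [map_smul, LinearMap.smul_apply, smul_eq_mul, map_mul, map_inv₀]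
    have h2 : (Valued.v (x a))⁻¹ ≤ 1 := inv_le_one_of_one_le₀ hge
    exact mul_le_of_le_one_of_le h2 (mul_le_of_le_one_of_le h2 le_rfl)
  simpa using valuation_le_of_lt hp (n := 0) (by simpa using hlt)

theorem exists_isBoundedForm_combForm (hc : IsCompact {x : k | Valued.v x ≤ 1})
    (hp : Valued.v (p : k) = WithZero.exp (-1))
    (hnd : ∀ ℓ : Fin m → k, ℓ ≠ 0 → ∀ y : Fin n → k, y ≠ 0 → ∃ j, ∑ i, ℓ i *
      (integralForm (C i) y (Pi.single j 1) + integralForm (C i) (Pi.single j 1) y) ≠ 0) :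
    ∃ r : ℕ, ∀ r' ≥ r, ∀ ℓ : Fin m → 𝒪[k], (∃ i, Valued.v (p : k) ≤ Valued.v (ℓ i : k)) →
      IsBoundedForm p r' (combForm C ℓ) := by
  have hp1 : Valued.v (p : k) < 1 := by rw [hp, ← WithZero.exp_zero, WithZero.exp_lt_exp]; simp
  have hp0 : Valued.v (p : k) ≠ 0 := by rw [hp]; exact WithZero.exp_ne_zero
  let F : Fin n → (Fin m → k) × (Fin n → k) → k := fun j z => ∑ i, z.1 i *
      (integralForm (C i) z.2 (Pi.single j 1) + integralForm (C i) (Pi.single j 1) z.2)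
  obtain ⟨γ, h0, hγ⟩ := exists_le_valuation
    ((isCompact_primitiveVectors hc m).prod (isCompact_primitiveVectors hc n)) (F := F)
    (fun j => continuous_finsetSum _ fun i _ => by
      have h1 : Continuous fun z : (Fin m → k) × (Fin n → k) =>
          integralForm (C i) z.2 (Pi.single j 1) :=
        continuous_integralForm _ continuous_snd continuous_const
      have h2 : Continuous fun z : (Fin m → k) × (Fin n → k) =>
          integralForm (C i) (Pi.single j 1) z.2 :=
        continuous_integralForm _ continuous_const continuous_snd
      fun_prop)
    (fun z hz => hnd z.1 (fun h => by obtain ⟨⟨_, i, hi⟩, _⟩ := hz; simp [h] at hi) z.2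
      (fun h => by obtain ⟨_, ⟨_, i, hi⟩⟩ := hz; simp [h] at hi))
  obtain ⟨r, hr⟩ := exists_pow_lt₀ hp1 (Units.mk0 (γ * Valued.v (p : k)) (mul_ne_zero h0 hp0))
  refine ⟨r, fun r' hr' ℓ hℓ z hz j => ?_⟩
  by_cases hz0 : z = 0
  · simp [hz0]
  obtain ⟨b, hb, hbprim, hbmax⟩ := exists_smul_mem_primitiveVectors hz0
  refine (hbmax j).trans ?_
  obtain ⟨i, hi⟩ := hℓ
  have hℓ0 : (fun i => (ℓ i : k)) ≠ 0 := fun h => by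
    have : (ℓ i : k) = 0 := congrFun h i
    rw [this, map_zero] at hi
    exact hp0 (le_zero_iff.1 hi)
  obtain ⟨a, ha, haprim, hamax⟩ := exists_smul_mem_primitiveVectors hℓ0
  obtain ⟨l, hl⟩ := hγ (_, _) ⟨haprim, hbprim⟩
  have e : (ℓ a : k) * z b * F l ((ℓ a : k)⁻¹ • fun i => (ℓ i : k), (z b)⁻¹ • z) =
      integralForm (combForm C ℓ) z (Pi.single l 1) +
        integralForm (combForm C ℓ) (Pi.single l 1) z := by
    simp only [F, integralForm_combForm, map_smul, LinearMap.smul_apply, Pi.smul_apply, smul_eq_mul,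
      Finset.mul_sum, ← Finset.sum_add_distrib]
    refine Finset.sum_congr rfl fun i _ => ?_
    field_simp
  have h1 := hz l
  rw [← e, map_mul, map_mul] at h1
  have h2 : Valued.v (p : k) ^ r' ≤ γ * Valued.v (p : k) :=
    (pow_le_pow_right_of_le_one' hp1.le hr').trans hr.le
  have h3 : Valued.v (p : k) ^ r' * Valued.v (z b) ≤
      Valued.v (p : k) ^ r' * Valued.v (p : k) ^ r' := by
    calc _ ≤ γ * Valued.v (p : k) * Valued.v (z b) := by gcongr
      _ = Valued.v (p : k) * Valued.v (z b) * γ := by rw [mul_assoc, mul_comm]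
      _ ≤ Valued.v (ℓ a : k) * Valued.v (z b) * Valued.v (F l (_, _)) := by
        gcongr
        exact hi.trans (hamax i)
      _ ≤ _ := by rwa [← pow_add, ← two_mul]
  exact le_of_mul_le_mul_left h3 (pow_pos (zero_lt_iff.2 hp0) _)

end LocalGaussSum

section LocalGaussSum

open scoped Valued
open Matrix

variable [Valued k (WithZero (Multiplicative ℤ))]

/-- The integral case of `exists_not_isometric`. -/
theorem exists_integral_not_isometric
    (hdisc : Function.Surjective (Valued.v : Valuation k (WithZero (Multiplicative ℤ))))
    (hc : IsCompact {x : k | Valued.v x ≤ 1}) {m n : ℕ} (hm : m ≠ 0) (hmn : n = 2 * m)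
    {C : Fin m → Matrix (Fin n) (Fin n) 𝒪[k]}
    (hN : ∀ x : Fin n → k, x ≠ 0 → ∃ i, integralForm (C i) x x ≠ 0)
    (hnd : ∀ ℓ : Fin m → k, ℓ ≠ 0 → ∀ y : Fin n → k, y ≠ 0 → ∃ j, ∑ i, ℓ i *
      (integralForm (C i) y (Pi.single j 1) + integralForm (C i) (Pi.single j 1) y) ≠ 0) :
    ∃ ℓ ℓ' : Fin m → 𝒪[k], ℓ ≠ 0 ∧ ℓ' ≠ 0 ∧ ¬∃ g : (Fin n → k) ≃ₗ[k] (Fin n → k),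
      ∀ x, integralForm (combForm C ℓ') (g x) (g x) = integralForm (combForm C ℓ) x x := by
  classical
  by_contra! hiso
  obtain ⟨p, hp⟩ : ∃ p : 𝒪[k], Valued.v (p : k) = WithZero.exp (-1) := by
    obtain ⟨x, hx⟩ := hdisc (WithZero.exp (-1))
    refine ⟨⟨x, ?_⟩, hx⟩
    change Valued.v x ≤ 1
    rw [hx, ← WithZero.exp_zero, WithZero.exp_le_exp]
    simp
  have := isDiscreteValuationRing_integer hdisc
  have hp1 : Valued.v (p : k) < 1 := by rw [hp, ← WithZero.exp_zero, WithZero.exp_lt_exp]; simp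
  have hp0 : p ≠ 0 := by
    rintro rfl
    rw [ZeroMemClass.coe_zero, map_zero] at hp
    exact WithZero.exp_ne_zero hp.symm
  obtain ⟨r₁, hr₁⟩ := exists_valuation_le_of_map_le hc hp hN
  obtain ⟨r₂, hr₂⟩ := exists_isBoundedForm_combForm hc hp hnd
  obtain ⟨r, hr, h₁, h₂⟩ : ∃ r, r ≠ 0 ∧ r₁ ≤ 2 * r ∧ r₂ ≤ r :=
    ⟨r₁ + r₂ + 1, by omega, by omega, by omega⟩
  specialize hr₁ _ h₁
  specialize hr₂ _ h₂
  have hfin := finite_integer_quotient hc (pow_ne_zero (2 * r) hp0)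
  have := Fintype.ofFinite (𝒪[k] ⧸ Ideal.span {p ^ (2 * r)})
  obtain ⟨ψ, hψ⟩ : ∃ ψ : AddChar (𝒪[k] ⧸ Ideal.span {p ^ (2 * r)}) ℂ,
      ∀ a ≠ 0, ∃ b, ψ (a * b) ≠ 1 := by
    obtain ⟨s, hs⟩ : ∃ s, 2 * r = s + 1 := ⟨2 * r - 1, by omega⟩
    rw [hs] at hfin ⊢
    exact exists_primitive_addChar hp s
  set π := Ideal.Quotient.mk (Ideal.span {p ^ (2 * r)}) with hπ
  have hann : ∀ b, π p * b = 0 → ∃ c, π p * c = b := by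
    obtain ⟨s, hs⟩ : ∃ s, 2 * r = s + 2 := ⟨2 * r - 2, by omega⟩
    rw [hπ, hs]
    exact exists_mul_eq_of_mul_eq_zero hp0 s
  have hmem : ∀ x : 𝒪[k], π x = 0 ↔ Valued.v (x : k) ≤ Valued.v (p : k) ^ (2 * r) := fun x => by
    rw [hπ, Ideal.Quotient.eq_zero_iff_dvd, integer_dvd_iff]
    simp
  have hzero := sum_gaussSum_eq_zero hψ (card_sq_mul_eq_zero hann) (fun i => (C i).map π)
    (by simpa using hmn) (fun x hx => by
      choose x' hx' using fun i => Ideal.Quotient.mk_surjective (x i)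
      obtain rfl : x = π ∘ x' := funext fun i => (hx' i).symm
      have := hr₁ (fun i => (x' i : k)) fun i => by
        rw [integralForm_coe, ← hmem, ← map_dotProduct_mulVec]
        exact hx i
      choose y hy using fun i => integer_dvd_iff.2 (this i)
      exact ⟨π ∘ y, funext fun i => by simp [hy i]⟩)
  have hlift : ∀ ℓ : Fin m → 𝒪[k] ⧸ Ideal.span {p ^ (2 * r)}, (¬∃ ℓ', ℓ = π p ^ 2 • ℓ') →
      ∃ L : Fin m → 𝒪[k], ℓ = π ∘ L ∧ L ≠ 0 ∧ IsBoundedForm p r (combForm C L) := by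
    intro ℓ hℓ
    choose L hL using fun i => Ideal.Quotient.mk_surjective (ℓ i)
    obtain rfl : ℓ = π ∘ L := funext fun i => (hL i).symm
    refine ⟨L, rfl, ?_, hr₂ L ?_⟩
    · rintro rfl
      exact hℓ ⟨0, funext fun i => by simp⟩
    · by_contra! h
      have h' : ∀ i, p ^ 2 ∣ L i := fun i => by
        rw [integer_dvd_iff, SubmonoidClass.coe_pow, map_pow]
        exact valuation_le_of_lt hp (by simpa using h i)
      choose y hy using h'
      exact hℓ ⟨π ∘ y, funext fun i => by simp [hy i]⟩
  have h1 : ¬∃ ℓ' : Fin m → 𝒪[k] ⧸ Ideal.span {p ^ (2 * r)}, (fun _ => 1) = π p ^ 2 • ℓ' := by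
    rintro ⟨ℓ', h⟩
    have h := congrFun h ⟨0, Nat.pos_of_ne_zero hm⟩
    have hu : IsUnit (π p) := by
      rw [Pi.smul_apply, smul_eq_mul, sq, mul_assoc] at h
      exact IsUnit.of_mul_eq_one _ h.symm
    have := hu.pow (2 * r)
    rw [← map_pow, (hmem _).2 (by simp)] at this
    have := isUnit_zero_iff.1 this
    rw [eq_comm, ← map_one π, hmem, OneMemClass.coe_one, map_one] at this
    exact absurd this (not_le.2 (pow_lt_one₀ zero_le hp1 (by omega)))
  obtain ⟨L₁, hL₁, hL₁0, hb₁⟩ := hlift _ h1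
  set G₁ := ∑ x, ψ (-(x ⬝ᵥ (combForm C L₁).map π *ᵥ x)) with hG₁
  have hterm : ∀ ℓ : Fin m → 𝒪[k] ⧸ Ideal.span {p ^ (2 * r)}, (¬∃ ℓ', ℓ = π p ^ 2 • ℓ') →
      ∃ N : ℕ, 0 < N ∧ (∑ x, ψ (x ⬝ᵥ combForm (fun i => (C i).map π) ℓ *ᵥ x)) * G₁ = N := by
    intro ℓ hℓ
    obtain ⟨L, rfl, hL, hb⟩ := hlift ℓ hℓ
    obtain ⟨g, hg⟩ := hiso L L₁ hL hL₁0
    simp only [← combForm_map]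
    exact gaussSum_mul_gaussSum_neg hp1 hr hψ hb hb₁ g hg
  choose! N hN0 hN using hterm
  have hsum : ((∑ ℓ : Fin m → 𝒪[k] ⧸ Ideal.span {p ^ (2 * r)} with ¬∃ ℓ', ℓ = π p ^ 2 • ℓ', N ℓ :
      ℕ) : ℂ) = 0 := by
    rw [Nat.cast_sum, ← zero_mul G₁, ← hzero, Finset.sum_mul]
    exact Finset.sum_congr rfl fun ℓ hℓ => (hN ℓ (Finset.mem_filter.1 hℓ).2).symm
  have hpos := Finset.sum_pos (s := {ℓ : Fin m → 𝒪[k] ⧸ Ideal.span {p ^ (2 * r)} |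
    ¬∃ ℓ', ℓ = π p ^ 2 • ℓ'}) (f := N) (fun ℓ hℓ => hN0 ℓ (Finset.mem_filter.1 hℓ).2)
    ⟨_, Finset.mem_filter.2 ⟨Finset.mem_univ _, h1⟩⟩
  exact hpos.ne' (Nat.cast_eq_zero.1 hsum)

end LocalGaussSum

section LocalGaussSum

open scoped Valued
open Matrix Module

variable [Valued k (WithZero (Multiplicative ℤ))]

/-- A linear system of bilinear forms of dimension `m` on a space of dimension `2 * m`, all of
whose nonzero members are nondegenerate and without a common isotropic vector, contains two
nonisometric nonzero members. -/
theorem exists_not_isometric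
    (hdisc : Function.Surjective (Valued.v : Valuation k (WithZero (Multiplicative ℤ))))
    (hc : IsCompact {x : k | Valued.v x ≤ 1}) {U E : Type} [AddCommGroup U] [Module k U]
    [FiniteDimensional k U] [AddCommGroup E] [Module k E] [FiniteDimensional k E]
    (hU : finrank k U ≠ 0) (hE : finrank k E = 2 * finrank k U) (q : U →ₗ[k] E →ₗ[k] E →ₗ[k] k)
    (hN : ∀ x, x ≠ 0 → ∃ u, q u x x ≠ 0)
    (hnd : ∀ u, u ≠ 0 → ∀ y, (∀ z, q u y z + q u z y = 0) → y = 0) :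
    ∃ u u', u ≠ 0 ∧ u' ≠ 0 ∧ ¬∃ g : E ≃ₗ[k] E, ∀ x, q u' (g x) (g x) = q u x x := by
  let bU := finBasis k U
  let bE := finBasis k E
  obtain ⟨a, ha, hint⟩ := exists_smul_integer
    fun s : Fin (finrank k U) × Fin (finrank k E) × Fin (finrank k E) =>
      q (bU s.1) (bE s.2.1) (bE s.2.2)
  let C : Fin (finrank k U) → Matrix (Fin (finrank k E)) (Fin (finrank k E)) 𝒪[k] :=
    fun i => Matrix.of fun j l => ⟨a * q (bU i) (bE j) (bE l), hint (i, j, l)⟩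
  let e := bE.equivFun
  have hCi : ∀ i x y, integralForm (C i) x y = a * q (bU i) (e.symm x) (e.symm y) := by
    intro i x y
    have h : integralForm (C i) = a • (q (bU i)).compl₁₂ e.symm.toLinearMap e.symm.toLinearMap := by
      refine LinearMap.pi_ext' fun j => LinearMap.ext_ring (LinearMap.pi_ext' fun l =>
        LinearMap.ext_ring ?_)
      simp [integralForm_apply, e, C]
    simp [h]
  have hC : ∀ ℓ x y, integralForm (combForm C ℓ) x y =
      a * q (∑ i, (ℓ i : k) • bU i) (e.symm x) (e.symm y) := by
    intro ℓ x y
    simp only [integralForm_combForm, hCi, map_sum, map_smul, LinearMap.sum_apply,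
      LinearMap.smul_apply, smul_eq_mul, Finset.mul_sum]
    exact Finset.sum_congr rfl fun i _ => mul_left_comm ..
  obtain ⟨ℓ, ℓ', hℓ, hℓ', h⟩ := exists_integral_not_isometric hdisc hc hU hE (C := C)
    (fun x hx => by
      by_contra! h
      obtain ⟨u, hu⟩ := hN (e.symm x) (by simpa using hx)
      apply hu
      rw [← bU.sum_repr u]
      simp only [map_sum, map_smul, LinearMap.sum_apply, LinearMap.smul_apply, smul_eq_mul]
      refine Finset.sum_eq_zero fun i _ => ?_
      rw [(mul_eq_zero.1 ((hCi i x x).symm.trans (h i))).resolve_left ha, mul_zero])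
    (fun ℓ hℓ y hy => by
      by_contra! h
      refine hy ?_
      have hu : ∑ i, ℓ i • bU i ≠ 0 := fun h0 =>
        hℓ (bU.equivFun.symm.injective (by simpa [Basis.equivFun_symm_apply] using h0))
      have hB : (q (∑ i, ℓ i • bU i)) (e.symm y) + (q (∑ i, ℓ i • bU i)).flip (e.symm y) = 0 := by
        refine bE.ext fun j => (mul_eq_zero.1 ?_).resolve_left ha
        have hs : e.symm (Pi.single j 1) = bE j := by simp [e]
        have hj := h j
        simp only [hCi, hs] at hj
        rw [← hj]
        simp only [map_sum, map_smul, LinearMap.add_apply, LinearMap.flip_apply,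
          LinearMap.sum_apply, LinearMap.smul_apply, smul_eq_mul, mul_add, Finset.mul_sum,
          ← Finset.sum_add_distrib, mul_left_comm a]
      have := hnd _ hu (e.symm y) fun z => by simpa using LinearMap.congr_fun hB z
      simpa using this)
  have hne : ∀ ℓ : Fin (finrank k U) → 𝒪[k], ℓ ≠ 0 → ∑ i, (ℓ i : k) • bU i ≠ 0 := fun ℓ hℓ h0 => by
    refine hℓ (funext fun i => Subtype.ext ?_)
    have : (fun i => (ℓ i : k)) = 0 :=
      bU.equivFun.symm.injective (by simpa [Basis.equivFun_symm_apply] using h0)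
    exact congrFun this i
  refine ⟨_, _, hne ℓ hℓ, hne ℓ' hℓ', fun ⟨g, hg⟩ => h ⟨e.symm.trans (g.trans e), fun x => ?_⟩⟩
  rw [hC, hC]
  refine congrArg (a * ·) ?_
  simpa only [LinearEquiv.trans_apply, LinearEquiv.symm_apply_apply] using hg (e.symm x)

end LocalGaussSum

section HermitianForms

open Module

/-- The subspace of vectors fixed by an involution. -/
def fixedSubspace {L : Type} [Field L] [Algebra k L] (i : L →ₐ[k] L) : Submodule k L :=
  LinearMap.eqLocus i.toLinearMap LinearMap.id

variable {L : Type} [Field L] [Algebra k L] {i : L →ₐ[k] L}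

theorem mem_fixedSubspace {x : L} : x ∈ fixedSubspace i ↔ i x = x := Iff.rfl

theorem finrank_eq_two_mul_finrank_fixedSubspace [FiniteDimensional k L] (h2 : (2 : k) ≠ 0)
    (hi : ∀ x, i (i x) = x) {a : L} (ha : i a ≠ a) :
    finrank k L = 2 * finrank k (fixedSubspace i) := by
  have h2' : (2 : L) ≠ 0 := by
    rw [← map_ofNat (algebraMap k L) 2]
    simpa using h2
  have hd : a - i a ≠ 0 := sub_ne_zero.2 ha.symm
  have hid : i (a - i a) = -(a - i a) := by rw [map_sub, hi, neg_sub]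
  generalize a - i a = d at hd hid
  let e : (fixedSubspace i × fixedSubspace i) →ₗ[k] L :=
    (fixedSubspace i).subtype.coprod (LinearMap.mulLeft k d ∘ₗ (fixedSubspace i).subtype)
  have he (x y : fixedSubspace i) : e (x, y) = x + d * y := rfl
  have hbij : Function.Bijective e := by
    refine ⟨(injective_iff_map_eq_zero e).2 ?_, fun x => ?_⟩
    · rintro ⟨⟨x, hx⟩, ⟨y, hy⟩⟩ h
      rw [he] at h
      have h' := congrArg i h
      rw [mem_fixedSubspace] at hx hy
      simp only [map_add, map_mul, hx, hy, hid, map_zero] at h'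
      simp only at h
      have hx0 : x = 0 := by
        have : 2 * x = 0 := by linear_combination h + h'
        simpa [h2'] using this
      subst hx0
      simpa [hd] using h
    · refine ⟨(⟨(x + i x) / 2, ?_⟩, ⟨(x - i x) / (2 * d), ?_⟩), ?_⟩
      · rw [mem_fixedSubspace, map_div₀, map_add, hi, map_ofNat, add_comm]
      · rw [mem_fixedSubspace, map_div₀, map_sub, hi, map_mul, hid, map_ofNat]
        field_simp
        ring
      · rw [he]
        field_simp
        ring
  rw [← (LinearEquiv.ofBijective e hbij).finrank_eq, finrank_prod, two_mul]

variable [Valued k (WithZero (Multiplicative ℤ))]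

/-- Over a local field, the transfers of the one-dimensional hermitian forms for a nontrivial
involution are not all isometric. -/
theorem exists_hermForm_not_isometric
    (hdisc : Function.Surjective (Valued.v : Valuation k (WithZero (Multiplicative ℤ))))
    (hc : IsCompact {x : k | Valued.v x ≤ 1}) [FiniteDimensional k L] (h2 : (2 : k) ≠ 0)
    (hi : ∀ x, i (i x) = x) {a : L} (ha : i a ≠ a) {s : L →ₗ[k] k} (hs : ∀ x, s (i x) = s x)
    (hs1 : s 1 ≠ 0) :
    ∃ u u' : L, i u = u ∧ i u' = u' ∧ u ≠ 0 ∧ u' ≠ 0 ∧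
      ¬∃ g : L ≃ₗ[k] L, ∀ x, hermForm i s u' (g x) (g x) = hermForm i s u x x := by
  have h1 : (1 : L) ∈ fixedSubspace i := map_one i
  have hU : finrank k (fixedSubspace i) ≠ 0 := fun h => by
    have := finrank_zero_iff.1 h
    exact one_ne_zero (congrArg Subtype.val (Subsingleton.elim (⟨1, h1⟩ : fixedSubspace i) 0))
  let q : fixedSubspace i →ₗ[k] L →ₗ[k] L →ₗ[k] k :=
    { toFun := fun u => hermForm i s u
      map_add' := fun u v => by ext; simp [add_mul]
      map_smul' := fun c u => by ext; simp }
  have hN (x : L) (hx : x ≠ 0) : ∃ u, q u x x ≠ 0 := by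
    have hix : i x ≠ 0 := by simpa using hx
    refine ⟨⟨(x * i x)⁻¹, ?_⟩, ?_⟩
    · rw [mem_fixedSubspace, map_inv₀, map_mul, hi, mul_comm]
    · change s ((x * i x)⁻¹ * x * i x) ≠ 0
      rwa [mul_assoc, inv_mul_cancel₀ (mul_ne_zero hx hix)]
  have hnd (u : fixedSubspace i) (hu : u ≠ 0) (y : L) (hy : ∀ z, q u y z + q u z y = 0) :
      y = 0 := by
    obtain ⟨hsymm, hnd⟩ := isQuadraticSpace_hermForm hi hs hs1 u.2 (by simpa using hu)
    refine hnd y fun z => ?_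
    have := hy z
    change hermForm i s u y z + hermForm i s u z y = 0 at this
    rw [hsymm z y, ← two_mul] at this
    exact (mul_eq_zero.1 this).resolve_left h2
  obtain ⟨u, u', hu, hu', h⟩ := exists_not_isometric hdisc hc hU
    (finrank_eq_two_mul_finrank_fixedSubspace h2 hi ha) q hN hnd
  exact ⟨u, u', u.2, u'.2, by simpa using hu, by simpa using hu', h⟩

end HermitianForms

section Assembly

open Module QuadraticSpace

theorem IsQuadraticSpace.polar {W : Type} [AddCommGroup W] [Module k W]
    {B : LinearMap.BilinForm k W} (h : IsQuadraticSpace B) (x y : W) :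
    QuadraticMap.polar B.toQuadraticMap x y = 2 * B x y := by
  rw [LinearMap.BilinMap.polar_toQuadraticMap, h.1 y x, two_mul]

theorem IsQuadraticSpace.nondeg {W : Type} [AddCommGroup W] [Module k W] (h2 : (2 : k) ≠ 0)
    {B : LinearMap.BilinForm k W} (h : IsQuadraticSpace B) : Nondeg B.toQuadraticMap :=
  fun x hx => h.2 x fun y => by simpa [h.polar, h2] using hx y

theorem IsQuadraticSpace.disc_eq {W : Type} [AddCommGroup W] [Module k W] [FiniteDimensional k W]
    {B : LinearMap.BilinForm k W} (h : IsQuadraticSpace B) :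
    disc B.toQuadraticMap = 2 ^ finrank k W * detOf B := by
  rw [disc, ← detOf_smul]
  congr 1
  ext x y
  simpa using h.polar x y

theorem exists_linearEquiv_of_equivalent {V W : Type} [AddCommGroup V] [Module k V]
    [AddCommGroup W] [Module k W] (h2 : (2 : k) ≠ 0) {B : LinearMap.BilinForm k V}
    {B' : LinearMap.BilinForm k W} (hB : IsQuadraticSpace B) (hB' : IsQuadraticSpace B')
    (h : B.toQuadraticMap.Equivalent B'.toQuadraticMap) :
    ∃ g : V ≃ₗ[k] W, ∀ x y, B' (g x) (g y) = B x y := by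
  obtain ⟨e⟩ := h
  refine ⟨e.toLinearEquiv, fun x y => mul_left_cancel₀ h2 ?_⟩
  rw [← hB.polar, ← hB'.polar]
  exact polar_map e x y

/-- Two nonisometric spaces with the same determinant represent, after adding a common summand,
all isometry classes of the given dimension and determinant. -/
theorem exists_isometry_prodForm {V A R : Type} [AddCommGroup V] [Module k V]
    [FiniteDimensional k V] [AddCommGroup A] [Module k A] [FiniteDimensional k A] [AddCommGroup R]
    [Module k R] [FiniteDimensional k R] (h2 : (2 : k) ≠ 0) (hk : LocalAnisotropy k)
    {B : LinearMap.BilinForm k V} {b b' : LinearMap.BilinForm k A} {r : LinearMap.BilinForm k R}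
    (hB : IsQuadraticSpace B) (hb : IsQuadraticSpace b) (hb' : IsQuadraticSpace b')
    (hr : IsQuadraticSpace r) (hdim : finrank k (A × R) = finrank k V)
    (hd : SqEq (detOf B) (detOf b * detOf r)) (hd' : SqEq (detOf b) (detOf b'))
    (hne : ¬∃ g : A ≃ₗ[k] A, ∀ x, b' (g x) (g x) = b x x) :
    (∃ g : V ≃ₗ[k] A × R, ∀ x y, prodForm b r (g x) (g y) = B x y) ∨
      ∃ g : V ≃ₗ[k] A × R, ∀ x y, prodForm b' r (g x) (g y) = B x y := by
  have hdisc {c : LinearMap.BilinForm k A} (hc : IsQuadraticSpace c)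
      (h : SqEq (detOf B) (detOf c * detOf r)) :
      SqEq (disc B.toQuadraticMap) (disc (prodForm c r).toQuadraticMap) := by
    rw [hB.disc_eq, (hc.prodForm hr).disc_eq, hdim]
    exact (SqEq.refl _).mul (h.trans (detOf_prodForm c r).symm)
  have hswap (c : LinearMap.BilinForm k A) :
      (r.toQuadraticMap.prod c.toQuadraticMap).Equivalent (prodForm c r).toQuadraticMap :=
    ⟨{ LinearEquiv.prodComm k R A with map_app' := fun x => by simp [add_comm] }⟩
  refine (equivalent_or_equivalent h2 hk (hB.nondeg h2) ((hb.prodForm hr).nondeg h2)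
    ((hb'.prodForm hr).nondeg h2) rfl hdim hdim (hdisc hb hd)
    (hdisc hb' (hd.trans (hd'.mul (SqEq.refl _)))) fun h => hne ?_).imp
    (exists_linearEquiv_of_equivalent h2 hB (hb.prodForm hr))
    (exists_linearEquiv_of_equivalent h2 hB (hb'.prodForm hr))
  obtain ⟨e⟩ := cancel h2 _ r.toQuadraticMap rfl (hr.nondeg h2)
    (((hswap b).trans h).trans (hswap b').symm)
  exact ⟨e.toLinearEquiv, fun x => e.map_app x⟩

theorem eval_ne_zero_of_even {f : k[X]} (hirr : Irreducible f) (he : Even f.natDegree) (c : k) :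
    f.eval c ≠ 0 := fun h => by
  have := natDegree_eq_of_degree_eq_some (degree_eq_one_of_irreducible_of_root hirr h)
  rw [this] at he
  exact absurd he (by decide)

theorem starPoly_X_sub_C {c : k} (hc : c * c = 1) : starPoly (X - C c) = X - C c := by
  have h : (X - C c : k[X]).reverse = 1 - C c * X := by
    rw [reverse, natDegree_X_sub_C, reflect_sub, reflect_one_X, reflect_C, pow_one]
  have h1 : (-c)⁻¹ = -c := inv_eq_of_mul_eq_one_left (by simpa using hc)
  rw [starPoly, h, coeff_sub, coeff_X_zero, coeff_C_zero, zero_sub, h1, mul_sub, ← mul_assoc,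
    ← C_mul, neg_mul, hc]
  simp
  ring

theorem IsInvForm.sqEq_of_even {f : k[X]} [FiniteDimensional k (QuotMod f)] (hm : f.Monic)
    (hirr : Irreducible f) (he : Even f.natDegree) {b b' : LinearMap.BilinForm k (QuotMod f)}
    (hb : IsInvForm b) (hb' : IsInvForm b') : SqEq (detOf b) (detOf b') := by
  refine sqEq_of_isSquare_mul hb.quadratic.detOf_ne_zero hb'.quadratic.detOf_ne_zero
    (mul_ne_zero ?_ ?_) hb.isSquare hb'.isSquare <;>
  · rw [charDet_quotMod hm]
    exact eval_ne_zero_of_even hirr he _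

theorem exists_isInvForm_complement (h2 : (2 : k) ≠ 0) {D : ModuleData k} (hss : D.Semisimple)
    {p₀ : D.Idx} (h₀ : D.IsIdx1 p₀.1) [FiniteDimensional k (QuotMod (D.f p₀.1))]
    {b : LinearMap.BilinForm k (QuotMod (D.f p₀.1))} (hb : IsInvForm b) {d : k} (hd0 : d ≠ 0)
    (hd : IsSquare (d * (D.charPoly.eval 1 * D.charPoly.eval (-1)))) :
    ∃ (R : Type) (_ : AddCommGroup R) (_ : Module k R) (_ : Module k[X] R)
      (_ : IsScalarTower k k[X] R) (_ : FiniteDimensional k R) (r : LinearMap.BilinForm k R),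
      IsInvForm r ∧ SqEq d (detOf b * detOf r) ∧
      Nonempty ((QuotMod (D.f p₀.1) × R) ≃ₗ[k[X]] D.SpaceVia (RingHom.id k)) := by
  obtain ⟨τ, hτ⟩ := D.exists_perm_idx
  have hm (p : D.Idx) := D.monic p.1
  have hirr (p : D.Idx) := D.irr p.1
  have hs : D.f p₀.1 = starPoly (D.f p₀.1) :=
    (starPoly_eq_self_of_symm (D.monic _) h₀.1).symm
  by_cases hF : D.charPoly.eval 1 * D.charPoly.eval (-1) = 0
  · have key : ∃ i, ∃ c : k, c * c = 1 ∧ (D.f i).eval c = 0 := by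
      have (c : k) (hc : D.charPoly.eval c = 0) : ∃ i, (D.f i).eval c = 0 := by
        rw [ModuleData.charPoly, eval_prod, Finset.prod_eq_zero_iff] at hc
        obtain ⟨i, -, hi⟩ := hc
        exact ⟨i, eq_zero_of_pow_eq_zero (n := D.n i * D.e i) (by rwa [← eval_pow])⟩
      rcases mul_eq_zero.1 hF with h | h
      · obtain ⟨i, hi⟩ := this _ h
        exact ⟨i, 1, by simp, hi⟩
      · obtain ⟨i, hi⟩ := this _ h
        exact ⟨i, -1, by simp, hi⟩
    obtain ⟨j, c, hc, hj⟩ := key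
    have hdeg : (D.f j).natDegree = 1 :=
      natDegree_eq_of_degree_eq_some (degree_eq_one_of_irreducible_of_root (D.irr j) hj)
    have hfj : D.f j = X - C c := by
      have h := (D.monic j).eq_X_add_C hdeg
      rw [h, eval_add, eval_X, eval_C] at hj
      rw [h, sub_eq_add_neg, ← C_neg, eq_neg_of_add_eq_zero_right hj]
    let p₁ : D.Idx := ⟨j, ⟨0, D.npos j⟩⟩
    have h₁ : D.f p₁.1 = starPoly (D.f p₁.1) := by
      change D.f j = starPoly (D.f j)
      rw [hfj, starPoly_X_sub_C hc]
    have hne : p₁ ≠ p₀ := by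
      intro h
      have := h₀.2
      rw [← h, hdeg] at this
      exact absurd this (by decide)
    obtain ⟨R, _, _, _, _, _, r, hr, ⟨e⟩⟩ :=
      exists_decomposition_two (g := fun p : D.Idx => D.f p.1) h2 hm hirr hτ hs h₁ hne
    have := finiteDimensional_quotMod (D.monic j).ne_zero
    have hrank : finrank k (QuotMod (D.f p₁.1)) = 1 := by
      rw [← hdeg]
      exact finrank_quotient_span_eq_natDegree
    obtain ⟨a, ha⟩ := exists_isInvForm_of_eq_starPoly h2 (hirr p₁) h₁
    have hb0 := hb.quadratic.detOf_ne_zero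
    have ha0 := ha.quadratic.detOf_ne_zero
    have hr0 := hr.quadratic.detOf_ne_zero
    have hx : d * detOf b * detOf a * detOf r ≠ 0 := by simp [*]
    refine ⟨QuotMod (D.f p₁.1) × R, inferInstance, inferInstance, inferInstance, inferInstance,
      inferInstance, _, (ha.smul hx).prod hr, ?_, ⟨e.trans hss.piEquiv⟩⟩
    refine SqEq.trans ?_ ((SqEq.refl _).mul (detOf_prodForm _ _).symm)
    rw [detOf_smul, hrank, pow_one]
    exact SqEq.symm ⟨detOf b * detOf a * detOf r, by simp [*], by ring⟩
  · obtain ⟨R, _, _, _, _, _, r, hr, ⟨e⟩⟩ :=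
      exists_decomposition (g := fun p : D.Idx => D.f p.1) h2 hm hirr hτ hs
    refine ⟨R, inferInstance, inferInstance, inferInstance, inferInstance, inferInstance, r, hr,
      (sqEq_of_isSquare_mul hd0 (hb.prod hr).quadratic.detOf_ne_zero hF hd ?_).trans
        (detOf_prodForm _ _), ⟨e.trans hss.piEquiv⟩⟩
    rw [← hss.charDet_eq, ← hss.charDet_eq, ← charDet_congr (e.trans hss.piEquiv),
      ← charDet_congr (e.trans hss.piEquiv)]
    exact (hb.prod hr).isSquare

theorem exists_isInvForm_not_isometric [Valued k (WithZero (Multiplicative ℤ))]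
    (hdisc : Function.Surjective (Valued.v : Valuation k (WithZero (Multiplicative ℤ))))
    (hc : IsCompact {x : k | Valued.v x ≤ 1}) (h2 : (2 : k) ≠ 0) {f : k[X]} (hm : f.Monic)
    (hirr : Irreducible f) (hf : f = starPoly f) (he : Even f.natDegree) :
    ∃ b b' : LinearMap.BilinForm k (QuotMod f), IsInvForm b ∧ IsInvForm b' ∧
      ¬∃ g : QuotMod f ≃ₗ[k] QuotMod f, ∀ x, b' (g x) (g x) = b x x := by
  have : Fact (Irreducible f) := ⟨hirr⟩
  have := finiteDimensional_quotMod hm.ne_zero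
  have : FiniteDimensional k (AdjoinRoot f) := Module.Finite.equiv (quotModEquiv f)
  have h0 : f.coeff 0 ≠ 0 := coeff_zero_ne_zero_of_starPoly (hf ▸ hirr.ne_zero)
  obtain ⟨i, s, hr, hi, hs, hs1⟩ := exists_involution h2 hf
  have ha : i (AdjoinRoot.root f) ≠ AdjoinRoot.root f := by
    intro h
    have hroot (c : k) (h : AdjoinRoot.root f = algebraMap k _ c) : False := by
      refine eval_ne_zero_of_even hirr he c ((algebraMap k (AdjoinRoot f)).injective ?_)
      rw [map_zero, ← Polynomial.aeval_algebraMap_apply_eq_algebraMap_eval, ← h,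
        AdjoinRoot.aeval_eq, AdjoinRoot.mk_self]
    have h1 : AdjoinRoot.root f * AdjoinRoot.root f = 1 := by
      nth_rewrite 1 [← h, hr]
      exact inv_mul_cancel₀ (root_ne_zero h0)
    rcases mul_self_eq_one_iff.1 h1 with h | h
    · exact hroot 1 (by simpa using h)
    · exact hroot (-1) (by simpa using h)
  obtain ⟨u, u', hu, hu', hu0, hu0', h⟩ := exists_hermForm_not_isometric hdisc hc h2 hi ha hs hs1
  refine ⟨_, _, isInvForm_hermForm h0 hr hi hs hs1 hu hu0, isInvForm_hermForm h0 hr hi hs hs1 hu'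
    hu0', fun ⟨g, hg⟩ => h ⟨((quotModEquiv f).symm.trans g).trans (quotModEquiv f), fun x => ?_⟩⟩
  simpa using hg ((quotModEquiv f).symm x)

end Assembly

/-- **Th. 7.1.** Over a non-archimedean local field `k` (complete with
respect to a (surjective) discrete valuation, with finite residue field), a quadratic
space `q` with `dim q = dim_k M`, where `M` is semi-simple with `M¹ ≠ 0`, has an
isometry with module `M` iff `det(q)·F_M(1)·F_M(−1)` is a square in `k`. -/
theorem hasIsometryWithModule_iff_isSquare_of_localField
    {k : Type} [Field k] [Valued k (WithZero (Multiplicative ℤ))] [CompleteSpace k]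
    (hdisc : Function.Surjective
      (Valued.v : Valuation k (WithZero (Multiplicative ℤ))))
    (hres : Finite (Valued.ResidueField k))
    (hchar : (2 : k) ≠ 0)
    (D : ModuleData k) (hss : D.Semisimple) (hM1 : ∃ i, D.IsIdx1 i)
    {V : Type} [AddCommGroup V] [Module k V] [FiniteDimensional k V]
    (B : LinearMap.BilinForm k V) (hq : IsQuadraticSpace B)
    (hdim : Module.finrank k V = D.dim) :
    HasIsometryWithModule B D ↔
      IsSquare (detOf B * (D.charPoly.eval 1 * D.charPoly.eval (-1))) := by
  constructor
  · rintro ⟨t, ht, φ, hφ⟩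
    have := isSquare_detOf_mul_charDet hq ht φ hφ
    rwa [hss.charDet_eq, hss.charDet_eq] at this
  · intro hsq
    obtain ⟨i, hi⟩ := hM1
    have hc := isCompact_integer hdisc hres
    obtain ⟨b, b', hb, hb', hne⟩ := exists_isInvForm_not_isometric hdisc hc hchar (D.monic i)
      (D.irr i) (starPoly_eq_self_of_symm (D.monic i) hi.1).symm hi.2
    have := finiteDimensional_quotMod (D.monic i).ne_zero
    let p₀ : D.Idx := ⟨i, ⟨0, D.npos i⟩⟩
    obtain ⟨R, _, _, _, _, _, r, hr, hd, ⟨e⟩⟩ := exists_isInvForm_complement hchar hss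
      (p₀ := p₀) hi hb hq.detOf_ne_zero hsq
    have hrank : Module.finrank k (QuotMod (D.f i) × R) = Module.finrank k V := by
      rw [hdim, ← hss.finrank_eq, (e.restrictScalars k).finrank_eq]
    rcases exists_isometry_prodForm hchar
      (QuadraticSpace.localAnisotropy hchar hc hres hdisc) hq hb.quadratic hb'.quadratic
      hr.quadratic hrank hd (hb.sqEq_of_even (D.monic i) (D.irr i) hi.2 hb') hne with
      ⟨g, hg⟩ | ⟨g, hg⟩
    · exact hasIsometryWithModule_of_isInvForm (hb.prod hr) e g hg
    · exact hasIsometryWithModule_of_isInvForm (hb'.prod hr) e g hg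

end
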